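/- Let ψ_0, ψ ∈ 𝒮(ℝⁿ) satisfy the Tauberian conditions for some ε > 0, let 0 < p_i < ∞ (i = 1,…,n), 0 < q ≤ ∞ and s ∈ ℝ, and let r = (r_1,…,r_n) satisfy r_l·min(q, p_1,…,p_n) > 1 for each l. Then there exists a constant c > 0 such that for every f ∈ 𝒮′(ℝⁿ): ‖(2^{sj} ψ_j^*f)_{j≥0} | L_{p̄}(ℓ_q)‖ ≤ c · ‖(2^{sj} ψ_j*f)_{j≥0} | L_{p̄}(ℓ_q)‖. -/

import Mathlib

open MeasureTheory Complex
open scoped ENNReal NNReal BigOperators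

noncomputable section

/-- Points of `ℝⁿ`, written `x = (x 0, …, x (n-1))`. -/
abbrev RV (n : ℕ) := Fin n → ℝ

/-- Tempered distributions `𝒮′(ℝⁿ)`. -/
abbrev TD (n : ℕ) := SchwartzMap (RV n) ℂ →L[ℂ] ℂ

/-- The Fourier transform `𝓕g(ξ) = ∫ e^{-i x·ξ} g(x) dx`. -/
def FT (n : ℕ) (g : RV n → ℂ) (ξ : RV n) : ℂ :=
  ∫ x : RV n, Complex.exp (-Complex.I * ((∑ i, x i * ξ i : ℝ) : ℂ)) * g x

/-- The partial derivative `∂_i`. -/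
def pderiv1 (n : ℕ) (i : Fin n) (g : RV n → ℂ) : RV n → ℂ :=
  fun x => fderiv ℝ g x (Pi.single i 1)

def pderivIter (n : ℕ) (i : Fin n) : ℕ → (RV n → ℂ) → RV n → ℂ
  | 0, g => g
  | k + 1, g => pderiv1 n i (pderivIter n i k g)

/-- `D^α = (-i ∂_1)^{α_1} ⋯ (-i ∂_n)^{α_n}`. -/
def Dop (n : ℕ) (α : Fin n → ℕ) (g : RV n → ℂ) : RV n → ℂ :=
  fun x => (-Complex.I) ^ (∑ i, α i) *
    ((List.finRange n).foldr (fun i h => pderivIter n i (α i) h) g) x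

/-- `anorm` is the anisotropic distance function `|·|_a` :
`anorm 0 = 0`, and for `x ≠ 0`, `anorm x` is the (unique) `t > 0` with
`x 1 ^ 2 / t ^ (2 a 1) + … + x n ^ 2 / t ^ (2 a n) = 1`. -/
def IsAnorm (n : ℕ) (a : Fin n → ℝ) (anorm : RV n → ℝ) : Prop :=
  anorm 0 = 0 ∧
    ∀ x : RV n, x ≠ 0 → 0 < anorm x ∧ ∑ i, (x i : ℝ) ^ 2 / (anorm x) ^ (2 * a i) = 1

/-- Moment condition of order `M` : `D^α (𝓕ψ)(0) = 0` for all `|α| ≤ M` (void for `M = -1`). -/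
def MomentCond (n : ℕ) (M : ℤ) (ψ : RV n → ℂ) : Prop :=
  ∀ α : Fin n → ℕ, (∑ i, (α i : ℤ)) ≤ M → Dop n α (FT n ψ) 0 = 0

/-- Tauberian conditions for `ε > 0` for the pair `(ψ0, ψ)`. -/
def Tauber (n : ℕ) (anorm : RV n → ℝ) (ψ0 ψ : RV n → ℂ) (ε : ℝ) : Prop :=
  (∀ ξ, anorm ξ < 2 * ε → 0 < ‖FT n ψ0 ξ‖) ∧
    (∀ ξ, ε / 2 < anorm ξ → anorm ξ < 2 * ε → 0 < ‖FT n ψ ξ‖)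

/-- The family `φ_j`, `φ_0` at `j = 0` and `φ_j(x) = 2^{j|a|} φ(2^{ja}x)` for `j ≥ 1`. -/
def fam (n : ℕ) (a : Fin n → ℝ) (φ0 φ : RV n → ℂ) : ℕ → RV n → ℂ
  | 0 => φ0
  | j + 1 => fun x =>
      (((2 : ℝ) ^ (((j : ℝ) + 1) * ∑ i, a i) : ℝ) : ℂ) *
        φ (fun i => (2 : ℝ) ^ (((j : ℝ) + 1) * a i) * x i)

/-- Peetre–Fefferman–Stein maximal function attached to the function `F` (intended: `F = ψ_j * f`). -/
def pfs (n : ℕ) (a r : Fin n → ℝ) (F : RV n → ℂ) (j : ℕ) (x : RV n) : ℝ≥0∞ :=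
  ⨆ y : RV n,
    ENNReal.ofReal (‖F y‖ / ∏ l, (1 + (2 : ℝ) ^ ((j : ℝ) * a l) * |x l - y l|) ^ (r l))

/-- Iterated-integral construction of the mixed Lebesgue norm : integrate out the
coordinates one at a time, first `x 0`, last `x (n-1)`. -/
def mixAux (n : ℕ) (p : Fin n → ℝ≥0∞) : ℕ → ((RV n) → ℝ≥0∞) → (RV n) → ℝ≥0∞
  | 0, F => F
  | l + 1, F => fun x =>
      if h : l < n then
        (if p ⟨l, h⟩ = ∞ then
          essSup (fun t : ℝ => mixAux n p l F (Function.update x ⟨l, h⟩ t)) volume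
        else
          (∫⁻ t : ℝ, (mixAux n p l F (Function.update x ⟨l, h⟩ t)) ^ (p ⟨l, h⟩).toReal) ^
            (1 / (p ⟨l, h⟩).toReal))
      else mixAux n p l F x

/-- The mixed Lebesgue quasi-norm `‖F | L_{p̄}‖` of an extended-nonnegative-valued `F`. -/
def mixedNorm (n : ℕ) (p : Fin n → ℝ≥0∞) (F : RV n → ℝ≥0∞) : ℝ≥0∞ :=
  mixAux n p n F fun _ => 0

/-- `‖(u_k) | L_{p̄}(ℓ_q)‖`. -/
def seqNorm (n : ℕ) (p : Fin n → ℝ≥0∞) (q : ℝ≥0∞) (u : ℕ → RV n → ℝ≥0∞) : ℝ≥0∞ :=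
  mixedNorm n p fun x =>
    if q = ∞ then ⨆ k, u k x else (∑' k, u k x ^ q.toReal) ^ (1 / q.toReal)

/-- Convolution of (Schwartz) functions. -/
def conv2 (n : ℕ) (f g : RV n → ℂ) (x : RV n) : ℂ := ∫ y : RV n, f y * g (x - y)

/-- Schwartz seminorm `p_{α,β}(φ) = sup_x |x^α D^β φ(x)|`, valued in `[0,∞]`. -/
def pSemiE (n : ℕ) (α β : Fin n → ℕ) (g : RV n → ℂ) : ℝ≥0∞ :=
  ⨆ x : RV n, (‖((∏ i, x i ^ α i : ℝ) : ℂ) * Dop n β g x‖₊ : ℝ≥0∞)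

/-- Schwartz seminorm `q_{N,γ}(φ) = ∫ (1+|x|²)^{N/2} |D^γ φ(x)| dx`, valued in `[0,∞]`. -/
def qSemiE (n : ℕ) (N : ℝ) (γ : Fin n → ℕ) (g : RV n → ℂ) : ℝ≥0∞ :=
  ∫⁻ x : RV n, ENNReal.ofReal ((1 + ∑ i, (x i) ^ 2) ^ (N / 2)) * (‖Dop n γ g x‖₊ : ℝ≥0∞)

/-- Iterated Laplacian `Δ^N`. -/
def lapIter (n : ℕ) : ℕ → (RV n → ℂ) → RV n → ℂ
  | 0, g => g
  | N + 1, g => fun x => ∑ i, pderiv1 n i (pderiv1 n i (lapIter n N g)) x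

/-- The box `B_{R,j} = {ξ : |ξ_k| ≤ R 2^{j a_k}}`. -/
def specBox (n : ℕ) (a : Fin n → ℝ) (R : ℝ) (j : ℕ) : Set (RV n) :=
  {ξ | ∀ k, |ξ k| ≤ R * (2 : ℝ) ^ ((j : ℝ) * a k)}

/-- The spectral condition `supp 𝓕u ⊆ B_{R,j}` for a temperate-growth function `u`. -/
def SpecCond (n : ℕ) (a : Fin n → ℝ) (R : ℝ) (j : ℕ) (u : RV n → ℂ) : Prop :=
  ∀ φ : SchwartzMap (RV n) ℂ,
    tsupport (⇑φ) ∩ specBox n a R j = ∅ → (∫ x : RV n, u x * FT n (⇑φ) x) = 0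

/-- The maximal function `u^*` of Section 3. -/
def ustar (n : ℕ) (a r : Fin n → ℝ) (R : ℝ) (j : ℕ) (u : RV n → ℂ) (x : RV n) : ℝ≥0∞ :=
  ⨆ y : RV n,
    ENNReal.ofReal (‖u y‖ / ∏ l, (1 + R * (2 : ℝ) ^ ((j : ℝ) * a l) * |x l - y l|) ^ (r l))


lemma pf_layer (F G : ℝ → ℝ≥0∞) (hF : Measurable F) (hG : Measurable G) (W : ℝ≥0∞)
    (h : ∀ t : ℝ, 0 < t → ENNReal.ofReal t * volume {x | ENNReal.ofReal (2 * t) < F x} ≤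
      W * ∫⁻ x in {x | ENNReal.ofReal t < F x}, G x) (P : ℝ) (hP : 1 < P) (Λ : ℝ) (hΛ : 0 < Λ) :
    ∫⁻ x, (min (F x) (ENNReal.ofReal Λ)) ^ P ≤
      (2 * W * ENNReal.ofReal P * ENNReal.ofReal (P - 1)⁻¹ * 2 ^ (P - 1)) *
        ∫⁻ x, (min (F x) (ENNReal.ofReal Λ)) ^ (P - 1) * G x := by
  set f : ℝ → ℝ := fun x => (min (F x) (ENNReal.ofReal Λ)).toReal with hf
  have hfm : Measurable f := (hF.min measurable_const).ennreal_toReal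
  have hf0 : ∀ x, 0 ≤ f x := fun x => ENNReal.toReal_nonneg
  have hfe : ∀ x, min (F x) (ENNReal.ofReal Λ) = ENNReal.ofReal (f x) := fun x => by
    rw [hf, ENNReal.ofReal_toReal]
    exact ne_top_of_le_ne_top ENNReal.ofReal_ne_top (min_le_right _ _)
  have hlt : ∀ t x, 0 ≤ t → (t < f x ↔ (ENNReal.ofReal t < F x ∧ t < Λ)) := by
    intro t x ht
    rw [← ENNReal.ofReal_lt_ofReal_iff_of_nonneg ht, ← hfe, lt_min_iff,
      ENNReal.ofReal_lt_ofReal_iff_of_nonneg ht]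
  have e1 : ∫⁻ x, (min (F x) (ENNReal.ofReal Λ)) ^ P = ∫⁻ x, ENNReal.ofReal (f x ^ P) := by
    refine lintegral_congr fun x => ?_
    rw [hfe, ENNReal.ofReal_rpow_of_nonneg (hf0 x) (by linarith)]
  have e2 : ∫⁻ x, (min (F x) (ENNReal.ofReal Λ)) ^ (P - 1) * G x =
      ∫⁻ x, ENNReal.ofReal (f x ^ (P - 1)) ∂(volume.withDensity G) := by
    rw [lintegral_withDensity_eq_lintegral_mul _ hG (by fun_prop)]
    refine lintegral_congr fun x => ?_
    rw [hfe, ENNReal.ofReal_rpow_of_nonneg (hf0 x) (by linarith), Pi.mul_apply, mul_comm]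
  have e3 : ∫⁻ x, ENNReal.ofReal ((2 * f x) ^ (P - 1)) ∂(volume.withDensity G) =
     2 ^ (P - 1) * ∫⁻ x, ENNReal.ofReal (f x ^ (P - 1)) ∂(volume.withDensity G) := by
    rw [← lintegral_const_mul _ (by fun_prop)]
    refine lintegral_congr fun x => ?_
    rw [Real.mul_rpow (by norm_num) (hf0 x), ENNReal.ofReal_mul (by positivity),
      ← ENNReal.ofReal_rpow_of_nonneg (by norm_num) (by linarith)]
    simp
  rw [e1, e2, lintegral_rpow_eq_lintegral_meas_lt_mul volume (Filter.Eventually.of_forall hf0)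
    hfm.aemeasurable (by linarith)]
  have e4 := lintegral_rpow_eq_lintegral_meas_lt_mul (volume.withDensity G) (f := fun x => 2 * f x)
    (Filter.Eventually.of_forall fun x => by have := hf0 x; positivity)
    (by fun_prop) (p := P - 1) (by linarith)
  have key : ∫⁻ t in Set.Ioi (0:ℝ), volume {a | t < f a} * ENNReal.ofReal (t ^ (P - 1)) ≤
     2 * W * ∫⁻ t in Set.Ioi (0:ℝ), (volume.withDensity G) {a | t < 2 * f a} *
        ENNReal.ofReal (t ^ (P - 1 - 1)) := by
    have hmono : Measurable fun t : ℝ => (volume.withDensity G) {a | t < 2 * f a} := by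
      apply Antitone.measurable
      intro s t hst
      exact measure_mono fun a (ha : t < 2 * f a) => lt_of_le_of_lt hst ha
    rw [← lintegral_const_mul _ (by fun_prop)]
    refine setLIntegral_mono (by fun_prop) fun t ht => ?_
    have ht : 0 < t := ht
    rw [withDensity_apply _ (measurableSet_lt (by fun_prop) (by fun_prop))]
    have h1 := h (t / 2) (by positivity)
    rw [show 2 * (t / 2) = t by ring] at h1
    by_cases htΛ : t < Λ
    · have s1 : {a | t < f a} = {x | ENNReal.ofReal t < F x} := by
        ext x; simp [hlt t x ht.le, htΛ]
      have s2 : {a | t < 2 * f a} = {x | ENNReal.ofReal (t / 2) < F x} := by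
        ext x
        have : t < 2 * f x ↔ t / 2 < f x := by constructor <;> intro <;> linarith
        simp only [Set.mem_setOf_eq, this]
        rw [hlt (t/2) x (by positivity)]
        simp only [and_iff_left_iff_imp]; intro; linarith
      rw [s1, s2]
      have : ENNReal.ofReal (t ^ (P - 1)) = 2 * (ENNReal.ofReal (t / 2) * ENNReal.ofReal (t ^ (P - 1 - 1))) := by
        rw [← ENNReal.ofReal_mul (by positivity), show (2:ℝ≥0∞) = ENNReal.ofReal 2 by simp,
          ← ENNReal.ofReal_mul (by positivity)]
        congr 1
        rw [Real.rpow_sub_one ht.ne' (P - 1)]; field_simp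
      rw [this]
      calc _ = 2 * (ENNReal.ofReal (t / 2) * volume {x | ENNReal.ofReal t < F x}) * ENNReal.ofReal (t ^ (P - 1 - 1)) := by ring
        _ ≤ 2 * (W * ∫⁻ x in {x | ENNReal.ofReal (t / 2) < F x}, G x) * ENNReal.ofReal (t ^ (P - 1 - 1)) := by gcongr
        _ = _ := by ring
    · have s1 : {a | t < f a} = ∅ := by
        ext x; simp only [Set.mem_setOf_eq, hlt t x ht.le]; simp; intro _; linarith
      rw [s1]; simp
  have hP1 : ENNReal.ofReal (P - 1)⁻¹ * ENNReal.ofReal (P - 1) = 1 := by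
    rw [← ENNReal.ofReal_mul (by simp; linarith), inv_mul_cancel₀ (by linarith)]; simp
  calc _ ≤ ENNReal.ofReal P * (2 * W * ∫⁻ t in Set.Ioi (0:ℝ), (volume.withDensity G) {a | t < 2 * f a} *
        ENNReal.ofReal (t ^ (P - 1 - 1))) := by gcongr
    _ = 2 * W * ENNReal.ofReal P * (ENNReal.ofReal (P - 1)⁻¹ * ENNReal.ofReal (P - 1)) * (∫⁻ t in Set.Ioi (0:ℝ), (volume.withDensity G) {a | t < 2 * f a} *
        ENNReal.ofReal (t ^ (P - 1 - 1))) := by rw [hP1]; ring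
    _ = 2 * W * ENNReal.ofReal P * ENNReal.ofReal (P - 1)⁻¹ * (ENNReal.ofReal (P - 1) * (∫⁻ t in Set.Ioi (0:ℝ), (volume.withDensity G) {a | t < 2 * f a} *
        ENNReal.ofReal (t ^ (P - 1 - 1)))) := by ring
    _ = _ := by rw [← e4, e3]; ring

/-- constant in the Doob type inequality -/
def pfC (W : ℝ≥0∞) (P : ℝ) : ℝ≥0∞ :=
  let c := (2 * W * ENNReal.ofReal P * ENNReal.ofReal (P - 1)⁻¹ * 2 ^ (P - 1)) + 1
  2 * c * (2 * c) ^ (P - 1)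

lemma pfC_ne_top (W : ℝ≥0∞) (P : ℝ) (hP : 1 < P) (hW : W ≠ ∞) : pfC W P ≠ ∞ := by
  have : (2 * W * ENNReal.ofReal P * ENNReal.ofReal (P - 1)⁻¹ * 2 ^ (P - 1)) + 1 ≠ ∞ := by
    have : (2:ℝ≥0∞) ^ (P - 1) ≠ ∞ := ENNReal.rpow_ne_top_of_nonneg (by linarith) (by simp)
    finiteness
  unfold pfC
  have h2 : (2 * ((2 * W * ENNReal.ofReal P * ENNReal.ofReal (P - 1)⁻¹ * 2 ^ (P - 1)) + 1)) ^ (P - 1) ≠ ∞ :=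
    ENNReal.rpow_ne_top_of_nonneg (by linarith) (ENNReal.mul_ne_top (by simp) this)
  exact ENNReal.mul_ne_top (ENNReal.mul_ne_top (by simp) this) h2

lemma pf_doob (F G : ℝ → ℝ≥0∞) (hF : Measurable F) (hG : Measurable G) (W : ℝ≥0∞) (hW : W ≠ ∞)
    (h : ∀ t : ℝ, 0 < t → ENNReal.ofReal t * volume {x | ENNReal.ofReal (2 * t) < F x} ≤
      W * ∫⁻ x in {x | ENNReal.ofReal t < F x}, G x) (P : ℝ) (hP : 1 < P) (hGi : ∫⁻ x, G x ≠ ∞) :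
    ∫⁻ x, F x ^ P ≤ pfC W P * ∫⁻ x, G x ^ P := by
  set c := (2 * W * ENNReal.ofReal P * ENNReal.ofReal (P - 1)⁻¹ * 2 ^ (P - 1)) + 1 with hc
  have hct : c ≠ ∞ := by
    have : (2:ℝ≥0∞) ^ (P - 1) ≠ ∞ := ENNReal.rpow_ne_top_of_nonneg (by linarith) (by simp)
    rw [hc]; finiteness
  have hc1 : 1 ≤ c := by rw [hc]; exact le_add_self
  have hc0 : c ≠ 0 := (lt_of_lt_of_le one_pos hc1).ne'
  have main : ∀ m : ℕ, ∫⁻ x, (min (F x) (ENNReal.ofReal ((m:ℝ) + 1))) ^ P ≤ pfC W P * ∫⁻ x, G x ^ P := by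
    intro m
    have hm : (0:ℝ) < m + 1 := by positivity
    have h1 := pf_layer F G hF hG W h P hP ((m:ℝ) + 1) hm
    set F' : ℝ → ℝ≥0∞ := fun x => min (F x) (ENNReal.ofReal ((m:ℝ) + 1)) with hF'
    have hF'm : Measurable F' := hF.min measurable_const
    have h2 : ∫⁻ x, F' x ^ P ≤ c * ∫⁻ x, F' x ^ (P - 1) * G x :=
      h1.trans (by gcongr; rw [hc]; exact le_self_add)
    have hfin : ∫⁻ x, F' x ^ P ≠ ∞ := by
      refine ne_top_of_le_ne_top ?_ h2
      refine ENNReal.mul_ne_top hct ?_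
      refine ne_top_of_le_ne_top (b := (ENNReal.ofReal ((m:ℝ) + 1)) ^ (P - 1) * ∫⁻ x, G x) ?_ ?_
      · exact ENNReal.mul_ne_top (ENNReal.rpow_ne_top_of_nonneg (by linarith) ENNReal.ofReal_ne_top) hGi
      · rw [← lintegral_const_mul _ hG]
        refine lintegral_mono fun x => ?_
        exact mul_le_mul_left (ENNReal.rpow_le_rpow (min_le_right _ _) (by linarith)) _
    have hpt : ∀ x, F' x ^ (P - 1) * G x ≤ (2 * c)⁻¹ * F' x ^ P + (2 * c) ^ (P - 1) * G x ^ P := by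
      intro x
      have h2c0 : 2 * c ≠ 0 := by simp [hc0]
      have h2ct : 2 * c ≠ ∞ := ENNReal.mul_ne_top (by simp) hct
      have hsplit : ∀ y : ℝ≥0∞, y ^ (P - 1) * y = y ^ P := by
        intro y
        conv_rhs => rw [show P = (P - 1) + 1 by ring, ENNReal.rpow_add_of_nonneg _ _ (by linarith) (by norm_num), ENNReal.rpow_one]
      by_cases hx : G x ≤ (2 * c)⁻¹ * F' x
      · refine le_trans ?_ le_self_add
        calc _ ≤ F' x ^ (P - 1) * ((2 * c)⁻¹ * F' x) := by gcongr
          _ = (2 * c)⁻¹ * (F' x ^ (P - 1) * F' x) := by ring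
          _ = _ := by rw [hsplit]
      · refine le_trans ?_ le_add_self
        push Not at hx
        have : F' x ≤ (2 * c) * G x := by
          have := mul_le_mul_right hx.le (2 * c)
          rwa [← mul_assoc, ENNReal.mul_inv_cancel h2c0 h2ct, one_mul] at this
        calc _ ≤ ((2 * c) * G x) ^ (P - 1) * G x := by gcongr
          _ = (2 * c) ^ (P - 1) * (G x ^ (P - 1) * G x) := by
            rw [ENNReal.mul_rpow_of_nonneg _ _ (by linarith)]; ring
          _ = _ := by rw [hsplit]
    have h3 : ∫⁻ x, F' x ^ P ≤ 2⁻¹ * (∫⁻ x, F' x ^ P) + c * (2 * c) ^ (P - 1) * ∫⁻ x, G x ^ P := by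
      calc _ ≤ c * ∫⁻ x, F' x ^ (P - 1) * G x := h2
        _ ≤ c * ∫⁻ x, ((2 * c)⁻¹ * F' x ^ P + (2 * c) ^ (P - 1) * G x ^ P) := by
          gcongr with x; exact hpt x
        _ = (c * (2 * c)⁻¹) * (∫⁻ x, F' x ^ P) + c * (2 * c) ^ (P - 1) * ∫⁻ x, G x ^ P := by
          rw [lintegral_add_left (by fun_prop), lintegral_const_mul _ (by fun_prop), lintegral_const_mul _ (by fun_prop)]; ring
        _ = _ := by
          rw [ENNReal.mul_inv (by simp) (by simp), mul_left_comm, ENNReal.mul_inv_cancel hc0 hct, mul_one]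
    set I := ∫⁻ x, F' x ^ P
    have h4 : 2⁻¹ * I ≤ c * (2 * c) ^ (P - 1) * ∫⁻ x, G x ^ P := by
      have h5 : I = 2⁻¹ * I + 2⁻¹ * I := by
        rw [← add_mul, ENNReal.inv_two_add_inv_two, one_mul]
      have : 2⁻¹ * I + 2⁻¹ * I ≤ 2⁻¹ * I + c * (2 * c) ^ (P - 1) * ∫⁻ x, G x ^ P := by
        rw [← h5]; exact h3
      exact (ENNReal.add_le_add_iff_left (ENNReal.mul_ne_top (by simp) hfin)).1 this
    calc I = 2 * (2⁻¹ * I) := by rw [← mul_assoc, ENNReal.mul_inv_cancel (by simp) (by simp), one_mul]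
      _ ≤ 2 * (c * (2 * c) ^ (P - 1) * ∫⁻ x, G x ^ P) := by gcongr
      _ = _ := by simp only [pfC, ← hc]; ring
  have hsup : ∀ x, F x ^ P = ⨆ m : ℕ, (min (F x) (ENNReal.ofReal ((m:ℝ) + 1))) ^ P := by
    intro x
    have hmono : Monotone fun m : ℕ => (min (F x) (ENNReal.ofReal ((m:ℝ) + 1))) := by
      intro a b hab; dsimp only; gcongr
    have ht : Filter.Tendsto (fun m : ℕ => (min (F x) (ENNReal.ofReal ((m:ℝ) + 1)))) Filter.atTop (nhds (min (F x) ∞)) := by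
      refine Filter.Tendsto.min tendsto_const_nhds ?_
      exact ENNReal.tendsto_ofReal_atTop.comp (Filter.tendsto_atTop_add_const_right _ _ tendsto_natCast_atTop_atTop)
    rw [min_eq_left le_top] at ht
    have := ((ENNReal.continuous_rpow_const (y := P)).tendsto _).comp ht
    refine tendsto_nhds_unique this (tendsto_atTop_iSup ?_)
    intro a b hab
    exact ENNReal.rpow_le_rpow (hmono hab) (by linarith)
  simp_rw [hsup]
  rw [lintegral_iSup (fun m => by fun_prop)]
  · exact iSup_le main
  · intro a b hab x
    dsimp only
    gcongr


/-- nested grids on the line -/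
structure GridS where
  ix : ℕ → ℝ → ℤ
  meas : ∀ n, Measurable (ix n)
  nest : ∀ n s t, ix (n+1) s = ix (n+1) t → ix n s = ix n t
  vol0 : ∀ n t, volume {s | ix n s = ix n t} ≠ 0
  volT : ∀ n t, volume {s | ix n s = ix n t} ≠ ∞
  dbl : ∀ n t, volume {s | ix n s = ix n t} ≤ 2 * volume {s | ix (n+1) s = ix (n+1) t}

namespace GridS
variable (G : GridS)

def avgI (n : ℕ) (g : ℝ → ℝ≥0∞) (i : ℤ) : ℝ≥0∞ :=
  (volume {s | G.ix n s = i})⁻¹ * ∫⁻ s in {s | G.ix n s = i}, g s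

def avg (n : ℕ) (g : ℝ → ℝ≥0∞) (t : ℝ) : ℝ≥0∞ := G.avgI n g (G.ix n t)

def Inv (n : ℕ) (B : Set ℝ) : Prop := ∀ s t, G.ix n s = G.ix n t → s ∈ B → t ∈ B

lemma mcell (n : ℕ) (i : ℤ) : MeasurableSet {s | G.ix n s = i} :=
  G.meas n (measurableSet_singleton i)

lemma nest_le {m n : ℕ} (h : m ≤ n) : ∀ s t, G.ix n s = G.ix n t → G.ix m s = G.ix m t := by
  induction n, h using Nat.le_induction with
  | base => intro s t h; exact h
  | succ n _ ih => intro s t h; exact ih s t (G.nest n s t h)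

lemma Inv.mono {m n : ℕ} (h : m ≤ n) {B : Set ℝ} (hB : G.Inv m B) : G.Inv n B :=
  fun s t hst hs => hB s t (G.nest_le h s t hst) hs

lemma Inv.inter {n : ℕ} {B C : Set ℝ} (hB : G.Inv n B) (hC : G.Inv n C) : G.Inv n (B ∩ C) :=
  fun s t hst hs => ⟨hB s t hst hs.1, hC s t hst hs.2⟩

lemma inv_cell (n : ℕ) (i : ℤ) : G.Inv n {s | G.ix n s = i} := fun s t hst hs => by
  simp only [Set.mem_ofPred_eq] at *; rw [← hst, hs]

lemma avg_congr {n : ℕ} (g : ℝ → ℝ≥0∞) {s t : ℝ} (h : G.ix n s = G.ix n t) :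
    G.avg n g s = G.avg n g t := by simp [avg, h]

lemma avg_meas {Ω : Type*} [MeasurableSpace Ω] (n : ℕ) (g : Ω → ℝ → ℝ≥0∞)
    (hg : Measurable fun p : Ω × ℝ => g p.1 p.2) :
    Measurable fun p : Ω × ℝ => G.avg n (g p.1) p.2 := by
  have h : Measurable fun q : Ω × ℤ => G.avgI n (g q.1) q.2 := by
    refine measurable_from_prod_countable_left fun i => ?_
    simp only [avgI]
    exact (Measurable.lintegral_prod_right' (f := fun p : Ω × ℝ => g p.1 p.2) hg).const_mul _
  have h2 : Measurable fun p : Ω × ℝ => (p.1, G.ix n p.2) :=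
    measurable_fst.prodMk ((G.meas n).comp measurable_snd)
  have h3 := h.comp h2
  simpa only [Function.comp_def, avg] using h3

lemma avg_meas1 (n : ℕ) (g : ℝ → ℝ≥0∞) : Measurable (G.avg n g) := by
  have h : Measurable (G.avgI n g) := measurable_from_top
  exact h.comp (G.meas n)

lemma int_avg (n : ℕ) (g : ℝ → ℝ≥0∞) (B : Set ℝ) (hB : MeasurableSet B) (hi : G.Inv n B) :
    ∫⁻ t in B, G.avg n g t = ∫⁻ t in B, g t := by
  have hu : B = ⋃ i : ℤ, B ∩ {s | G.ix n s = i} := by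
    ext x; simp
  have hd : Pairwise (Function.onFun Disjoint fun i : ℤ => B ∩ {s | G.ix n s = i}) := by
    intro i j hij
    refine Set.disjoint_left.2 ?_
    rintro x ⟨_, h1⟩ ⟨_, h2⟩
    exact hij (h1.symm.trans h2)
  rw [hu, lintegral_iUnion (fun i => hB.inter (G.mcell n i)) hd,
    lintegral_iUnion (fun i => hB.inter (G.mcell n i)) hd]
  refine tsum_congr fun i => ?_
  by_cases hne : (B ∩ {s | G.ix n s = i}).Nonempty
  · obtain ⟨x, hxB, hx⟩ := hne
    have hx : G.ix n x = i := hx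
    have e : B ∩ {s | G.ix n s = i} = {s | G.ix n s = i} := by
      refine Set.inter_eq_right.2 fun s hs => hi x s (hx.trans (Eq.symm hs)) hxB
    rw [e]
    have : ∫⁻ t in {s | G.ix n s = i}, G.avg n g t = ∫⁻ t in {s | G.ix n s = i}, G.avgI n g i := by
      refine setLIntegral_congr_fun (G.mcell n i) fun t ht => ?_
      have ht : G.ix n t = i := ht
      simp [avg, ht]
    rw [this, setLIntegral_const, avgI, mul_right_comm, ← hx, ENNReal.inv_mul_cancel (G.vol0 n x) (G.volT n x), one_mul]
  · rw [Set.not_nonempty_iff_eq_empty.1 hne]; simp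

lemma int_avg_univ (n : ℕ) (g : ℝ → ℝ≥0∞) : ∫⁻ t, G.avg n g t = ∫⁻ t, g t := by
  simpa using G.int_avg n g Set.univ MeasurableSet.univ (fun _ _ _ _ => trivial)

lemma avg_mono (n : ℕ) {g h : ℝ → ℝ≥0∞} (hgh : ∀ t, g t ≤ h t) (t : ℝ) : G.avg n g t ≤ G.avg n h t := by
  unfold avg avgI; gcongr with s; exact hgh s

lemma avg_dbl (n : ℕ) (g : ℝ → ℝ≥0∞) (t : ℝ) : G.avg (n+1) g t ≤ 2 * G.avg n g t := by
  unfold avg avgI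
  rw [← mul_assoc]
  refine mul_le_mul' ?_ ?_
  · have := ENNReal.inv_le_inv.2 (G.dbl n t)
    rw [ENNReal.mul_inv (by simp) (by simp)] at this
    have := mul_le_mul_right this 2
    rwa [← mul_assoc, ENNReal.mul_inv_cancel (by simp) (by simp), one_mul] at this
  · exact lintegral_mono_set fun s hs => G.nest n s t hs

/-- Jensen -/
lemma avg_rpow (n : ℕ) (g : ℝ → ℝ≥0∞) (hg : Measurable g) (P : ℝ) (hP : 1 ≤ P) (t : ℝ) :
    (G.avg n g t) ^ P ≤ G.avg n (fun s => g s ^ P) t := by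
  have h0 := G.vol0 n t
  have hT := G.volT n t
  unfold avg avgI
  set C := {s | G.ix n s = G.ix n t}
  have : IsProbabilityMeasure ((volume C)⁻¹ • volume.restrict C) := ⟨by
    simp [ENNReal.inv_mul_cancel h0 hT]⟩
  rcases hP.eq_or_lt with rfl | hP
  · simp
  have hc : P.HolderConjugate (P / (P - 1)) := Real.HolderConjugate.conjExponent hP
  have := ENNReal.lintegral_mul_le_Lp_mul_Lq ((volume C)⁻¹ • volume.restrict C) hc hg.aemeasurable (aemeasurable_const (b := (1:ℝ≥0∞)))
  simp only [Pi.mul_apply, mul_one, ENNReal.one_rpow, lintegral_const, measure_univ] at this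
  rw [lintegral_smul_measure, lintegral_smul_measure, smul_eq_mul, smul_eq_mul] at this
  have := ENNReal.rpow_le_rpow this (by linarith : 0 ≤ P)
  rwa [← ENNReal.rpow_mul, one_div_mul_cancel (by linarith), ENNReal.rpow_one] at this

/-- first entrance sets -/
def fst (E : ℕ → Set ℝ) (n : ℕ) : Set ℝ := {t | t ∈ E n ∧ ∀ m < n, t ∉ E m}

lemma fst_meas {E : ℕ → Set ℝ} (hE : ∀ n, MeasurableSet (E n)) (n : ℕ) : MeasurableSet (fst E n) := by
  have : fst E n = E n ∩ ⋂ m, ⋂ (_ : m < n), (E m)ᶜ := by ext; simp [fst]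
  rw [this]
  exact (hE n).inter (MeasurableSet.iInter fun m => MeasurableSet.iInter fun _ => (hE m).compl)

lemma fst_inv {E : ℕ → Set ℝ} (hE : ∀ n, G.Inv n (E n)) (n : ℕ) : G.Inv n (fst E n) := by
  rintro s t hst ⟨h1, h2⟩
  exact ⟨hE n s t hst h1, fun m hm h => h2 m hm (Inv.mono G hm.le (hE m) t s hst.symm h)⟩

lemma fst_disj (E : ℕ → Set ℝ) : Pairwise (Function.onFun Disjoint (fst E)) := by
  intro i j hij
  refine Set.disjoint_left.2 ?_
  rintro x ⟨h1, h2⟩ ⟨h3, h4⟩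
  rcases lt_or_gt_of_ne hij with h | h
  · exact h4 _ h h1
  · exact h2 _ h h3

lemma fst_union (E : ℕ → Set ℝ) : ⋃ n, fst E n = ⋃ n, E n := by
  classical
  ext x
  simp only [Set.mem_iUnion]
  constructor
  · rintro ⟨n, h, _⟩; exact ⟨n, h⟩
  · intro h; exact ⟨Nat.find h, Nat.find_spec h, fun m hm => Nat.find_min h hm⟩

lemma doob_weak (g : ℝ → ℝ≥0∞) (c : ℝ≥0∞) :
    c * volume (⋃ n, {t | c < G.avg n g t}) ≤ ∫⁻ t, g t := by
  set E : ℕ → Set ℝ := fun n => {t | c < G.avg n g t}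
  have hE : ∀ n, MeasurableSet (E n) := fun n => measurableSet_lt measurable_const (G.avg_meas1 n g)
  have hI : ∀ n, G.Inv n (E n) := fun n s t hst hs => by
    change c < _; rw [← G.avg_congr g hst]; exact hs
  rw [← fst_union E, measure_iUnion (fst_disj E) (fst_meas hE), ← ENNReal.tsum_mul_left]
  calc _ ≤ ∑' n, ∫⁻ t in fst E n, g t := by
        refine ENNReal.tsum_le_tsum fun n => ?_
        rw [← G.int_avg n g _ (fst_meas hE n) (G.fst_inv hI n), ← setLIntegral_const]
        exact setLIntegral_mono (G.avg_meas1 n g) fun t ht => ht.1.le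
    _ = ∫⁻ t in ⋃ n, fst E n, g t := (lintegral_iUnion (fst_meas hE) (fst_disj E) _).symm
    _ ≤ _ := setLIntegral_le_lintegral _ _

end GridS

/-- lattice norms on sequences of functions -/
structure LN (Z : Type) [MeasurableSpace Z] where
  N : (ℕ → Z → ℝ≥0∞) → ℝ≥0∞
  mono : ∀ u v : ℕ → Z → ℝ≥0∞, (∀ k z, u k z ≤ v k z) → N u ≤ N v
  mink : ∀ {Ω : Type} [MeasurableSpace Ω] (μ : Measure Ω) [SFinite μ] (g : Ω → ℕ → Z → ℝ≥0∞),
    (∀ k, Measurable (fun p : Ω × Z => g p.1 k p.2)) →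
    N (fun k z => ∫⁻ ω, g ω k z ∂μ) ≤ ∫⁻ ω, N (g ω) ∂μ
  meas : ∀ {Ω : Type} [MeasurableSpace Ω] (g : Ω → ℕ → Z → ℝ≥0∞),
    (∀ k, Measurable (fun p : Ω × Z => g p.1 k p.2)) → Measurable fun ω => N (g ω)
  mct : ∀ u : ℕ → ℕ → Z → ℝ≥0∞, (∀ m k, Measurable (u m k)) →
    (∀ k z, Monotone fun m => u m k z) → N (fun k z => ⨆ m, u m k z) ≤ ⨆ m, N (u m)

namespace LN
variable {Z : Type} [MeasurableSpace Z] (N : LN Z)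

lemma zero : N.N (fun _ _ => 0) = 0 := by
  have := N.mink (0 : Measure Unit) (fun _ _ _ => 0) (by fun_prop)
  simpa using this

lemma add (u v : ℕ → Z → ℝ≥0∞) (hu : ∀ k, Measurable (u k)) (hv : ∀ k, Measurable (v k)) :
    N.N (fun k z => u k z + v k z) ≤ N.N u + N.N v := by
  have h := N.mink (Measure.count : Measure Bool) (fun b => if b then u else v) (fun k => by
    refine measurable_from_prod_countable_right fun b => ?_
    cases b
    · simpa using hv k
    · simpa using hu k)
  simpa [lintegral_fintype, lintegral_count] using h

lemma smul (c : ℝ≥0) (u : ℕ → Z → ℝ≥0∞) (hu : ∀ k, Measurable (u k)) :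
    N.N (fun k z => c * u k z) ≤ c * N.N u := by
  have h := N.mink (c • Measure.dirac () : Measure Unit) (fun _ => u) (fun k => by fun_prop)
  simpa [mul_comm] using h

lemma tsum (u : ℕ → ℕ → Z → ℝ≥0∞) (hu : ∀ m k, Measurable (u m k)) :
    N.N (fun k z => ∑' m, u m k z) ≤ ∑' m, N.N (u m) := by
  have h := N.mink (Measure.count : Measure ℕ) u (fun k => by
    exact measurable_from_prod_countable_right fun b => hu b k)
  simpa [lintegral_count] using h

end LN

def JM {Z : Type} [MeasurableSpace Z] (g : ℝ → ℕ → Z → ℝ≥0∞) : Prop :=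
  ∀ k, Measurable (fun p : ℝ × Z => g p.1 k p.2)

def Ti {Z : Type} (G : GridS) (lev : ℕ → ℕ) (g : ℝ → ℕ → Z → ℝ≥0∞) : ℝ → ℕ → Z → ℝ≥0∞ :=
  fun t k z => G.avg (lev k) (fun s => g s k z) t

def Weak {Z : Type} [MeasurableSpace Z] (G : GridS) (lev : ℕ → ℕ) (N : LN Z) (W : ℝ≥0∞) : Prop :=
  ∀ g : ℝ → ℕ → Z → ℝ≥0∞, JM g → ∀ t : ℝ, 0 < t →
    ENNReal.ofReal t * volume {x | ENNReal.ofReal t < N.N (Ti G lev g x)} ≤ W * ∫⁻ x, N.N (g x)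

def Strong {Z : Type} [MeasurableSpace Z] (G : GridS) (lev : ℕ → ℕ) (N : LN Z) (u : ℝ) (A : ℝ≥0∞) : Prop :=
  ∀ g : ℝ → ℕ → Z → ℝ≥0∞, JM g →
    ∫⁻ x, N.N (Ti G lev g x) ^ u ≤ A * ∫⁻ x, N.N (g x) ^ u

section
variable {Z : Type} [MeasurableSpace Z] (G : GridS) (lev : ℕ → ℕ) (N : LN Z)

lemma JM.Ti {g : ℝ → ℕ → Z → ℝ≥0∞} (hg : JM g) : JM (Ti G lev g) := fun k => by
  have h : Measurable fun p : Z × ℝ => g p.2 k p.1 := (hg k).comp measurable_swap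
  have h2 := (G.avg_meas (lev k) (fun z s => g s k z) h).comp (measurable_swap (α := ℝ) (β := Z))
  simpa only [Function.comp_def, Prod.fst_swap, Prod.snd_swap, _root_.Ti] using h2

lemma JM.sec {g : ℝ → ℕ → Z → ℝ≥0∞} (hg : JM g) (t : ℝ) (k : ℕ) : Measurable (g t k) :=
  (hg k).comp measurable_prodMk_left

lemma JM.ind {g : ℝ → ℕ → Z → ℝ≥0∞} (hg : JM g) {B : Set ℝ} (hB : MeasurableSet B) :
    JM (fun t k z => B.indicator (fun t => g t k z) t) := fun k => by
  have : (fun p : ℝ × Z => B.indicator (fun t => g t k p.2) p.1) =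
     (Prod.fst ⁻¹' B).indicator (fun p : ℝ × Z => g p.1 k p.2) := by
    ext p; simp only [Set.indicator, Set.mem_preimage]; rfl
  rw [this]; exact (hg k).indicator (measurable_fst hB)

lemma JM.trunc {g : ℝ → ℕ → Z → ℝ≥0∞} (hg : JM g) (L : ℕ) :
    JM (fun t k z => if lev k ≤ L then g t k z else 0) := fun k => by
  by_cases h : lev k ≤ L
  · simpa [h] using hg k
  · simp [h]

lemma N_ind {B : Set ℝ} (g : ℝ → ℕ → Z → ℝ≥0∞) (t : ℝ) :
    N.N (fun k z => B.indicator (fun t => g t k z) t) = B.indicator (fun t => N.N (g t)) t := by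
  by_cases h : t ∈ B
  · simp [h]
  · simp [h, N.zero]

lemma N_avg {g : ℝ → ℕ → Z → ℝ≥0∞} (hg : JM g) (n : ℕ) (t : ℝ) :
    N.N (fun k z => G.avg n (fun s => g s k z) t) ≤ G.avg n (fun s => N.N (g s)) t := by
  have h0 : (volume {s | G.ix n s = G.ix n t})⁻¹ ≠ ∞ := ENNReal.inv_ne_top.2 (G.vol0 n t)
  have := N.mink (((volume {s | G.ix n s = G.ix n t})⁻¹).toNNReal • volume.restrict {s | G.ix n s = G.ix n t}) g hg
  simpa only [lintegral_smul_measure, ENNReal.smul_def, ENNReal.coe_toNNReal h0, smul_eq_mul, GridS.avg, GridS.avgI] using this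

end


section
variable {Z : Type} [MeasurableSpace Z] (G : GridS) (lev : ℕ → ℕ) (N : LN Z)

lemma Ti_mono {g h : ℝ → ℕ → Z → ℝ≥0∞} (hgh : ∀ t k z, g t k z ≤ h t k z) (t : ℝ) (k : ℕ) (z : Z) :
    Ti G lev g t k z ≤ Ti G lev h t k z := G.avg_mono _ (fun s => hgh s k z) t

lemma Ti_iSup {g : ℕ → ℝ → ℕ → Z → ℝ≥0∞} (hg : ∀ m, JM (g m)) (hm : ∀ t k z, Monotone fun m => g m t k z)
    (t : ℝ) (k : ℕ) (z : Z) :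
    Ti G lev (fun t k z => ⨆ m, g m t k z) t k z = ⨆ m, Ti G lev (g m) t k z := by
  unfold Ti GridS.avg GridS.avgI
  rw [lintegral_iSup, ENNReal.mul_iSup]
  · exact fun m => (hg m k).comp measurable_prodMk_right
  · exact fun a b hab s => hm s k z hab

lemma N_Ti_iSup {g : ℕ → ℝ → ℕ → Z → ℝ≥0∞} (hg : ∀ m, JM (g m)) (hm : ∀ t k z, Monotone fun m => g m t k z)
    (t : ℝ) :
    N.N (Ti G lev (fun t k z => ⨆ m, g m t k z) t) = ⨆ m, N.N (Ti G lev (g m) t) := by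
  refine le_antisymm ?_ ?_
  · have : Ti G lev (fun t k z => ⨆ m, g m t k z) t = fun k z => ⨆ m, Ti G lev (g m) t k z := by
      ext k z; exact Ti_iSup G lev hg hm t k z
    rw [this]
    refine N.mct _ (fun m k => (JM.Ti G lev (hg m)).sec t k) ?_
    intro k z a b hab
    exact Ti_mono G lev (fun t k z => hm t k z hab) t k z
  · refine iSup_le fun m => N.mono _ _ fun k z => Ti_mono G lev (fun t k z => ?_) t k z
    exact le_iSup (fun m => g m t k z) m

lemma trunc_iSup (g : ℝ → ℕ → Z → ℝ≥0∞) :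
    (fun t k z => ⨆ L : ℕ, (if lev k ≤ L then g t k z else 0)) = g := by
  ext t k z
  refine le_antisymm (iSup_le fun L => ?_) ?_
  · split_ifs <;> simp
  · refine le_trans ?_ (le_iSup _ (lev k)); simp

lemma trunc_mono (g : ℝ → ℕ → Z → ℝ≥0∞) (t : ℝ) (k : ℕ) (z : Z) :
    Monotone fun L : ℕ => (if lev k ≤ L then g t k z else 0) := by
  intro a b hab
  dsimp only
  split_ifs with h1 h2
  · exact le_rfl
  · omega
  · simp
  · simp

lemma N_Ti_trunc {g : ℝ → ℕ → Z → ℝ≥0∞} (hg : JM g) (t : ℝ) :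
    N.N (Ti G lev g t) = ⨆ L : ℕ, N.N (Ti G lev (fun t k z => if lev k ≤ L then g t k z else 0) t) := by
  rw [← N_Ti_iSup G lev N (fun L => hg.trunc lev L) (fun t k z => trunc_mono lev g t k z),
    trunc_iSup]

lemma weak_trunc {u : ℝ} (hu : 1 ≤ u) {A : ℝ≥0∞} (hS : Strong G lev N u A) (L : ℕ)
    (g : ℝ → ℕ → Z → ℝ≥0∞) (hg : JM g) (hL : ∀ k, L < lev k → ∀ t z, g t k z = 0) (lam : ℝ) (hl : 0 < lam) :
    ENNReal.ofReal lam * volume {x | ENNReal.ofReal lam < N.N (Ti G lev g x)} ≤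
      (1 + A * 2 ^ (u - 1)) * ∫⁻ x, N.N (g x) := by
  classical
  set c := ENNReal.ofReal lam with hc
  have hc0 : c ≠ 0 := by simp [hc, hl]
  have hct : c ≠ ∞ := ENNReal.ofReal_ne_top
  set H : ℝ → ℝ≥0∞ := fun x => N.N (g x) with hH
  have hHm : Measurable H := N.meas g hg
  set E0 : ℕ → Set ℝ := fun n => {t | c < G.avg n H t}
  have hE0 : ∀ n, MeasurableSet (E0 n) := fun n => measurableSet_lt measurable_const (G.avg_meas1 n H)
  have hI0 : ∀ n, G.Inv n (E0 n) := fun n s t hst hs => by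
    change c < _; rw [← G.avg_congr H hst]; exact hs
  set E : ℕ → Set ℝ := fun n => if n < L then E0 n else Set.univ with hEdef
  have hE : ∀ n, MeasurableSet (E n) := fun n => by
    simp only [hEdef]; split_ifs; exacts [hE0 n, MeasurableSet.univ]
  have hI : ∀ n, G.Inv n (E n) := fun n => by
    simp only [hEdef]; split_ifs; exacts [hI0 n, fun _ _ _ _ => trivial]
  set D := GridS.fst E
  have hDm := GridS.fst_meas hE
  have hDi := G.fst_inv hI
  have hDd := GridS.fst_disj E
  have hDu : ⋃ n, D n = Set.univ := by
    rw [GridS.fst_union]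
    refine Set.eq_univ_of_forall fun x => Set.mem_iUnion.2 ⟨L, by simp [hEdef]⟩
  have hDL : ∀ n, L < n → D n = ∅ := by
    intro n hn
    refine Set.eq_empty_of_forall_notMem fun x hx => hx.2 L hn (by simp [hEdef])
  have splitI : ∀ (C : Set ℝ), MeasurableSet C → ∀ f : ℝ → ℝ≥0∞, ∫⁻ t in C, f t = ∑' n, ∫⁻ t in C ∩ D n, f t := by
    intro C hC f
    rw [← lintegral_iUnion (fun n => hC.inter (hDm n)), ← Set.inter_iUnion, hDu, Set.inter_univ]
    intro i j hij
    exact (hDd hij).mono Set.inter_subset_right Set.inter_subset_right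
  -- the modified function
  set gt : ℝ → ℕ → Z → ℝ≥0∞ := fun t k z => (E0 0)ᶜ.indicator (fun t =>
    ∑' n, (D n).indicator (fun t => G.avg n (fun s => g s k z) t) t) t with hgt
  have havgJ : ∀ n, JM (fun t k z => G.avg n (fun s => g s k z) t) := fun n => JM.Ti G (fun _ => n) hg
  have hgtJ : JM gt := by
    refine JM.ind (g := fun t k z => ∑' n, (D n).indicator (fun t => G.avg n (fun s => g s k z) t) t) ?_ (hE0 0).compl
    intro k
    exact Measurable.ennreal_tsum fun n => (havgJ n).ind (hDm n) k
  have hgtD : ∀ n t, t ∈ D n → t ∉ E0 0 → ∀ k z, gt t k z = G.avg n (fun s => g s k z) t := by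
    intro n t ht h0 k z
    simp only [hgt, Set.indicator, Set.mem_compl_iff, h0, not_false_eq_true, if_true]
    rw [tsum_eq_single n]
    · simp [ht]
    · intro m hm
      have : t ∉ D m := fun h => Set.disjoint_left.1 (hDd hm) h ht
      simp [this]
  have hgt0 : ∀ t, t ∈ E0 0 → ∀ k z, gt t k z = 0 := by
    intro t h0 k z; simp [hgt, h0]
  have hNgt : ∀ n t, t ∈ D n → N.N (gt t) ≤ G.avg n H t := by
    intro n t ht
    by_cases h0 : t ∈ E0 0
    · have : gt t = fun _ _ => 0 := by ext k z; exact hgt0 t h0 k z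
      rw [this, N.zero]; exact zero_le
    · have : gt t = fun k z => G.avg n (fun s => g s k z) t := by ext k z; exact hgtD n t ht h0 k z
      rw [this]; exact N_avg G N hg n t
  have hNgt2 : ∀ t, N.N (gt t) ≤ 2 * c := by
    intro t
    by_cases h0 : t ∈ E0 0
    · have : gt t = fun _ _ => 0 := by ext k z; exact hgt0 t h0 k z
      rw [this, N.zero]; exact zero_le
    obtain ⟨n, hn⟩ := Set.mem_iUnion.1 (hDu ▸ Set.mem_univ t : t ∈ ⋃ n, D n)
    refine (hNgt n t hn).trans ?_
    rcases n with _ | n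
    · have : G.avg 0 H t ≤ c := not_lt.1 h0
      refine this.trans ?_
      rw [two_mul]; exact le_self_add
    · refine (G.avg_dbl n H t).trans ?_
      gcongr
      have h1 := hn.2 n (by omega)
      have h2 : n < L := by
        by_contra hh
        exact h1 (by simp [hEdef, hh])
      simp only [hEdef, h2, if_true] at h1
      exact not_lt.1 h1
  have hint : ∫⁻ t, N.N (gt t) ≤ ∫⁻ t, H t := by
    have e1 := splitI Set.univ MeasurableSet.univ (fun t => N.N (gt t))
    have e2 := splitI Set.univ MeasurableSet.univ H
    simp only [Measure.restrict_univ, Set.univ_inter] at e1 e2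
    rw [e1, e2]
    refine ENNReal.tsum_le_tsum fun n => ?_
    rw [← G.int_avg n H _ (hDm n) (hDi n)]
    exact setLIntegral_mono (G.avg_meas1 n H) fun t ht => hNgt n t ht
  -- equality off the bad set
  set Om := ⋃ n, E0 n
  have hOm : c * volume Om ≤ ∫⁻ t, H t := G.doob_weak H c
  have hEq : ∀ t, t ∉ Om → Ti G lev g t = Ti G lev gt t := by
    intro t ht
    ext k z
    by_cases hk : L < lev k
    · have e1 : ∀ s, g s k z = 0 := fun s => hL k hk s z
      have e2 : ∀ s, gt s k z = 0 := by
        intro s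
        have : ∀ n, G.avg n (fun s => g s k z) s = 0 := by
          intro n; simp [GridS.avg, GridS.avgI, e1]
        simp [hgt, this]
      unfold Ti
      congr 1; ext s; rw [e1, e2]
    push Not at hk
    unfold Ti GridS.avg GridS.avgI
    congr 1
    set C := {s | G.ix (lev k) s = G.ix (lev k) t}
    have hC : MeasurableSet C := G.mcell _ _
    have hCi : G.Inv (lev k) C := G.inv_cell _ _
    rw [splitI C hC, splitI C hC]
    have ht' : ∀ n, t ∉ E0 n := fun n h => ht (Set.mem_iUnion.2 ⟨n, h⟩)
    have hC0 : ∀ s ∈ C, s ∉ E0 0 := fun s hs h =>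
      ht' 0 (GridS.Inv.mono G (Nat.zero_le _) (hI0 0) s t hs h)
    refine tsum_congr fun n => ?_
    have step : lev k ≤ n ∨ C ∩ D n = ∅ := by
      by_cases h : lev k ≤ n
      · exact Or.inl h
      · right
        push Not at h
        refine Set.eq_empty_of_forall_notMem fun s hs => ?_
        have h1 : s ∈ E n := hs.2.1
        simp only [hEdef, show n < L by omega, if_true] at h1
        exact ht' n (GridS.Inv.mono G h.le (hI0 n) s t hs.1 h1)
    rcases step with h | h
    · rw [← G.int_avg n (fun s => g s k z) _ (hC.inter (hDm n)) (GridS.Inv.inter G (GridS.Inv.mono G h hCi) (hDi n))]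
      refine setLIntegral_congr_fun (hC.inter (hDm n)) fun s hs => ?_
      exact (hgtD n s hs.2 (hC0 s hs.1) k z).symm
    · rw [h]; simp
  set V := volume {x | c < N.N (Ti G lev gt x)} with hV
  have hVb : c * V ≤ A * 2 ^ (u - 1) * ∫⁻ x, H x := by
    have h1 : c ^ u * V ≤ A * ((2 * c) ^ (u - 1) * ∫⁻ x, H x) := by
      calc c ^ u * V ≤ ∫⁻ x, N.N (Ti G lev gt x) ^ u := by
            have hm : Measurable fun x => N.N (Ti G lev gt x) := N.meas _ (JM.Ti G lev hgtJ)
            rw [hV, ← setLIntegral_const]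
            refine le_trans ?_ (setLIntegral_le_lintegral {x | c < N.N (Ti G lev gt x)} _)
            refine setLIntegral_mono (hm.pow_const u) fun x hx => ?_
            exact ENNReal.rpow_le_rpow hx.le (by linarith)
        _ ≤ A * ∫⁻ x, N.N (gt x) ^ u := hS gt hgtJ
        _ ≤ A * ((2 * c) ^ (u - 1) * ∫⁻ x, N.N (gt x)) := by
            gcongr
            rw [← lintegral_const_mul _ (N.meas gt hgtJ)]
            refine lintegral_mono fun x => ?_
            conv_lhs => rw [show u = (u - 1) + 1 by ring, ENNReal.rpow_add_of_nonneg _ _ (by linarith) (by norm_num), ENNReal.rpow_one]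
            exact mul_le_mul_left (ENNReal.rpow_le_rpow (hNgt2 x) (by linarith)) _
        _ ≤ _ := by gcongr
    have hcu0 : c ^ (u - 1) ≠ 0 := by
      simp only [ne_eq, ENNReal.rpow_eq_zero_iff, hc0, hct, false_and, or_self, not_false_eq_true]
    have hcut : c ^ (u - 1) ≠ ∞ := ENNReal.rpow_ne_top_of_nonneg (by linarith) hct
    have h2 : c ^ (u - 1) * (c * V) ≤ c ^ (u - 1) * (A * 2 ^ (u - 1) * ∫⁻ x, H x) := by
      rw [ENNReal.mul_rpow_of_nonneg _ _ (by linarith)] at h1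
      calc _ = c ^ u * V := by
            conv_rhs => rw [show u = (u - 1) + 1 by ring, ENNReal.rpow_add_of_nonneg _ _ (by linarith) (by norm_num), ENNReal.rpow_one]
            ring
        _ ≤ _ := h1
        _ = _ := by ring
    exact (ENNReal.mul_le_mul_iff_right hcu0 hcut).1 h2
  calc c * volume {x | c < N.N (Ti G lev g x)} ≤ c * (volume Om + V) := by
        gcongr
        refine le_trans (measure_mono ?_) (measure_union_le Om _)
        intro x hx
        by_cases hxo : x ∈ Om
        · exact Or.inl hxo
        · right
          change c < _
          rw [← hEq x hxo]; exact hx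
    _ = c * volume Om + c * V := mul_add _ _ _
    _ ≤ (∫⁻ t, H t) + A * 2 ^ (u - 1) * ∫⁻ x, H x := add_le_add hOm hVb
    _ = _ := by ring

lemma weak_of_strong {u : ℝ} (hu : 1 ≤ u) {A : ℝ≥0∞} (hS : Strong G lev N u A) :
    Weak G lev N (1 + A * 2 ^ (u - 1)) := by
  intro g hg t ht
  set gL : ℕ → ℝ → ℕ → Z → ℝ≥0∞ := fun L t k z => if lev k ≤ L then g t k z else 0
  have e : {x | ENNReal.ofReal t < N.N (Ti G lev g x)} = ⋃ L, {x | ENNReal.ofReal t < N.N (Ti G lev (gL L) x)} := by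
    ext x
    simp only [Set.mem_ofPred_eq, Set.mem_iUnion]
    rw [N_Ti_trunc G lev N hg, lt_iSup_iff]
  have hm : Monotone fun L => {x | ENNReal.ofReal t < N.N (Ti G lev (gL L) x)} := by
    intro a b hab x hx
    exact lt_of_lt_of_le hx (N.mono _ _ (Ti_mono G lev (fun t k z => trunc_mono lev g t k z hab) x))
  rw [e, hm.measure_iUnion, ENNReal.mul_iSup]
  refine iSup_le fun L => (weak_trunc G lev N hu hS L (gL L) (hg.trunc lev L) ?_ t ht).trans ?_
  · intro k hk t z; simp [gL, hk]
  · gcongr with x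
    refine N.mono _ _ fun k z => ?_
    simp only [gL]; split_ifs <;> simp

lemma pfC_pos (W : ℝ≥0∞) (P : ℝ) (hP : 1 < P) : pfC W P ≠ 0 := by
  unfold pfC
  set c := (2 * W * ENNReal.ofReal P * ENNReal.ofReal (P - 1)⁻¹ * 2 ^ (P - 1)) + 1 with hc
  have : c ≠ 0 := by simp [hc]
  have h2 : 2 * c ≠ 0 := by simp [this]
  refine mul_ne_zero h2 ?_
  simp only [ne_eq, ENNReal.rpow_eq_zero_iff, h2, false_and, false_or, not_and, not_lt]
  intro _; linarith

lemma good_lam {W : ℝ≥0∞} (hW : Weak G lev N W) (g : ℝ → ℕ → Z → ℝ≥0∞) (hg : JM g) (lam : ℝ) (hl : 0 < lam) :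
    ENNReal.ofReal lam * volume {x | ENNReal.ofReal (2 * lam) < N.N (Ti G lev g x)} ≤
      W * ∫⁻ x in {x | ENNReal.ofReal lam < N.N (Ti G lev g x)}, N.N (g x) := by
  set c := ENNReal.ofReal lam with hc
  have hct : c ≠ ∞ := ENNReal.ofReal_ne_top
  have h2c : ENNReal.ofReal (2 * lam) = c + c := by rw [two_mul, ENNReal.ofReal_add hl.le hl.le]
  set gL : ℕ → ℝ → ℕ → Z → ℝ≥0∞ := fun L t k z => if lev k ≤ L then g t k z else 0 with hgL
  have hgLJ : ∀ L, JM (gL L) := fun L => hg.trunc lev L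
  set E : ℕ → Set ℝ := fun n => {t | c < N.N (Ti G lev (gL n) t)}
  have hE : ∀ n, MeasurableSet (E n) := fun n =>
    measurableSet_lt measurable_const (N.meas _ (JM.Ti G lev (hgLJ n)))
  have hI : ∀ n, G.Inv n (E n) := by
    intro n s t hst hs
    have : Ti G lev (gL n) t = Ti G lev (gL n) s := by
      ext k z
      unfold Ti
      by_cases hk : lev k ≤ n
      · exact G.avg_congr _ (G.nest_le hk t s hst.symm)
      · simp [hgL, hk, GridS.avg, GridS.avgI]
    change c < _; rw [this]; exact hs
  have hu : {x | c < N.N (Ti G lev g x)} = ⋃ n, GridS.fst E n := by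
    rw [GridS.fst_union]
    ext x
    simp only [Set.mem_ofPred_eq, Set.mem_iUnion, E]
    rw [N_Ti_trunc G lev N hg, lt_iSup_iff]
  set D := GridS.fst E
  have hDm := GridS.fst_meas hE
  have hDi := G.fst_inv hI
  have hDd := GridS.fst_disj E
  set gD : ℕ → ℝ → ℕ → Z → ℝ≥0∞ := fun n t k z => (D n).indicator (fun t => g t k z) t with hgD
  have hgDJ : ∀ n, JM (gD n) := fun n => hg.ind (hDm n)
  have key : ∀ n t, t ∈ D n → N.N (Ti G lev g t) ≤ c + N.N (Ti G lev (gD n) t) := by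
    intro n t ht
    have hloc : ∀ k z, n ≤ lev k → Ti G lev g t k z ≤ Ti G lev (gD n) t k z := by
      intro k z hk
      unfold Ti GridS.avg GridS.avgI
      gcongr 1
      refine setLIntegral_mono' (G.mcell _ _) fun s hs => ?_
      have : s ∈ D n := (GridS.Inv.mono G hk (hDi n)) t s (Eq.symm hs) ht
      simp [hgD, this]
    rcases n with _ | n
    · refine le_trans (N.mono _ _ fun k z => hloc k z (Nat.zero_le _)) le_add_self
    · calc N.N (Ti G lev g t) ≤ N.N (fun k z => Ti G lev (gL n) t k z + Ti G lev (gD (n+1)) t k z) := by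
            refine N.mono _ _ fun k z => ?_
            by_cases hk : lev k ≤ n
            · refine le_trans (le_of_eq ?_) le_self_add
              unfold Ti; simp [hgL, hk]
            · exact (hloc k z (by omega)).trans le_add_self
        _ ≤ N.N (Ti G lev (gL n) t) + N.N (Ti G lev (gD (n+1)) t) :=
            N.add _ _ ((JM.Ti G lev (hgLJ n)).sec t) ((JM.Ti G lev (hgDJ (n+1))).sec t)
        _ ≤ _ := by
            gcongr
            exact not_lt.1 (ht.2 n (by omega))
  have hsub : {x | ENNReal.ofReal (2 * lam) < N.N (Ti G lev g x)} ⊆ ⋃ n, {x | c < N.N (Ti G lev (gD n) x)} ∩ D n := by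
    intro x hx
    have hx' : c + c < N.N (Ti G lev g x) := by rw [← h2c]; exact hx
    have hx1 : x ∈ ⋃ n, D n := by
      rw [← hu]; exact lt_of_le_of_lt le_self_add hx'
    obtain ⟨n, hn⟩ := Set.mem_iUnion.1 hx1
    refine Set.mem_iUnion.2 ⟨n, ?_, hn⟩
    have := lt_of_lt_of_le hx' (key n x hn)
    exact (ENNReal.add_lt_add_iff_left hct).1 this
  calc _ ≤ c * ∑' n, volume {x | c < N.N (Ti G lev (gD n) x)} := by
        gcongr
        refine (measure_mono hsub).trans ((measure_iUnion_le _).trans ?_)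
        exact ENNReal.tsum_le_tsum fun n => measure_mono Set.inter_subset_left
    _ = ∑' n, c * volume {x | c < N.N (Ti G lev (gD n) x)} := ENNReal.tsum_mul_left.symm
    _ ≤ ∑' n, W * ∫⁻ x in D n, N.N (g x) := by
        refine ENNReal.tsum_le_tsum fun n => (hW (gD n) (hgDJ n) lam hl).trans ?_
        refine mul_le_mul' le_rfl ?_
        rw [← lintegral_indicator (hDm n)]
        refine lintegral_mono fun x => le_of_eq ?_
        exact N_ind N g x
    _ = _ := by rw [ENNReal.tsum_mul_left, hu, lintegral_iUnion hDm hDd]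

lemma strong_of_weak {W : ℝ≥0∞} (hWt : W ≠ ∞) (hW : Weak G lev N W) {P : ℝ} (hP : 1 < P) :
    Strong G lev N P (pfC W P) := by
  intro g hg
  by_cases hfin : ∫⁻ x, N.N (g x) ^ P = ∞
  · rw [hfin, ENNReal.mul_top (pfC_pos W P hP)]; exact le_top
  set B : ℕ → Set ℝ := fun m => Set.Icc (-(m:ℝ)) m
  have hB : ∀ m, MeasurableSet (B m) := fun m => measurableSet_Icc
  set gm : ℕ → ℝ → ℕ → Z → ℝ≥0∞ := fun m t k z => (B m).indicator (fun t => g t k z) t with hgm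
  have hgmJ : ∀ m, JM (gm m) := fun m => hg.ind (hB m)
  have hmono : ∀ t k z, Monotone fun m => gm m t k z := by
    intro t k z a b hab
    refine Set.indicator_le_indicator_of_subset ?_ (fun _ => zero_le) t
    exact Set.Icc_subset_Icc (by simpa using hab) (by simpa using hab)
  have hsup : (fun t k z => ⨆ m, gm m t k z) = g := by
    ext t k z
    refine le_antisymm (iSup_le fun m => Set.indicator_le_self _ _ _) ?_
    obtain ⟨m, hm⟩ := exists_nat_ge |t|
    refine le_trans ?_ (le_iSup _ m)
    have : t ∈ B m := ⟨by linarith [neg_abs_le t], (le_abs_self t).trans hm⟩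
    simp [hgm, this]
  have hmeas : ∀ m, Measurable fun x => N.N (Ti G lev (gm m) x) := fun m => N.meas _ (JM.Ti G lev (hgmJ m))
  have hNm : ∀ m x, N.N (gm m x) = (B m).indicator (fun t => N.N (g t)) x := fun m x => N_ind N g x
  have main : ∀ m, ∫⁻ x, N.N (Ti G lev (gm m) x) ^ P ≤ pfC W P * ∫⁻ x, N.N (g x) ^ P := by
    intro m
    refine (pf_doob _ (fun x => N.N (gm m x)) (hmeas m) (N.meas _ (hgmJ m)) W hWt
      (fun t ht => good_lam G lev N hW (gm m) (hgmJ m) t ht) P hP ?_).trans ?_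
    · refine ne_top_of_le_ne_top (b := volume (B m) + ∫⁻ x, N.N (g x) ^ P) ?_ ?_
      · refine ENNReal.add_ne_top.2 ⟨?_, hfin⟩
        simp [B]
      · simp_rw [hNm]
        rw [lintegral_indicator (hB m), ← setLIntegral_one]
        calc _ ≤ ∫⁻ x in B m, (1 + N.N (g x) ^ P) := by
              refine lintegral_mono fun x => ?_
              rcases le_total (N.N (g x)) 1 with h | h
              · exact h.trans le_self_add
              · refine le_trans ?_ le_add_self
                exact ENNReal.le_rpow_self_of_one_le h hP.le
          _ = _ := lintegral_add_left (by fun_prop) _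
          _ ≤ _ := by
              gcongr
              exact Measure.restrict_le_self
    · gcongr with x
      rw [hNm]; exact Set.indicator_le_self _ _ _
  have e : ∀ x, N.N (Ti G lev g x) ^ P = ⨆ m, N.N (Ti G lev (gm m) x) ^ P := by
    intro x
    conv_lhs => rw [← hsup, N_Ti_iSup G lev N hgmJ hmono]
    exact (ENNReal.monotone_rpow_of_nonneg (by linarith)).map_iSup_of_continuousAt
      (ENNReal.continuous_rpow_const.continuousAt) (by simp; linarith)
  simp_rw [e]
  rw [lintegral_iSup (fun m => (hmeas m).pow_const P)]
  · exact iSup_le main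
  · intro a b hab x
    exact ENNReal.rpow_le_rpow (N.mono _ _ (Ti_mono G lev (fun t k z => hmono t k z hab) x)) (by linarith)

end


lemma rpow_iSup' {P : ℝ} (hP : 0 < P) (f : ℕ → ℝ≥0∞) : (⨆ m, f m) ^ P = ⨆ m, f m ^ P :=
  (ENNReal.monotone_rpow_of_nonneg hP.le).map_iSup_of_continuousAt
      (ENNReal.continuous_rpow_const.continuousAt) (by simp; linarith)

/-- Minkowski integral inequality -/
lemma minkowski_int {Ω Y : Type} [MeasurableSpace Ω] [MeasurableSpace Y] (μ : Measure Ω) [SFinite μ]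
    (ν : Measure Y) [SigmaFinite ν] (g : Ω → Y → ℝ≥0∞) (hg : Measurable fun p : Ω × Y => g p.1 p.2)
    (P : ℝ) (hP : 1 ≤ P) :
    (∫⁻ y, (∫⁻ ω, g ω y ∂μ) ^ P ∂ν) ^ (1 / P) ≤ ∫⁻ ω, (∫⁻ y, g ω y ^ P ∂ν) ^ (1 / P) ∂μ := by
  have hg2 : Measurable fun p : Y × Ω => g p.2 p.1 := hg.comp measurable_swap
  rcases hP.eq_or_lt with rfl | hP1
  · simp only [ENNReal.rpow_one, div_one]
    rw [lintegral_lintegral_swap]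
    exact hg2.aemeasurable
  set R := ∫⁻ ω, (∫⁻ y, g ω y ^ P ∂ν) ^ (1 / P) ∂μ with hR
  set H : Y → ℝ≥0∞ := fun y => ∫⁻ ω, g ω y ∂μ with hH
  have hHm : Measurable H := Measurable.lintegral_prod_right' hg2
  set S : ℕ → Set Y := spanningSets ν
  have hS : ∀ m, MeasurableSet (S m) := measurableSet_spanningSets ν
  set Hm : ℕ → Y → ℝ≥0∞ := fun m => (S m).indicator fun y => min (H y) m with hHmd
  have hHmm : ∀ m, Measurable (Hm m) := fun m => (hHm.min measurable_const).indicator (hS m)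
  have hle : ∀ m y, Hm m y ≤ H y := fun m y => by
    simp only [hHmd, Set.indicator]; split_ifs
    · exact min_le_left _ _
    · exact zero_le
  have hmono : ∀ y, Monotone fun m => Hm m y := by
    intro y a b hab
    simp only [hHmd, Set.indicator]
    have : y ∈ S a → y ∈ S b := fun h => monotone_spanningSets ν hab h
    split_ifs with h1 h2
    · gcongr
    · exact absurd (this h1) h2
    · exact zero_le
    · exact le_rfl
  have hsup : ∀ y, ⨆ m, Hm m y = H y := by
    intro y
    refine le_antisymm (iSup_le fun m => hle m y) ?_
    refine le_of_forall_lt fun b hb => ?_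
    obtain ⟨m1, h1⟩ : ∃ m, y ∈ S m := by
      have : y ∈ ⋃ m, S m := by rw [iUnion_spanningSets]; trivial
      simpa using this
    obtain ⟨m2, h2⟩ := ENNReal.exists_nat_gt (ne_top_of_lt hb)
    refine lt_of_lt_of_le ?_ (le_iSup _ (max m1 m2))
    have : y ∈ S (max m1 m2) := monotone_spanningSets ν (le_max_left _ _) h1
    simp only [hHmd, Set.indicator, this, if_true]
    refine lt_min hb (lt_of_lt_of_le h2 ?_)
    exact_mod_cast le_max_right _ _
  have hc : (P / (P - 1)).HolderConjugate P := (Real.HolderConjugate.conjExponent hP1).symm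
  have hsplit : ∀ y : ℝ≥0∞, y ^ (P - 1) * y = y ^ P := by
    intro y
    conv_rhs => rw [show P = (P - 1) + 1 by ring, ENNReal.rpow_add_of_nonneg _ _ (by linarith) (by norm_num), ENNReal.rpow_one]
  have main : ∀ m, (∫⁻ y, Hm m y ^ P ∂ν) ^ (1 / P) ≤ R := by
    intro m
    set I := ∫⁻ y, Hm m y ^ P ∂ν with hI
    have hIt : I ≠ ∞ := by
      refine ne_top_of_le_ne_top (b := ∫⁻ y in S m, (m:ℝ≥0∞) ^ P ∂ν) ?_ ?_
      · rw [setLIntegral_const]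
        exact ENNReal.mul_ne_top (ENNReal.rpow_ne_top_of_nonneg (by linarith) (by simp)) (measure_spanningSets_lt_top ν m).ne
      · rw [← lintegral_indicator (hS m)]
        refine lintegral_mono fun y => ?_
        simp only [hHmd, Set.indicator]
        split_ifs
        · exact ENNReal.rpow_le_rpow (min_le_right _ _) (by linarith)
        · simp [show 0 < P by linarith]
    have h1 : I ≤ I ^ ((P - 1) / P) * R := by
      calc I = ∫⁻ y, Hm m y ^ (P - 1) * Hm m y ∂ν := by simp_rw [hsplit]; rfl
        _ ≤ ∫⁻ y, Hm m y ^ (P - 1) * H y ∂ν := by gcongr with y; exact hle m y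
        _ = ∫⁻ y, ∫⁻ ω, Hm m y ^ (P - 1) * g ω y ∂μ ∂ν := by
            refine lintegral_congr fun y => ?_
            exact (lintegral_const_mul _ (hg2.comp (measurable_prodMk_left (x := y)))).symm
        _ = ∫⁻ ω, ∫⁻ y, Hm m y ^ (P - 1) * g ω y ∂ν ∂μ := by
            rw [lintegral_lintegral_swap]
            exact ((((hHmm m).comp measurable_fst).pow_const _).mul hg2).aemeasurable
        _ ≤ ∫⁻ ω, I ^ ((P - 1) / P) * (∫⁻ y, g ω y ^ P ∂ν) ^ (1 / P) ∂μ := by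
            refine lintegral_mono fun ω => ?_
            have := ENNReal.lintegral_mul_le_Lp_mul_Lq ν hc ((hHmm m).pow_const (P - 1)).aemeasurable
              (hg.comp (measurable_prodMk_left (x := ω))).aemeasurable
            refine this.trans (le_of_eq ?_)
            rw [one_div_div]
            congr 2
            refine lintegral_congr fun y => ?_
            rw [← ENNReal.rpow_mul, mul_div_cancel₀ _ (by linarith)]
        _ = _ := by
            rw [lintegral_const_mul]
            have : Measurable fun p : Ω × Y => g p.1 p.2 ^ P := hg.pow_const _
            exact (Measurable.lintegral_prod_right' this).pow_const _
    rcases eq_or_ne I 0 with h0 | h0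
    · rw [h0, ENNReal.zero_rpow_of_pos (by positivity)]; exact zero_le
    · have e : I = I ^ ((P - 1) / P) * I ^ (1 / P) := by
        rw [← ENNReal.rpow_add _ _ h0 hIt]
        conv_lhs => rw [← ENNReal.rpow_one I]
        congr 1; field_simp; ring
      have h2 : I ^ ((P - 1) / P) * I ^ (1 / P) ≤ I ^ ((P - 1) / P) * R := by rw [← e]; exact h1
      refine (ENNReal.mul_le_mul_iff_right ?_ ?_).1 h2
      · simp only [ne_eq, ENNReal.rpow_eq_zero_iff, h0, hIt, false_and, or_self, not_false_eq_true]
      · exact ENNReal.rpow_ne_top_of_nonneg (div_nonneg (by linarith) (by linarith)) hIt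
  have e : ∀ y, H y ^ P = ⨆ m, Hm m y ^ P := fun y => by rw [← hsup, rpow_iSup' (by linarith)]
  change (∫⁻ y, H y ^ P ∂ν) ^ (1 / P) ≤ R
  simp_rw [e]
  rw [lintegral_iSup (fun m => (hHmm m).pow_const P), rpow_iSup' (by positivity)]
  · exact iSup_le main
  · intro a b hab y
    exact ENNReal.rpow_le_rpow (hmono y hab) (by linarith)

def lq (q : ℝ≥0∞) (v : ℕ → ℝ≥0∞) : ℝ≥0∞ :=
  if q = ∞ then ⨆ k, v k else (∑' k, v k ^ q.toReal) ^ (1 / q.toReal)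

lemma lq_mono (q : ℝ≥0∞) {u v : ℕ → ℝ≥0∞} (h : ∀ k, u k ≤ v k) : lq q u ≤ lq q v := by
  unfold lq
  split_ifs
  · exact iSup_mono h
  · gcongr with k; exact h k

lemma lq_mink (q : ℝ≥0∞) (hq : 1 ≤ q) {Ω : Type} [MeasurableSpace Ω] (μ : Measure Ω) [SFinite μ]
    (g : Ω → ℕ → ℝ≥0∞) (hg : ∀ k, Measurable fun ω => g ω k) :
    lq q (fun k => ∫⁻ ω, g ω k ∂μ) ≤ ∫⁻ ω, lq q (g ω) ∂μ := by
  unfold lq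
  split_ifs with h
  · refine iSup_le fun k => lintegral_mono fun ω => le_iSup (g ω) k
  · have := minkowski_int μ (Measure.count : Measure ℕ) g
      (measurable_from_prod_countable_left fun k => hg k) q.toReal (by
        rw [← ENNReal.toReal_one]; exact (ENNReal.toReal_le_toReal (by simp) h).2 hq)
    simpa only [lintegral_count] using this

lemma lq_meas (q : ℝ≥0∞) {Ω : Type*} [MeasurableSpace Ω] (g : Ω → ℕ → ℝ≥0∞) (hg : ∀ k, Measurable fun ω => g ω k) :
    Measurable fun ω => lq q (g ω) := by
  unfold lq
  split_ifs
  · exact Measurable.iSup hg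
  · exact (Measurable.tsum fun k => (hg k).pow_const _).pow_const _

lemma lq_mct (q : ℝ≥0∞) (hq : 0 < q) (u : ℕ → ℕ → ℝ≥0∞) (hu : ∀ k, Monotone fun m => u m k) :
    lq q (fun k => ⨆ m, u m k) ≤ ⨆ m, lq q (u m) := by
  unfold lq
  split_ifs with h
  · rw [iSup_comm]
  · have hq' : 0 < q.toReal := ENNReal.toReal_pos hq.ne' h
    simp_rw [rpow_iSup' hq']
    rw [← rpow_iSup' (by positivity)]
    gcongr
    have := lintegral_iSup (μ := (Measure.count : Measure ℕ)) (f := fun m k => u m k ^ q.toReal) (fun m => measurable_from_top)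
      (fun a b hab k => ENNReal.rpow_le_rpow (hu k hab) hq'.le)
    simp only [lintegral_count] at this
    rw [this]

lemma mixAux_mono (n : ℕ) (p : Fin n → ℝ≥0∞) (l : ℕ) {F H : RV n → ℝ≥0∞}
    (h : ∀ x, F x ≤ H x) (hp : ∀ i, p i ≠ ∞) (x : RV n) : mixAux n p l F x ≤ mixAux n p l H x := by
  induction l generalizing x with
  | zero => exact h x
  | succ l ih =>
    simp only [mixAux]
    split_ifs with h1 h2
    · exact absurd h2 (hp _)
    · gcongr with t; exact ih _
    · exact ih x

lemma mixAux_succ (n : ℕ) (p : Fin n → ℝ≥0∞) (hp : ∀ i, p i ≠ ∞) (l : Fin n) (F : RV n → ℝ≥0∞) (x : RV n) :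
    mixAux n p (l + 1) F x = (∫⁻ t : ℝ, (mixAux n p l F (Function.update x l t)) ^ (p l).toReal) ^
            (1 / (p l).toReal) := by
  simp [mixAux, l.2, hp]

lemma meas_upd (n : ℕ) (i : Fin n) : Measurable fun q : RV n × ℝ => Function.update q.1 i q.2 := by
  refine measurable_pi_lambda _ fun j => ?_
  by_cases h : j = i
  · subst h; simpa using measurable_snd
  · simp only [Function.update_of_ne h]; fun_prop

lemma mixAux_meas (n : ℕ) (p : Fin n → ℝ≥0∞) (hp : ∀ i, p i ≠ ∞) (l : ℕ)
    {Ω : Type*} [MeasurableSpace Ω] (F : Ω → RV n → ℝ≥0∞) (hF : Measurable fun q : Ω × RV n => F q.1 q.2) :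
    Measurable fun q : Ω × RV n => mixAux n p l (F q.1) q.2 := by
  induction l with
  | zero => exact hF
  | succ l ih =>
    simp only [mixAux]
    split_ifs with h1 h2
    · exact absurd h2 (hp _)
    · have hm : Measurable fun q : (Ω × RV n) × ℝ => (q.1.1, Function.update q.1.2 ⟨l, h1⟩ q.2) :=
        (measurable_fst.comp measurable_fst).prodMk
          ((meas_upd n ⟨l, h1⟩).comp ((measurable_snd.comp measurable_fst).prodMk measurable_snd))
      exact (Measurable.lintegral_prod_right' ((ih.comp hm).pow_const _)).pow_const _
    · exact ih

lemma mixAux_mink (n : ℕ) (p : Fin n → ℝ≥0∞) (hp : ∀ i, p i ≠ ∞) (hp1 : ∀ i, 1 ≤ (p i).toReal) (l : ℕ)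
    {Ω : Type} [MeasurableSpace Ω] (μ : Measure Ω) [SFinite μ]
    (F : Ω → RV n → ℝ≥0∞) (hF : Measurable fun q : Ω × RV n => F q.1 q.2) (x : RV n) :
    mixAux n p l (fun x => ∫⁻ ω, F ω x ∂μ) x ≤ ∫⁻ ω, mixAux n p l (F ω) x ∂μ := by
  induction l generalizing x with
  | zero => exact le_rfl
  | succ l ih =>
    simp only [mixAux]
    split_ifs with h1 h2
    · exact absurd h2 (hp _)
    · refine le_trans ?_ (minkowski_int μ volume (fun ω t => mixAux n p l (F ω) (Function.update x ⟨l, h1⟩ t)) ?_ _ (hp1 _))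
      · gcongr with t; exact ih _
      · have hm : Measurable fun q : Ω × ℝ => (q.1, Function.update x ⟨l, h1⟩ q.2) :=
          measurable_fst.prodMk ((meas_upd n ⟨l, h1⟩).comp (measurable_const.prodMk measurable_snd))
        exact (mixAux_meas n p hp l F hF).comp hm
    · exact ih x

lemma mixAux_mct (n : ℕ) (p : Fin n → ℝ≥0∞) (hp : ∀ i, p i ≠ ∞) (hp1 : ∀ i, 1 ≤ (p i).toReal) (l : ℕ)
    (F : ℕ → RV n → ℝ≥0∞) (hF : ∀ m, Measurable (F m)) (hm : ∀ x, Monotone fun m => F m x) (x : RV n) :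
    mixAux n p l (fun x => ⨆ m, F m x) x ≤ ⨆ m, mixAux n p l (F m) x := by
  induction l generalizing x with
  | zero => exact le_rfl
  | succ l ih =>
    simp only [mixAux]
    split_ifs with h1 h2
    · exact absurd h2 (hp _)
    · have hP := hp1 ⟨l, h1⟩
      rw [← rpow_iSup' (by positivity)]
      refine ENNReal.rpow_le_rpow ?_ (by positivity)
      rw [← lintegral_iSup]
      · refine lintegral_mono fun t => ?_
        rw [← rpow_iSup' (by linarith)]
        gcongr; exact ih _
      · intro m
        have h0 : Measurable (mixAux n p l (F m)) := by
          have := mixAux_meas n p hp l (fun _ : Unit => F m) ((hF m).comp measurable_snd)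
          exact this.comp (measurable_prodMk_left (x := ()))
        exact (h0.comp ((meas_upd n ⟨l, h1⟩).comp (measurable_const.prodMk measurable_id))).pow_const _
      · intro a b hab t
        refine ENNReal.rpow_le_rpow (mixAux_mono n p l (fun x => hm x hab) hp _) (by linarith)
    · exact ih x

/-- the mixed lattice norm, coordinates `< l` integrated out, at the point `x` -/
def mixLN (n : ℕ) (p : Fin n → ℝ≥0∞) (hp : ∀ i, p i ≠ ∞) (hp1 : ∀ i, 1 ≤ (p i).toReal) (q : ℝ≥0∞) (hq : 1 ≤ q)
    (l : ℕ) (x : RV n) : LN (RV n) where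
  N u := mixAux n p l (fun x => lq q (fun k => u k x)) x
  mono u v h := mixAux_mono n p l (fun x => lq_mono q fun k => h k x) hp x
  mink μ _ g hg := by
    refine le_trans (mixAux_mono n p l (fun x => lq_mink q hq μ (fun ω k => g ω k x)
      (fun k => (hg k).comp measurable_prodMk_right)) hp x) ?_
    exact mixAux_mink n p hp hp1 l μ (fun ω x => lq q (fun k => g ω k x)) (lq_meas q _ hg) x
  meas g hg :=
    (mixAux_meas n p hp l (fun ω x => lq q (fun k => g ω k x)) (lq_meas q _ hg)).comp measurable_prodMk_right
  mct u hu hm := by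
    refine le_trans (mixAux_mono n p l (fun x => lq_mct q (lt_of_lt_of_le one_pos hq) (fun m k => u m k x) (fun k => hm k x)) hp x) ?_
    exact mixAux_mct n p hp hp1 l _ (fun m => lq_meas q _ (hu m)) (fun x a b hab => lq_mono q fun k => hm k x hab) x


lemma weak_mix (n : ℕ) (p : Fin n → ℝ≥0∞) (hp : ∀ i, p i ≠ ∞) (hp1 : ∀ i, 1 < (p i).toReal)
    (q : ℝ≥0∞) (hq : 1 ≤ q) (l : ℕ) (hl : l ≤ n) :
    ∃ W : ℝ≥0∞, W ≠ ∞ ∧ ∀ (G : GridS) (lev : ℕ → ℕ) (x : RV n),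
      Weak G lev (mixLN n p hp (fun i => (hp1 i).le) q hq l x) W := by
  induction l with
  | zero =>
    by_cases hqt : q = ∞
    · refine ⟨1, by simp, fun G lev x g hg t ht => ?_⟩
      set N := mixLN n p hp (fun i => (hp1 i).le) q hq 0 x with hN
      have hNv : ∀ u, N.N u = ⨆ k, u k x := by
        intro u; simp [hN, mixLN, mixAux, lq, hqt]
      rw [one_mul]
      refine le_trans ?_ (G.doob_weak (fun s => N.N (g s)) (ENNReal.ofReal t))
      refine mul_le_mul' le_rfl (measure_mono ?_)
      intro s hs
      have hs : ENNReal.ofReal t < N.N (Ti G lev g s) := hs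
      rw [hNv, lt_iSup_iff] at hs
      obtain ⟨k, hk⟩ := hs
      refine Set.mem_iUnion.2 ⟨lev k, lt_of_lt_of_le hk ?_⟩
      refine G.avg_mono _ (fun s => ?_) _
      rw [hNv]; exact le_iSup (fun k => g s k x) k
    · have hQ : 1 ≤ q.toReal := by
        rw [← ENNReal.toReal_one]; exact (ENNReal.toReal_le_toReal (by simp) hqt).2 hq
      refine ⟨1 + 1 * 2 ^ (q.toReal - 1), ?_, fun G lev x => weak_of_strong G lev _ hQ ?_⟩
      · have : (2:ℝ≥0∞) ^ (q.toReal - 1) ≠ ∞ := ENNReal.rpow_ne_top_of_nonneg (by linarith) (by simp)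
        finiteness
      · intro g hg
        set N := mixLN n p hp (fun i => (hp1 i).le) q hq 0 x with hN
        have hNv : ∀ u, N.N u ^ q.toReal = ∑' k, u k x ^ q.toReal := by
          intro u; simp only [hN, mixLN, mixAux, lq, hqt, if_false]
          rw [← ENNReal.rpow_mul, one_div_mul_cancel (by linarith), ENNReal.rpow_one]
        have hgx : ∀ k, Measurable fun s => g s k x := fun k => (hg k).comp measurable_prodMk_right
        have hgx2 : ∀ k, Measurable fun s => Ti G lev g s k x := fun k => by
          have h1 := JM.Ti G lev hg k
          generalize Ti G lev g = g' at h1 ⊢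
          exact h1.comp measurable_prodMk_right
        simp_rw [hNv]
        rw [one_mul, lintegral_tsum (fun k => ((hgx2 k).pow_const _).aemeasurable),
          lintegral_tsum (fun k => ((hgx k).pow_const _).aemeasurable)]
        refine ENNReal.tsum_le_tsum fun k => ?_
        rw [← G.int_avg_univ (lev k) (fun s => g s k x ^ q.toReal)]
        exact lintegral_mono fun s => G.avg_rpow _ _ (hgx k) _ hQ s
  | succ l ih =>
    obtain ⟨W, hW, hw⟩ := ih (by omega)
    set i : Fin n := ⟨l, by omega⟩
    set P := (p i).toReal with hPd
    have hP : 1 < P := hp1 i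
    refine ⟨1 + pfC W P * 2 ^ (P - 1), ?_, fun G lev x => weak_of_strong G lev _ hP.le ?_⟩
    · have : (2:ℝ≥0∞) ^ (P - 1) ≠ ∞ := ENNReal.rpow_ne_top_of_nonneg (by linarith) (by simp)
      have := pfC_ne_top W P hP hW
      finiteness
    · intro g hg
      have hNv : ∀ u, (mixLN n p hp (fun i => (hp1 i).le) q hq (l+1) x).N u ^ P =
          ∫⁻ s, (mixLN n p hp (fun i => (hp1 i).le) q hq l (Function.update x i s)).N u ^ P := by
        intro u
        simp only [mixLN]
        have := mixAux_succ n p hp i (fun x => lq q (fun k => u k x)) x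
        simp only [i] at this
        rw [this, ← ENNReal.rpow_mul, one_div_mul_cancel (by linarith), ENNReal.rpow_one]
      have hmeas : ∀ g : ℝ → ℕ → RV n → ℝ≥0∞, JM g → AEMeasurable (fun q' : ℝ × ℝ =>
         (mixLN n p hp (fun i => (hp1 i).le) q hq l (Function.update x i q'.2)).N (g q'.1) ^ P) (volume.prod volume) := by
        intro g hg
        have h1 := mixAux_meas n p hp l (fun t x => lq q (fun k => g t k x)) (lq_meas q _ hg)
        have h2 : Measurable fun q' : ℝ × ℝ => (q'.1, Function.update x i q'.2) :=
          measurable_fst.prodMk ((meas_upd n i).comp (measurable_const.prodMk measurable_snd))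
        exact ((h1.comp h2).pow_const P).aemeasurable
      simp_rw [hNv]
      have s1 := fun (g : ℝ → ℕ → RV n → ℝ≥0∞) (hg : JM g) => lintegral_lintegral_swap (f := fun t s =>
        (mixLN n p hp (fun i => (hp1 i).le) q hq l (Function.update x i s)).N (g t) ^ P) (hmeas g hg)
      rw [s1 _ (JM.Ti G lev hg), s1 g hg]
      rw [← lintegral_const_mul' _ _ (pfC_ne_top W P hP hW)]
      refine lintegral_mono fun s => ?_
      exact strong_of_weak G lev _ hW (hw G lev (Function.update x i s)) hP g hg

lemma mixAux_upd (n : ℕ) (p : Fin n → ℝ≥0∞) (hp : ∀ i, p i ≠ ∞) (i : Fin n) (l : ℕ) (hl : l ≤ i)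
    (F : RV n → ℝ≥0∞) (t : ℝ) (x : RV n) :
    mixAux n p l (fun z => F (Function.update z i t)) x = mixAux n p l F (Function.update x i t) := by
  induction l generalizing x with
  | zero => rfl
  | succ l ih =>
    have h1 : l < n := by omega
    simp only [mixAux, h1, dif_pos, hp, if_false]
    congr 1
    refine lintegral_congr fun s => ?_
    rw [ih (by omega), Function.update_comm]
    intro h; have := congrArg Fin.val h; simp at this; omega

lemma mixAux_up (n : ℕ) (p : Fin n → ℝ≥0∞) (hp : ∀ i, p i ≠ ∞) (hp0 : ∀ i, 0 < (p i).toReal) (c : ℝ≥0∞) (hc : c ≠ ∞)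
    (F H : RV n → ℝ≥0∞) (l m : ℕ) (hlm : l ≤ m) (h : ∀ x, mixAux n p l F x ≤ c * mixAux n p l H x) :
    ∀ x, mixAux n p m F x ≤ c * mixAux n p m H x := by
  induction m, hlm using Nat.le_induction with
  | base => exact h
  | succ m _ ih =>
    intro x
    by_cases h1 : m < n
    · simp only [mixAux, h1, dif_pos, hp, if_false]
      set P := (p ⟨m, h1⟩).toReal
      have hP : 0 < P := hp0 ⟨m, h1⟩
      calc _ ≤ (∫⁻ t, (c * mixAux n p m H (Function.update x ⟨m, h1⟩ t)) ^ P) ^ (1 / P) := by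
            gcongr with t; exact ih _
        _ = _ := by
            simp_rw [ENNReal.mul_rpow_of_nonneg _ _ hP.le]
            rw [lintegral_const_mul' _ _ (ENNReal.rpow_ne_top_of_nonneg hP.le hc),
              ENNReal.mul_rpow_of_nonneg _ _ (by positivity), ← ENNReal.rpow_mul, mul_one_div_cancel hP.ne', ENNReal.rpow_one]
    · simp only [mixAux, h1, dif_neg, not_false_eq_true]; exact ih x

/-- averaging in the coordinate i -/
def Tco (n : ℕ) (G : GridS) (lev : ℕ → ℕ) (i : Fin n) (u : ℕ → RV n → ℝ≥0∞) : ℕ → RV n → ℝ≥0∞ :=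
  fun k x => G.avg (lev k) (fun s => u k (Function.update x i s)) (x i)

lemma Tco_meas (n : ℕ) (G : GridS) (lev : ℕ → ℕ) (i : Fin n) (u : ℕ → RV n → ℝ≥0∞) (hu : ∀ k, Measurable (u k)) (k : ℕ) :
    Measurable (Tco n G lev i u k) := by
  have h := G.avg_meas (lev k) (fun (x : RV n) s => u k (Function.update x i s)) ((hu k).comp (meas_upd n i))
  have h2 : Measurable fun x : RV n => (x, x i) := by fun_prop
  have := h.comp h2
  change Measurable fun x => G.avg (lev k) (fun s => u k (Function.update x i s)) (x i)
  simpa only [Function.comp_def] using this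

lemma Tco_bdd (n : ℕ) (p : Fin n → ℝ≥0∞) (hp : ∀ i, p i ≠ ∞) (hp1 : ∀ i, 1 < (p i).toReal)
    (q : ℝ≥0∞) (hq : 1 ≤ q) (i : Fin n) :
    ∃ C : ℝ≥0∞, C ≠ ∞ ∧ ∀ (G : GridS) (lev : ℕ → ℕ) (u : ℕ → RV n → ℝ≥0∞), (∀ k, Measurable (u k)) → ∀ x,
      (mixLN n p hp (fun i => (hp1 i).le) q hq n x).N (Tco n G lev i u) ≤
        C * (mixLN n p hp (fun i => (hp1 i).le) q hq n x).N u := by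
  obtain ⟨W, hW, hw⟩ := weak_mix n p hp hp1 q hq i i.2.le
  set P := (p i).toReal with hPd
  have hP : 1 < P := hp1 i
  have hCt : (pfC W P) ^ (1 / P) ≠ ∞ := ENNReal.rpow_ne_top_of_nonneg (by positivity) (pfC_ne_top W P hP hW)
  refine ⟨(pfC W P) ^ (1 / P), hCt, fun G lev u hu => ?_⟩
  refine mixAux_up n p hp (fun i => by have := hp1 i; linarith) _ hCt _ _ (i + 1) n (by omega) fun x => ?_
  rw [mixAux_succ n p hp i, mixAux_succ n p hp i]
  set g : ℝ → ℕ → RV n → ℝ≥0∞ := fun t k z => u k (Function.update z i t) with hg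
  have hgJ : JM g := fun k => (hu k).comp ((meas_upd n i).comp measurable_swap)
  have h := strong_of_weak G lev _ hW (hw G lev x) hP g hgJ
  have e1 : ∀ t, mixAux n p i (fun x => lq q (fun k => Tco n G lev i u k x)) (Function.update x i t) =
     (mixLN n p hp (fun i => (hp1 i).le) q hq i x).N (Ti G lev g t) := by
    intro t
    rw [← mixAux_upd n p hp i i le_rfl]
    simp only [mixLN, Tco, Ti, hg, Function.update_idem, Function.update_self]
  have e2 : ∀ t, mixAux n p i (fun x => lq q (fun k => u k x)) (Function.update x i t) =
     (mixLN n p hp (fun i => (hp1 i).le) q hq i x).N (g t) := by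
    intro t
    rw [← mixAux_upd n p hp i i le_rfl]
    simp only [mixLN, hg]
  simp_rw [e1, e2]
  rw [← ENNReal.mul_rpow_of_nonneg _ _ (by positivity)]
  exact ENNReal.rpow_le_rpow h (by positivity)


lemma cell_eq (α β : ℝ) (hα : 0 < α) (j : ℤ) :
    {s : ℝ | ⌊α * s + β⌋ = j} = Set.Ico (((j:ℝ) - β) / α) (((j:ℝ) + 1 - β) / α) := by
  ext s
  simp only [Set.mem_ofPred_eq, Int.floor_eq_iff, Set.mem_Ico, div_le_iff₀ hα, lt_div_iff₀ hα]
  constructor <;> rintro ⟨h1, h2⟩ <;> constructor <;> linarith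

lemma cell_vol (α β : ℝ) (hα : 0 < α) (j : ℤ) :
    volume {s : ℝ | ⌊α * s + β⌋ = j} = ENNReal.ofReal α⁻¹ := by
  rw [cell_eq α β hα, Real.volume_Ico]; congr 1; field_simp; ring

/-- grids with scale c and offsets b -/
def gridMk (c : ℝ) (hc : 0 < c) (b : ℕ → ℝ) (e : ℕ → ℤ) (hb : ∀ n, 2 * b n - b (n+1) = e n) : GridS where
  ix n t := ⌊2 ^ n * c * t + b n⌋
  meas n := by fun_prop
  nest n s t h := by
    have key : ∀ t, ⌊2 ^ n * c * t + b n⌋ = (⌊2 ^ (n+1) * c * t + b (n+1)⌋ + e n) / 2 := by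
      intro t
      rw [← Int.floor_add_intCast, show (2:ℤ) = ((2:ℕ):ℤ) by rfl, ← Int.floor_div_natCast]
      congr 1
      rw [← hb n]; push_cast; ring
    rw [key s, key t, h]
  vol0 n t := by
    rw [cell_vol _ _ (by positivity)]
    simp; positivity
  volT n t := by rw [cell_vol _ _ (by positivity)]; simp
  dbl n t := by
    rw [cell_vol _ _ (by positivity), cell_vol _ _ (by positivity), show (2:ℝ≥0∞) = ENNReal.ofReal 2 by simp,
      ← ENNReal.ofReal_mul (by norm_num)]
    refine ENNReal.ofReal_le_ofReal (le_of_eq ?_)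
    rw [pow_succ]; field_simp

def grid0 (m : ℕ) : GridS := gridMk ((2:ℝ) ^ (m + 4))⁻¹ (by positivity) (fun _ => 0) (fun _ => 0) (by simp)

def grid1 (m : ℕ) : GridS := gridMk ((2:ℝ) ^ (m + 4))⁻¹ (by positivity) (fun n => (-1) ^ n / 3) (fun n => (-1) ^ n)
  (by intro n; push_cast; rw [pow_succ]; ring)

lemma third_trick (v w : ℝ) (σ : ℝ) (hσ : σ = 1 ∨ σ = -1) (h : |v - w| ≤ 1 / 16) :
    ⌊v⌋ = ⌊w⌋ ∨ ⌊v + σ / 3⌋ = ⌊w + σ / 3⌋ := by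
  by_contra hcon
  push Not at hcon
  obtain ⟨h1, h2⟩ := hcon
  have sep : ∀ v w : ℝ, |v - w| ≤ 1/16 → ⌊v⌋ ≠ ⌊w⌋ → ∃ j : ℤ, |v - j| ≤ 1/16 := by
    intro v w h hne
    rw [abs_le] at h
    rcases lt_or_gt_of_ne hne with hlt | hlt
    · refine ⟨⌊w⌋, ?_⟩
      have a1 : v < ⌊w⌋ := Int.floor_lt.1 hlt
      have a2 := Int.floor_le w
      rw [abs_le]; constructor <;> linarith
    · refine ⟨⌊v⌋, ?_⟩
      have a1 : w < ⌊v⌋ := Int.floor_lt.1 hlt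
      have a2 := Int.floor_le v
      rw [abs_le]; constructor <;> linarith
  obtain ⟨j, hj⟩ := sep v w h h1
  obtain ⟨j', hj'⟩ := sep (v + σ/3) (w + σ/3) (by simpa using h) h2
  rw [abs_le] at hj hj'
  have h3 : (-1:ℝ) < ((j' - j : ℤ) : ℝ) := by push_cast; rcases hσ with h | h <;> subst h <;> linarith
  have h4 : ((j' - j : ℤ) : ℝ) < 1 := by push_cast; rcases hσ with h | h <;> subst h <;> linarith
  have h5 : j' - j = 0 := by
    have : (-1:ℤ) < j' - j := by exact_mod_cast h3
    have : j' - j < (1:ℤ) := by exact_mod_cast h4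
    omega
  have h6 : (j':ℝ) = j := by exact_mod_cast (by omega : j' = j)
  rw [h6] at hj'
  rcases hσ with h | h <;> subst h <;> linarith

lemma ball_sub_cell (m L : ℕ) (s t : ℝ) (h : |t - s| ≤ 2 ^ m / 2 ^ L) :
    (grid0 m).ix L s = (grid0 m).ix L t ∨ (grid1 m).ix L s = (grid1 m).ix L t := by
  have := third_trick (2 ^ L * ((2:ℝ) ^ (m + 4))⁻¹ * s) (2 ^ L * ((2:ℝ) ^ (m + 4))⁻¹ * t) ((-1) ^ L)
    (neg_one_pow_eq_or ℝ L) ?_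
  · simpa [grid0, grid1, gridMk] using this
  · rw [← mul_sub, abs_mul, abs_of_pos (by positivity), abs_sub_comm]
    calc _ ≤ 2 ^ L * ((2:ℝ) ^ (m + 4))⁻¹ * (2 ^ m / 2 ^ L) := by gcongr
      _ = 1 / 16 := by rw [pow_add]; field_simp; norm_num

lemma ball_avg (m L : ℕ) (g : ℝ → ℝ≥0∞) (t : ℝ) :
    ∫⁻ s in {s | |t - s| ≤ 2 ^ m / 2 ^ L}, g s ≤
      ENNReal.ofReal (2 ^ (m + 4) / 2 ^ L) * ((grid0 m).avg L g t + (grid1 m).avg L g t) := by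
  have hv : ∀ (G : GridS), (volume {s | G.ix L s = G.ix L t} = ENNReal.ofReal (2 ^ (m + 4) / 2 ^ L)) →
     ENNReal.ofReal (2 ^ (m + 4) / 2 ^ L) * G.avg L g t = ∫⁻ s in {s | G.ix L s = G.ix L t}, g s := by
    intro G hG
    unfold GridS.avg GridS.avgI
    rw [hG, ← mul_assoc, ENNReal.mul_inv_cancel (by simp) (by simp), one_mul]
  rw [mul_add, hv (grid0 m), hv (grid1 m)]
  · refine le_trans (lintegral_mono_set ?_) (lintegral_union_le g _ _)
    intro s hs
    exact ball_sub_cell m L s t hs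
  · have := cell_vol (2 ^ L * ((2:ℝ) ^ (m + 4))⁻¹) ((-1) ^ L / 3) (by positivity) ((grid1 m).ix L t)
    simp only [grid1, gridMk] at this ⊢
    rw [this]; congr 1; field_simp
  · have := cell_vol (2 ^ L * ((2:ℝ) ^ (m + 4))⁻¹) 0 (by positivity) ((grid0 m).ix L t)
    simp only [grid0, gridMk] at this ⊢
    rw [this]; congr 1; field_simp

lemma ker_le (ρ : ℝ) (hρ : 1 < ρ) (d : ℝ) (hd : 0 ≤ d) :
    ENNReal.ofReal ((1 + d) ^ (-ρ)) ≤ ∑' m : ℕ, ENNReal.ofReal (2 ^ ρ * 2 ^ (-(m:ℝ) * ρ)) *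
      (if d ≤ 2 ^ m then 1 else 0) := by
  classical
  have hex : ∃ m : ℕ, d ≤ 2 ^ m := pow_unbounded_of_one_lt d (by norm_num : (1:ℝ) < 2) |>.imp fun _ h => h.le
  set m := Nat.find hex with hm
  have h1 : d ≤ 2 ^ m := Nat.find_spec hex
  refine le_trans ?_ (ENNReal.le_tsum m)
  simp only [h1, if_true, mul_one]
  refine ENNReal.ofReal_le_ofReal ?_
  have h2 : (2:ℝ) ^ ((m:ℝ) - 1) ≤ 1 + d := by
    rcases Nat.eq_zero_or_pos m with h0 | h0
    · rw [h0]; simp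
      calc (2:ℝ) ^ (-1:ℝ) ≤ 1 := by rw [Real.rpow_neg_one]; norm_num
        _ ≤ _ := by linarith
    · have := Nat.find_min hex (m := m - 1) (by omega)
      push Not at this
      have e : (2:ℝ) ^ ((m:ℝ) - 1) = 2 ^ (m - 1) := by
        rw [← Real.rpow_natCast, Nat.cast_sub h0]; simp
      rw [e]; linarith
  calc (1 + d) ^ (-ρ) ≤ ((2:ℝ) ^ ((m:ℝ) - 1)) ^ (-ρ) :=
        Real.rpow_le_rpow_of_nonpos (by positivity) h2 (by linarith)
    _ = _ := by rw [← Real.rpow_mul (by norm_num), ← Real.rpow_add (by norm_num)]; congr 1; ring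

/-- kernel in one coordinate -/
def kap (a ρ : ℝ) (k : ℕ) (d : ℝ) : ℝ≥0∞ :=
  ENNReal.ofReal ((2:ℝ) ^ ((k:ℝ) * a) * (1 + (2:ℝ) ^ ((k:ℝ) * a) * |d|) ^ (-ρ))

lemma kap_meas (a ρ : ℝ) (k : ℕ) : Measurable (kap a ρ k) := by
  unfold kap; fun_prop

lemma kap_avg (a ρ : ℝ) (ha : 0 ≤ a) (hρ : 1 < ρ) (k : ℕ) (g : ℝ → ℝ≥0∞) (hg : Measurable g) (t : ℝ) :
    ∫⁻ s, kap a ρ k (t - s) * g s ≤ ∑' m : ℕ, ENNReal.ofReal (32 * 2 ^ ρ * 2 ^ (-(m:ℝ) * (ρ - 1))) *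
      ((grid0 m).avg ⌊(k:ℝ) * a⌋₊ g t + (grid1 m).avg ⌊(k:ℝ) * a⌋₊ g t) := by
  set L := ⌊(k:ℝ) * a⌋₊ with hL
  set la := (2:ℝ) ^ ((k:ℝ) * a) with hla
  have hla0 : 0 < la := by positivity
  have hl1 : (2:ℝ) ^ L ≤ la := by
    rw [hla, ← Real.rpow_natCast]
    exact Real.rpow_le_rpow_of_exponent_le (by norm_num) (Nat.floor_le (by positivity))
  have hl2 : la ≤ 2 * 2 ^ L := by
    rw [hla, ← pow_succ', ← Real.rpow_natCast]
    refine Real.rpow_le_rpow_of_exponent_le (by norm_num) ?_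
    push_cast; exact (Nat.lt_floor_add_one _).le
  have hS : ∀ m : ℕ, MeasurableSet {s : ℝ | |t - s| ≤ 2 ^ m / 2 ^ L} := fun m =>
    measurableSet_le (by fun_prop) (by fun_prop)
  calc _ ≤ ∫⁻ s, ∑' m : ℕ, (ENNReal.ofReal (la * (2 ^ ρ * 2 ^ (-(m:ℝ) * ρ))) *
      {s : ℝ | |t - s| ≤ 2 ^ m / 2 ^ L}.indicator g s) := by
        refine lintegral_mono fun s => ?_
        unfold kap
        rw [← hla, ENNReal.ofReal_mul hla0.le]
        have := ker_le ρ hρ (la * |t - s|) (by positivity)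
        calc _ ≤ ENNReal.ofReal la * (∑' m : ℕ, ENNReal.ofReal (2 ^ ρ * 2 ^ (-(m:ℝ) * ρ)) *
              (if la * |t - s| ≤ 2 ^ m then 1 else 0)) * g s := by gcongr
          _ = ∑' m : ℕ, ENNReal.ofReal la * (ENNReal.ofReal (2 ^ ρ * 2 ^ (-(m:ℝ) * ρ)) *
              (if la * |t - s| ≤ 2 ^ m then 1 else 0)) * g s := by
              rw [ENNReal.tsum_mul_right, ENNReal.tsum_mul_left]
          _ ≤ _ := by
              refine ENNReal.tsum_le_tsum fun m => ?_
              rw [ENNReal.ofReal_mul hla0.le, ← mul_assoc, mul_assoc _ _ (g s)]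
              refine mul_le_mul' le_rfl ?_
              split_ifs with h
              · have : |t - s| ≤ 2 ^ m / 2 ^ L := by
                  rw [le_div_iff₀ (by positivity)]
                  refine le_trans ?_ h
                  rw [mul_comm]; gcongr
                simp [this]
              · simp
    _ = ∑' m : ℕ, ENNReal.ofReal (la * (2 ^ ρ * 2 ^ (-(m:ℝ) * ρ))) * ∫⁻ s in {s : ℝ | |t - s| ≤ 2 ^ m / 2 ^ L}, g s := by
        rw [lintegral_tsum (fun m => ((hg.indicator (hS m)).const_mul _).aemeasurable)]
        refine tsum_congr fun m => ?_
        rw [lintegral_const_mul _ (hg.indicator (hS m)), lintegral_indicator (hS m)]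
    _ ≤ _ := by
        refine ENNReal.tsum_le_tsum fun m => ?_
        calc _ ≤ ENNReal.ofReal (la * (2 ^ ρ * 2 ^ (-(m:ℝ) * ρ))) * (ENNReal.ofReal (2 ^ (m + 4) / 2 ^ L) * ((grid0 m).avg L g t + (grid1 m).avg L g t)) := by
              gcongr; exact ball_avg m L g t
          _ ≤ _ := by
              rw [← mul_assoc, ← ENNReal.ofReal_mul (by positivity)]
              refine mul_le_mul' (ENNReal.ofReal_le_ofReal ?_) le_rfl
              calc la * (2 ^ ρ * 2 ^ (-(m:ℝ) * ρ)) * (2 ^ (m + 4) / 2 ^ L) ≤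
                  (2 * 2 ^ L) * (2 ^ ρ * 2 ^ (-(m:ℝ) * ρ)) * (2 ^ (m + 4) / 2 ^ L) := by gcongr
                _ = 32 * 2 ^ ρ * (2 ^ (-(m:ℝ) * ρ) * 2 ^ m) := by rw [pow_add]; field_simp; norm_num
                _ = _ := by
                  rw [← Real.rpow_natCast 2 m, ← Real.rpow_add (by norm_num)]
                  congr 2; ring

lemma geo_fin (c x : ℝ) (hx : 0 < x) : ∑' m : ℕ, ENNReal.ofReal (c * 2 ^ (-(m:ℝ) * x)) ≠ ∞ := by
  have : Summable fun m : ℕ => c * (2:ℝ) ^ (-(m:ℝ) * x) := by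
    have e : ∀ m : ℕ, c * (2:ℝ) ^ (-(m:ℝ) * x) = c * ((2:ℝ) ^ (-x)) ^ m := by
      intro m; rw [← Real.rpow_natCast, ← Real.rpow_mul (by norm_num)]; congr 2; ring
    simp_rw [e]
    refine (summable_geometric_of_lt_one (by positivity) ?_).mul_left c
    exact Real.rpow_lt_one_of_one_lt_of_neg (by norm_num) (by linarith)
  exact this.tsum_ofReal_ne_top

/-- convolution with the kernel in coordinate i -/
def Kco (n : ℕ) (a ρ : Fin n → ℝ) (i : Fin n) (u : ℕ → RV n → ℝ≥0∞) : ℕ → RV n → ℝ≥0∞ :=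
  fun k x => ∫⁻ s, kap (a i) (ρ i) k (x i - s) * u k (Function.update x i s)

lemma Kco_meas (n : ℕ) (a ρ : Fin n → ℝ) (i : Fin n) (u : ℕ → RV n → ℝ≥0∞) (hu : ∀ k, Measurable (u k)) (k : ℕ) :
    Measurable (Kco n a ρ i u k) := by
  unfold Kco
  have : Measurable fun q : RV n × ℝ => kap (a i) (ρ i) k (q.1 i - q.2) * u k (Function.update q.1 i q.2) := by
    refine ((kap_meas (a i) (ρ i) k).comp ?_).mul ((hu k).comp (meas_upd n i))
    fun_prop
  exact Measurable.lintegral_prod_right' this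

lemma Kco_bdd (n : ℕ) (a ρ : Fin n → ℝ) (ha : ∀ i, 0 ≤ a i) (hρ : ∀ i, 1 < ρ i)
    (p : Fin n → ℝ≥0∞) (hp : ∀ i, p i ≠ ∞) (hp1 : ∀ i, 1 < (p i).toReal)
    (q : ℝ≥0∞) (hq : 1 ≤ q) (i : Fin n) :
    ∃ C : ℝ≥0∞, C ≠ ∞ ∧ ∀ (u : ℕ → RV n → ℝ≥0∞), (∀ k, Measurable (u k)) → ∀ x,
      (mixLN n p hp (fun i => (hp1 i).le) q hq n x).N (Kco n a ρ i u) ≤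
        C * (mixLN n p hp (fun i => (hp1 i).le) q hq n x).N u := by
  obtain ⟨C, hC, hT⟩ := Tco_bdd n p hp hp1 q hq i
  set cc : ℕ → ℝ := fun m => 32 * 2 ^ ρ i * 2 ^ (-(m:ℝ) * (ρ i - 1)) with hcc
  have hcct : ∑' m, ENNReal.ofReal (cc m) ≠ ∞ := geo_fin _ _ (by linarith [hρ i])
  refine ⟨(∑' m, ENNReal.ofReal (cc m)) * (C + C), ENNReal.mul_ne_top hcct (by finiteness), fun u hu x => ?_⟩
  set N := mixLN n p hp (fun i => (hp1 i).le) q hq n x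
  set lev : ℕ → ℕ := fun k => ⌊(k:ℝ) * a i⌋₊
  have hm0 := fun m => Tco_meas n (grid0 m) lev i u hu
  have hm1 := fun m => Tco_meas n (grid1 m) lev i u hu
  calc N.N (Kco n a ρ i u) ≤ N.N (fun k x => ∑' m : ℕ, ENNReal.ofReal (cc m) *
        (Tco n (grid0 m) lev i u k x + Tco n (grid1 m) lev i u k x)) := by
        refine N.mono _ _ fun k x => ?_
        exact kap_avg (a i) (ρ i) (ha i) (hρ i) k (fun s => u k (Function.update x i s))
          ((hu k).comp ((meas_upd n i).comp measurable_prodMk_left)) (x i)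
    _ ≤ ∑' m : ℕ, N.N (fun k x => ENNReal.ofReal (cc m) *
        (Tco n (grid0 m) lev i u k x + Tco n (grid1 m) lev i u k x)) :=
        N.tsum _ fun m k => ((hm0 m k).add (hm1 m k)).const_mul _
    _ ≤ ∑' m : ℕ, ENNReal.ofReal (cc m) * (C * N.N u + C * N.N u) := by
        refine ENNReal.tsum_le_tsum fun m => ?_
        refine (N.smul (cc m).toNNReal _ fun k => ((hm0 m k).add (hm1 m k))).trans ?_
        refine mul_le_mul' le_rfl ?_
        refine (N.add _ _ (hm0 m) (hm1 m)).trans ?_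
        exact add_le_add (hT _ _ u hu x) (hT _ _ u hu x)
    _ = _ := by rw [ENNReal.tsum_mul_right]; ring

/-- full kernel convolution -/
def Kall (n : ℕ) (a ρ : Fin n → ℝ) (u : ℕ → RV n → ℝ≥0∞) : ℕ → RV n → ℝ≥0∞ :=
  fun k x => ∫⁻ z, (∏ l, kap (a l) (ρ l) k (x l - z l)) * u k z

def KS (n : ℕ) (a ρ : Fin n → ℝ) (S : Finset (Fin n)) (u : ℕ → RV n → ℝ≥0∞) : ℕ → RV n → ℝ≥0∞ :=
  fun k x => (lmarginal (fun _ => volume) S (fun z => (∏ l ∈ S, kap (a l) (ρ l) k (x l - z l)) * u k z)) x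

lemma KS_insert (n : ℕ) (a ρ : Fin n → ℝ) (S : Finset (Fin n)) (i : Fin n) (hi : i ∉ S)
    (u : ℕ → RV n → ℝ≥0∞) (hu : ∀ k, Measurable (u k)) : KS n a ρ (insert i S) u = Kco n a ρ i (KS n a ρ S u) := by
  classical
  ext k x
  unfold KS Kco
  have hprod : ∀ T : Finset (Fin n), Measurable fun z : RV n => ∏ l ∈ T, kap (a l) (ρ l) k (x l - z l) := by
    intro T
    refine Finset.measurable_prod _ fun l _ => (kap_meas _ _ k).comp (by fun_prop)
  have hm : Measurable fun z : RV n => (∏ l ∈ insert i S, kap (a l) (ρ l) k (x l - z l)) * u k z := (hprod _).mul (hu k)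
  rw [lmarginal_insert _ hm hi]
  refine lintegral_congr fun t => ?_
  unfold lmarginal
  rw [← lintegral_const_mul']
  · refine lintegral_congr fun y => ?_
    beta_reduce
    rw [Finset.prod_insert hi, mul_assoc]
    have e1 : Function.updateFinset (Function.update x i t) S y i = t := by
      simp [Function.updateFinset, hi]
    rw [e1]
    congr 2
    refine Finset.prod_congr rfl fun l hl => ?_
    have hne : l ≠ i := fun h => hi (h ▸ hl)
    rw [Function.update_of_ne hne]
  · simp [kap]

lemma Kall_eq (n : ℕ) (a ρ : Fin n → ℝ) (u : ℕ → RV n → ℝ≥0∞) : KS n a ρ Finset.univ u = Kall n a ρ u := by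
  ext k x
  unfold KS Kall
  rw [lmarginal_univ]; rfl

lemma Kall_bdd (n : ℕ) (a ρ : Fin n → ℝ) (ha : ∀ i, 0 ≤ a i) (hρ : ∀ i, 1 < ρ i)
    (p : Fin n → ℝ≥0∞) (hp : ∀ i, p i ≠ ∞) (hp1 : ∀ i, 1 < (p i).toReal)
    (q : ℝ≥0∞) (hq : 1 ≤ q) :
    ∃ C : ℝ≥0∞, C ≠ ∞ ∧ ∀ (u : ℕ → RV n → ℝ≥0∞), (∀ k, Measurable (u k)) → (∀ k, Measurable (Kall n a ρ u k)) ∧ ∀ x,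
      (mixLN n p hp (fun i => (hp1 i).le) q hq n x).N (Kall n a ρ u) ≤
        C * (mixLN n p hp (fun i => (hp1 i).le) q hq n x).N u := by
  classical
  have key : ∀ S : Finset (Fin n), ∃ C : ℝ≥0∞, C ≠ ∞ ∧ ∀ (u : ℕ → RV n → ℝ≥0∞), (∀ k, Measurable (u k)) → (∀ k, Measurable (KS n a ρ S u k)) ∧ ∀ x,
      (mixLN n p hp (fun i => (hp1 i).le) q hq n x).N (KS n a ρ S u) ≤
        C * (mixLN n p hp (fun i => (hp1 i).le) q hq n x).N u := by
    intro S
    induction S using Finset.induction_on with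
    | empty =>
      have : ∀ u, KS n a ρ ∅ u = u := by intro u; ext k x; simp [KS]
      refine ⟨1, by simp, fun u hu => ?_⟩
      rw [this]; exact ⟨hu, fun x => by rw [one_mul]⟩
    | insert i S hi ih =>
      obtain ⟨C, hC, h⟩ := ih
      obtain ⟨C', hC', h'⟩ := Kco_bdd n a ρ ha hρ p hp hp1 q hq i
      refine ⟨C' * C, ENNReal.mul_ne_top hC' hC, fun u hu => ?_⟩
      rw [KS_insert n a ρ S i hi u hu]
      refine ⟨Kco_meas n a ρ i _ (h u hu).1, fun x => (h' _ (h u hu).1 x).trans ?_⟩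
      rw [mul_assoc]
      exact mul_le_mul' le_rfl ((h u hu).2 x)
  simpa only [Kall_eq] using key Finset.univ


def wk (a ρ : ℝ) (k : ℕ) (d : ℝ) : ℝ≥0∞ :=
  ENNReal.ofReal ((1 + (2:ℝ) ^ ((k:ℝ) * a) * |d|) ^ (-ρ))

lemma kap_eq (a ρ : ℝ) (k : ℕ) (d : ℝ) : kap a ρ k d = ENNReal.ofReal ((2:ℝ) ^ ((k:ℝ) * a)) * wk a ρ k d := by
  unfold kap wk; rw [ENNReal.ofReal_mul (by positivity)]

lemma wk_ne_top (a ρ : ℝ) (k : ℕ) (d : ℝ) : wk a ρ k d ≠ ∞ := by simp [wk]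

lemma wk_pos (a ρ : ℝ) (k : ℕ) (d : ℝ) : 0 < wk a ρ k d := by
  unfold wk; rw [ENNReal.ofReal_pos]; positivity

lemma wk_le_one (a ρ : ℝ) (hρ : 0 ≤ ρ) (k : ℕ) (d : ℝ) : wk a ρ k d ≤ 1 := by
  unfold wk
  rw [ENNReal.ofReal_le_one]
  exact Real.rpow_le_one_of_one_le_of_nonpos (by have : 0 ≤ (2:ℝ) ^ ((k:ℝ) * a) * |d| := by positivity
                                                 linarith) (by linarith)

lemma wk_zero (a ρ : ℝ) (k : ℕ) : wk a ρ k 0 = 1 := by simp [wk]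

lemma wk_rpow (a ρ τ : ℝ) (hτ : 0 ≤ τ) (k : ℕ) (d : ℝ) : (wk a ρ k d) ^ τ = wk a (τ * ρ) k d := by
  unfold wk
  rw [ENNReal.ofReal_rpow_of_nonneg (by positivity) hτ, ← Real.rpow_mul (by positivity)]
  congr 2; ring

lemma wk_add (a ρ σ : ℝ) (k : ℕ) (d : ℝ) : wk a (ρ + σ) k d = wk a ρ k d * wk a σ k d := by
  unfold wk
  rw [← ENNReal.ofReal_mul (by positivity), ← Real.rpow_add (by positivity)]
  congr 2; ring

lemma wk_anti (a ρ σ : ℝ) (h : ρ ≤ σ) (k : ℕ) (d : ℝ) : wk a σ k d ≤ wk a ρ k d := by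
  unfold wk
  refine ENNReal.ofReal_le_ofReal (Real.rpow_le_rpow_of_exponent_le ?_ (by linarith))
  have : 0 ≤ (2:ℝ) ^ ((k:ℝ) * a) * |d| := by positivity
  linarith

lemma wk_tri (a ρ : ℝ) (ha : 0 ≤ a) (hρ : 0 ≤ ρ) (j m : ℕ) (x y z : ℝ) :
    wk a ρ j (x - y) * wk a ρ (j + m) (y - z) ≤ wk a ρ j (x - z) := by
  unfold wk
  rw [← ENNReal.ofReal_mul (by positivity), ← Real.mul_rpow (by positivity) (by positivity)]
  refine ENNReal.ofReal_le_ofReal (Real.rpow_le_rpow_of_nonpos (by positivity) ?_ (by linarith))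
  have h1 : (2:ℝ) ^ ((j:ℝ) * a) ≤ (2:ℝ) ^ (((j + m : ℕ):ℝ) * a) :=
    Real.rpow_le_rpow_of_exponent_le (by norm_num) (by push_cast; gcongr; simp)
  set A := (2:ℝ) ^ ((j:ℝ) * a) with hA
  set B := (2:ℝ) ^ (((j + m : ℕ):ℝ) * a) with hB
  have hA0 : 0 < A := by positivity
  have hB0 : 0 < B := by positivity
  have h2 : |x - z| ≤ |x - y| + |y - z| := abs_sub_le _ _ _
  have h3 : A * |x - z| ≤ A * (|x - y| + |y - z|) := by gcongr
  have h4 : A * |y - z| ≤ B * |y - z| := by gcongr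
  have h5 : 0 ≤ (A * |x - y|) * (B * |y - z|) := by positivity
  nlinarith

lemma kap_shift (a ρ : ℝ) (ha : 0 ≤ a) (hρ : 0 ≤ ρ) (j m : ℕ) (x y z : ℝ) :
    wk a ρ j (x - y) * kap a ρ (j + m) (y - z) ≤ ENNReal.ofReal (2 ^ ((m:ℝ) * a)) * kap a ρ j (x - z) := by
  rw [kap_eq, kap_eq, mul_left_comm, ← mul_assoc (ENNReal.ofReal (2 ^ ((m:ℝ) * a))), ← ENNReal.ofReal_mul (by positivity)]
  rw [show ENNReal.ofReal ((2:ℝ) ^ ((m:ℝ) * a) * (2:ℝ) ^ ((j:ℝ) * a)) = ENNReal.ofReal ((2:ℝ) ^ (((j+m:ℕ):ℝ) * a)) by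
    rw [← Real.rpow_add (by norm_num)]; congr 2; push_cast; ring]
  exact mul_le_mul' le_rfl (wk_tri a ρ ha hρ j m x y z)

/-- product weight -/
def Wk (n : ℕ) (a ρ : Fin n → ℝ) (k : ℕ) (x y : RV n) : ℝ≥0∞ := ∏ l, wk (a l) (ρ l) k (x l - y l)

/-- product kernel -/
def Kp (n : ℕ) (a ρ : Fin n → ℝ) (k : ℕ) (x z : RV n) : ℝ≥0∞ := ∏ l, kap (a l) (ρ l) k (x l - z l)

def p2 (t : ℝ) : ℝ≥0∞ := ENNReal.ofReal ((2:ℝ) ^ t)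

lemma p2_add (s t : ℝ) : p2 (s + t) = p2 s * p2 t := by
  unfold p2; rw [Real.rpow_add (by norm_num), ENNReal.ofReal_mul (by positivity)]
lemma p2_rpow (s t : ℝ) (ht : 0 ≤ t) : (p2 s) ^ t = p2 (s * t) := by
  unfold p2; rw [ENNReal.ofReal_rpow_of_nonneg (by positivity) ht, Real.rpow_mul (by norm_num)]
lemma p2_mono {s t : ℝ} (h : s ≤ t) : p2 s ≤ p2 t :=
  ENNReal.ofReal_le_ofReal (Real.rpow_le_rpow_of_exponent_le (by norm_num) h)
lemma p2_ne_top (s : ℝ) : p2 s ≠ ∞ := by simp [p2]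
lemma p2_pos (s : ℝ) : 0 < p2 s := by unfold p2; rw [ENNReal.ofReal_pos]; positivity
lemma p2_zero : p2 0 = 1 := by simp [p2]
lemma p2_sum (n : ℕ) (a : Fin n → ℝ) (m : ℝ) : ∏ l, p2 (m * a l) = p2 (m * ∑ l, a l) := by
  unfold p2
  rw [← ENNReal.ofReal_prod_of_nonneg (fun _ _ => by positivity), Finset.mul_sum, Real.rpow_sum_of_pos (by norm_num)]

lemma Kp_eq (n : ℕ) (a ρ : Fin n → ℝ) (k : ℕ) (x z : RV n) : Kp n a ρ k x z = p2 (k * ∑ l, a l) * Wk n a ρ k x z := by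
  unfold Kp Wk
  simp_rw [kap_eq]
  rw [Finset.prod_mul_distrib, ← p2_sum]; rfl

lemma Wk_ne_top (n : ℕ) (a ρ : Fin n → ℝ) (k : ℕ) (x y : RV n) : Wk n a ρ k x y ≠ ∞ :=
  ENNReal.prod_ne_top fun _ _ => wk_ne_top _ _ _ _
lemma Wk_pos (n : ℕ) (a ρ : Fin n → ℝ) (k : ℕ) (x y : RV n) : Wk n a ρ k x y ≠ 0 :=
  Finset.prod_ne_zero_iff.2 fun _ _ => (wk_pos _ _ _ _).ne'
lemma Wk_le_one (n : ℕ) (a ρ : Fin n → ℝ) (hρ : ∀ l, 0 ≤ ρ l) (k : ℕ) (x y : RV n) : Wk n a ρ k x y ≤ 1 :=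
  Finset.prod_le_one' fun _ _ => wk_le_one _ _ (hρ _) _ _
lemma Wk_self (n : ℕ) (a ρ : Fin n → ℝ) (k : ℕ) (x : RV n) : Wk n a ρ k x x = 1 := by simp [Wk, wk_zero]
lemma Wk_rpow (n : ℕ) (a ρ : Fin n → ℝ) (τ : ℝ) (hτ : 0 ≤ τ) (k : ℕ) (x y : RV n) :
    (Wk n a ρ k x y) ^ τ = Wk n a (fun l => τ * ρ l) k x y := by
  unfold Wk; rw [← ENNReal.prod_rpow_of_nonneg hτ]; simp_rw [wk_rpow _ _ _ hτ]
lemma Wk_anti (n : ℕ) (a ρ σ : Fin n → ℝ) (h : ∀ l, ρ l ≤ σ l) (k : ℕ) (x y : RV n) : Wk n a σ k x y ≤ Wk n a ρ k x y :=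
  Finset.prod_le_prod' fun _ _ => wk_anti _ _ _ (h _) _ _
lemma Wk_tri (n : ℕ) (a ρ : Fin n → ℝ) (ha : ∀ l, 0 ≤ a l) (hρ : ∀ l, 0 ≤ ρ l) (j m : ℕ) (x y z : RV n) :
    Wk n a ρ j x y * Wk n a ρ (j + m) y z ≤ Wk n a ρ j x z := by
  unfold Wk; rw [← Finset.prod_mul_distrib]
  exact Finset.prod_le_prod' fun _ _ => wk_tri _ _ (ha _) (hρ _) _ _ _ _ _
lemma Kp_shift (n : ℕ) (a ρ : Fin n → ℝ) (ha : ∀ l, 0 ≤ a l) (hρ : ∀ l, 0 ≤ ρ l) (j m : ℕ) (x y z : RV n) :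
    Wk n a ρ j x y * Kp n a ρ (j + m) y z ≤ p2 (m * ∑ l, a l) * Kp n a ρ j x z := by
  unfold Wk Kp; rw [← Finset.prod_mul_distrib, ← p2_sum, ← Finset.prod_mul_distrib]
  exact Finset.prod_le_prod' fun _ _ => kap_shift _ _ (ha _) (hρ _) _ _ _ _ _
lemma Kp_anti (n : ℕ) (a ρ σ : Fin n → ℝ) (h : ∀ l, ρ l ≤ σ l) (k : ℕ) (x y : RV n) : Kp n a σ k x y ≤ Kp n a ρ k x y := by
  rw [Kp_eq, Kp_eq]; exact mul_le_mul' le_rfl (Wk_anti n a ρ σ h k x y)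
lemma Kp_ne_top (n : ℕ) (a ρ : Fin n → ℝ) (k : ℕ) (x y : RV n) : Kp n a ρ k x y ≠ ∞ := by
  rw [Kp_eq]; exact ENNReal.mul_ne_top (p2_ne_top _) (Wk_ne_top _ _ _ _ _ _)
lemma Kp_meas (n : ℕ) (a ρ : Fin n → ℝ) (k : ℕ) (x : RV n) : Measurable (Kp n a ρ k x) := by
  unfold Kp
  exact Finset.measurable_prod _ fun l _ => (kap_meas _ _ k).comp (by fun_prop)

/-- the sum `S` -/
def SS (n : ℕ) (a : Fin n → ℝ) (L : ℝ) (ρ : Fin n → ℝ) (v : ℕ → RV n → ℝ≥0∞) (j : ℕ) (x : RV n) : ℝ≥0∞ :=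
  ∑' m : ℕ, p2 (-(m:ℝ) * L) * ∫⁻ z, Kp n a ρ j x z * v (j + m) z

lemma SS_mono (n : ℕ) (a : Fin n → ℝ) (L L' : ℝ) (hL : L ≤ L') (ρ ρ' : Fin n → ℝ) (hρ : ∀ l, ρ l ≤ ρ' l)
    (v : ℕ → RV n → ℝ≥0∞) (j : ℕ) (x : RV n) : SS n a L' ρ' v j x ≤ SS n a L ρ v j x := by
  unfold SS
  refine ENNReal.tsum_le_tsum fun m => mul_le_mul' (p2_mono ?_) (lintegral_mono fun z => mul_le_mul' (Kp_anti n a ρ ρ' hρ j x z) le_rfl)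
  have : (0:ℝ) ≤ m := by positivity
  nlinarith

lemma SS_shift (n : ℕ) (a : Fin n → ℝ) (ha : ∀ l, 0 ≤ a l) (L : ℝ) (ρ : Fin n → ℝ) (hρ : ∀ l, 0 ≤ ρ l)
    (v : ℕ → RV n → ℝ≥0∞) (j m : ℕ) (x y : RV n) :
    p2 (-(m:ℝ) * L) * Wk n a ρ j x y * SS n a L ρ v (j + m) y ≤ SS n a (L - ∑ l, a l) ρ v j x := by
  have hA : 0 ≤ ∑ l, a l := Finset.sum_nonneg fun l _ => ha l
  unfold SS
  rw [← ENNReal.tsum_mul_left]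
  refine le_trans ?_ (ENNReal.tsum_comp_le_tsum_of_injective (f := fun k : ℕ => m + k) (add_right_injective m) _)
  refine ENNReal.tsum_le_tsum fun k => ?_
  calc _ = p2 (-(m:ℝ) * L) * p2 (-(k:ℝ) * L) * (Wk n a ρ j x y * ∫⁻ z, Kp n a ρ (j + m) y z * v (j + m + k) z) := by ring
    _ = p2 (-(m:ℝ) * L) * p2 (-(k:ℝ) * L) * ∫⁻ z, Wk n a ρ j x y * (Kp n a ρ (j + m) y z * v (j + m + k) z) := by
        rw [lintegral_const_mul' _ _ (Wk_ne_top _ _ _ _ _ _)]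
    _ ≤ p2 (-(m:ℝ) * L) * p2 (-(k:ℝ) * L) * ∫⁻ z, p2 (m * ∑ l, a l) * (Kp n a ρ j x z * v (j + m + k) z) := by
        refine mul_le_mul' le_rfl (lintegral_mono fun z => ?_)
        rw [← mul_assoc, ← mul_assoc]
        exact mul_le_mul' (Kp_shift n a ρ ha hρ j m x y z) le_rfl
    _ = p2 (-(m:ℝ) * L) * p2 (-(k:ℝ) * L) * p2 (m * ∑ l, a l) * ∫⁻ z, Kp n a ρ j x z * v (j + (m + k)) z := by
        rw [lintegral_const_mul' _ _ (p2_ne_top _), ← mul_assoc, add_assoc]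
    _ ≤ _ := by
        refine mul_le_mul' ?_ le_rfl
        rw [← p2_add, ← p2_add]
        refine p2_mono ?_
        push_cast
        have : (0:ℝ) ≤ k * ∑ l, a l := by positivity
        nlinarith


def MM (n : ℕ) (a : Fin n → ℝ) (L : ℝ) (ρ : Fin n → ℝ) (u : ℕ → RV n → ℝ≥0∞) (j : ℕ) (x : RV n) : ℝ≥0∞ :=
  ⨆ m : ℕ, ⨆ y : RV n, p2 (-(m:ℝ) * L) * u (j + m) y * Wk n a ρ j x y

lemma le_MM (n : ℕ) (a : Fin n → ℝ) (L : ℝ) (ρ : Fin n → ℝ) (u : ℕ → RV n → ℝ≥0∞) (j m : ℕ) (x y : RV n) :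
    p2 (-(m:ℝ) * L) * u (j + m) y * Wk n a ρ j x y ≤ MM n a L ρ u j x :=
  le_iSup_of_le m (le_iSup_of_le y le_rfl)

lemma le_MM0 (n : ℕ) (a : Fin n → ℝ) (L : ℝ) (ρ : Fin n → ℝ) (u : ℕ → RV n → ℝ≥0∞) (j : ℕ) (x y : RV n) :
    u j y * Wk n a ρ j x y ≤ MM n a L ρ u j x := by
  simpa [p2_zero] using le_MM n a L ρ u j 0 x y

lemma SS_interp (n : ℕ) (a : Fin n → ℝ) (L : ℝ) (ρ : Fin n → ℝ) (u : ℕ → RV n → ℝ≥0∞) (j : ℕ) (x : RV n)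
    (τ : ℝ) (h0 : 0 < τ) (h1 : τ ≤ 1) (hM : MM n a L ρ u j x ≠ ∞) :
    SS n a (L - ∑ l, a l) ρ u j x ≤ (MM n a L ρ u j x) ^ (1 - τ) *
      SS n a (L * τ - ∑ l, a l) (fun l => τ * ρ l) (fun k z => u k z ^ τ) j x := by
  set A := ∑ l, a l
  have hMt : (MM n a L ρ u j x) ^ (1 - τ) ≠ ∞ := ENNReal.rpow_ne_top_of_nonneg (by linarith) hM
  unfold SS
  rw [← ENNReal.tsum_mul_left]
  refine ENNReal.tsum_le_tsum fun m => ?_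
  rw [← mul_assoc, ← lintegral_const_mul' _ _ (p2_ne_top _), ← lintegral_const_mul' _ _ (ENNReal.mul_ne_top hMt (p2_ne_top _))]
  refine lintegral_mono fun z => ?_
  set t := p2 (-(m:ℝ) * L) * u (j + m) z * Wk n a ρ j x z with ht
  have htM : t ≤ MM n a L ρ u j x := le_MM n a L ρ u j m x z
  have e1 : t ≤ MM n a L ρ u j x ^ (1 - τ) * t ^ τ := by
    calc t = t ^ ((1 - τ) + τ) := by simp
      _ = t ^ (1 - τ) * t ^ τ := ENNReal.rpow_add_of_nonneg _ _ (by linarith) h0.le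
      _ ≤ _ := mul_le_mul' (ENNReal.rpow_le_rpow htM (by linarith)) le_rfl
  rw [Kp_eq, Kp_eq]
  have e2 : t ^ τ = p2 (-(m:ℝ) * L * τ) * u (j + m) z ^ τ * Wk n a (fun l => τ * ρ l) j x z := by
    rw [ht, ENNReal.mul_rpow_of_nonneg _ _ h0.le, ENNReal.mul_rpow_of_nonneg _ _ h0.le, p2_rpow _ _ h0.le, Wk_rpow _ _ _ _ h0.le]
  have e3 : p2 (-(m:ℝ) * (L - A)) = p2 (m * A) * p2 (-(m:ℝ) * L) := by rw [← p2_add]; congr 1; ring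
  have e4 : p2 (-(m:ℝ) * (L * τ - A)) = p2 (m * A) * p2 (-(m:ℝ) * L * τ) := by rw [← p2_add]; congr 1; ring
  rw [e3, e4]
  calc _ = p2 (m * A) * p2 (j * A) * t := by rw [ht]; ring
    _ ≤ p2 (m * A) * p2 (j * A) * (MM n a L ρ u j x ^ (1 - τ) * t ^ τ) := mul_le_mul' le_rfl e1
    _ = _ := by rw [e2]; ring

lemma MM_le (n : ℕ) (a : Fin n → ℝ) (ha : ∀ l, 0 ≤ a l) (L : ℝ) (ρ : Fin n → ℝ) (hρ : ∀ l, 0 ≤ ρ l) (u v : ℕ → RV n → ℝ≥0∞) (C : ℝ≥0∞)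
    (hu : ∀ j y, u j y ≤ C * SS n a L ρ v j y) (j : ℕ) (x : RV n) :
    MM n a L ρ u j x ≤ C * SS n a (L - ∑ l, a l) ρ v j x := by
  refine iSup_le fun m => iSup_le fun y => ?_
  calc _ ≤ p2 (-(m:ℝ) * L) * (C * SS n a L ρ v (j + m) y) * Wk n a ρ j x y := by gcongr; exact hu _ _
    _ = C * (p2 (-(m:ℝ) * L) * Wk n a ρ j x y * SS n a L ρ v (j + m) y) := by ring
    _ ≤ _ := mul_le_mul' le_rfl (SS_shift n a ha L ρ hρ v j m x y)

lemma MM_rpow (n : ℕ) (a : Fin n → ℝ) (L : ℝ) (ρ : Fin n → ℝ) (u : ℕ → RV n → ℝ≥0∞) (j : ℕ) (x : RV n)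
    (τ : ℝ) (h0 : 0 < τ) :
    MM n a L ρ u j x ^ τ ≤ MM n a (L * τ) (fun l => τ * ρ l) (fun k z => u k z ^ τ) j x := by
  rw [← ENNReal.le_rpow_inv_iff h0]
  refine iSup_le fun m => iSup_le fun y => ?_
  rw [ENNReal.le_rpow_inv_iff h0, ENNReal.mul_rpow_of_nonneg _ _ h0.le, ENNReal.mul_rpow_of_nonneg _ _ h0.le, p2_rpow _ _ h0.le, Wk_rpow _ _ _ _ h0.le,
    show -(m:ℝ) * L * τ = -(m:ℝ) * (L * τ) by ring]
  exact le_MM n a (L * τ) (fun l => τ * ρ l) (fun k z => u k z ^ τ) j m x y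

lemma MM_bound (n : ℕ) (a : Fin n → ℝ) (ha : ∀ l, 0 ≤ a l) (L : ℝ) (ρ : Fin n → ℝ) (hρ : ∀ l, 0 ≤ ρ l) (u : ℕ → RV n → ℝ≥0∞) (C : ℝ≥0∞)
    (hu : ∀ j y, u j y ≤ C * SS n a L ρ u j y) (j : ℕ) (x : RV n)
    (τ : ℝ) (h0 : 0 < τ) (h1 : τ ≤ 1) (hM : MM n a L ρ u j x ≠ ∞) :
    MM n a L ρ u j x ^ τ ≤ C * SS n a (L * τ - ∑ l, a l) (fun l => τ * ρ l) (fun k z => u k z ^ τ) j x := by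
  have k1 := MM_le n a ha L ρ hρ u u C hu j x
  have k2 := SS_interp n a L ρ u j x τ h0 h1 hM
  set M := MM n a L ρ u j x
  set S := SS n a (L * τ - ∑ l, a l) (fun l => τ * ρ l) (fun k z => u k z ^ τ) j x
  rcases eq_or_ne M 0 with hz | hz
  · rw [hz, ENNReal.zero_rpow_of_pos h0]; exact zero_le
  have k3 : M ≤ M ^ (1 - τ) * (C * S) := by
    refine k1.trans ((mul_le_mul' le_rfl k2).trans (le_of_eq ?_)); ring
  have k4 : M ^ τ = M ^ (τ - 1) * M := by
    conv_rhs => rw [← ENNReal.rpow_one M]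
    rw [← ENNReal.rpow_mul, ← ENNReal.rpow_add _ _ hz hM]; congr 1; ring
  rw [k4]
  refine (mul_le_mul' le_rfl k3).trans (le_of_eq ?_)
  rw [← mul_assoc, ← ENNReal.rpow_add _ _ hz hM]; simp

lemma MM_fin (n : ℕ) (a : Fin n → ℝ) (ha : ∀ l, 0 ≤ a l) (u : ℕ → RV n → ℝ≥0∞) (Cf : ℝ≥0∞) (hCf : Cf ≠ ∞) (A : ℝ) (hA : 0 ≤ A)
    (hg : ∀ k y, u k y * Wk n a (fun _ => A) 0 0 y ≤ Cf * p2 (k * A)) (L : ℝ) (hL : A ≤ L) (ρ : Fin n → ℝ) (hρ : ∀ l, A ≤ ρ l) (j : ℕ) (x : RV n) :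
    MM n a L ρ u j x ≠ ∞ := by
  have hb : MM n a L ρ u j x ≤ Cf * p2 (j * A) * (Wk n a (fun _ => A) 0 0 x)⁻¹ := by
    refine iSup_le fun m => iSup_le fun y => ?_
    rw [← div_eq_mul_inv, ENNReal.le_div_iff_mul_le (Or.inl (Wk_pos _ _ _ _ _ _)) (Or.inl (Wk_ne_top _ _ _ _ _ _))]
    have t1 : Wk n a ρ j x y ≤ Wk n a (fun _ => A) 0 x y := by
      refine (Wk_anti n a (fun _ => A) ρ hρ j x y).trans ?_
      have := Wk_tri n a (fun _ => A) ha (fun _ => hA) 0 j x x y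
      rwa [Wk_self, one_mul, zero_add] at this
    have t2 := Wk_tri n a (fun _ => A) ha (fun _ => hA) 0 0 0 x y
    rw [add_zero] at t2
    calc _ ≤ p2 (-(m:ℝ) * L) * u (j + m) y * Wk n a (fun _ => A) 0 x y * Wk n a (fun _ => A) 0 0 x := by gcongr
      _ = p2 (-(m:ℝ) * L) * (u (j + m) y * (Wk n a (fun _ => A) 0 0 x * Wk n a (fun _ => A) 0 x y)) := by ring
      _ ≤ p2 (-(m:ℝ) * L) * (Cf * p2 ((j + m : ℕ) * A)) := by
          refine mul_le_mul' le_rfl ((mul_le_mul' le_rfl t2).trans (hg _ _))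
      _ = Cf * (p2 (-(m:ℝ) * L) * p2 ((j + m : ℕ) * A)) := by ring
      _ ≤ _ := by
          refine mul_le_mul' le_rfl ?_
          rw [← p2_add]; refine p2_mono ?_
          push_cast
          have : (m:ℝ) * A ≤ m * L := by gcongr
          linarith
  refine ne_top_of_le_ne_top ?_ hb
  exact ENNReal.mul_ne_top (ENNReal.mul_ne_top hCf (p2_ne_top _)) (ENNReal.inv_ne_top.2 (Wk_pos _ _ _ _ _ _))

lemma jensen_w {α : Type*} [MeasurableSpace α] (μ : Measure α) (w g : α → ℝ≥0∞) (hw : Measurable w) (hg : Measurable g)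
    (τ : ℝ) (hτ : 1 ≤ τ) :
    (∫⁻ x, w x * g x ∂μ) ^ τ ≤ (∫⁻ x, w x ∂μ) ^ (τ - 1) * ∫⁻ x, w x * g x ^ τ ∂μ := by
  rcases hτ.eq_or_lt with rfl | hP
  · simp
  have hc : τ.HolderConjugate (τ / (τ - 1)) := Real.HolderConjugate.conjExponent hP
  have := ENNReal.lintegral_mul_le_Lp_mul_Lq (μ.withDensity w) hc hg.aemeasurable (aemeasurable_const (b := (1:ℝ≥0∞)))
  rw [lintegral_withDensity_eq_lintegral_mul _ hw (hg.mul measurable_const), lintegral_withDensity_eq_lintegral_mul _ hw (hg.pow_const _),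
    lintegral_withDensity_eq_lintegral_mul _ hw (by fun_prop)] at this
  simp only [Pi.mul_apply, mul_one, ENNReal.one_rpow] at this
  have h2 := ENNReal.rpow_le_rpow this (by linarith : 0 ≤ τ)
  refine h2.trans (le_of_eq ?_)
  rw [ENNReal.mul_rpow_of_nonneg _ _ (by linarith), ← ENNReal.rpow_mul, ← ENNReal.rpow_mul, mul_comm]
  congr 1
  · congr 1; field_simp
  · rw [one_div, inv_mul_cancel₀ (by linarith), ENNReal.rpow_one]


lemma kap_int (a ρ : ℝ) (ha : 0 ≤ a) (hρ : 1 < ρ) : ∃ C : ℝ≥0∞, C ≠ ∞ ∧ ∀ k t, ∫⁻ s, kap a ρ k (t - s) ≤ C := by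
  refine ⟨(∑' m : ℕ, ENNReal.ofReal (32 * 2 ^ ρ * 2 ^ (-(m:ℝ) * (ρ - 1)))) * 2, ENNReal.mul_ne_top (geo_fin _ _ (by linarith)) (by simp), fun k t => ?_⟩
  have := kap_avg a ρ ha hρ k (fun _ => 1) measurable_const t
  simp only [mul_one] at this
  refine this.trans ?_
  rw [← ENNReal.tsum_mul_right]
  refine ENNReal.tsum_le_tsum fun m => mul_le_mul' le_rfl ?_
  have h1 : ∀ (G : GridS) (L : ℕ), G.avg L (fun _ => 1) t ≤ 1 := by
    intro G L
    unfold GridS.avg GridS.avgI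
    rw [lintegral_const, one_mul, Measure.restrict_apply MeasurableSet.univ, Set.univ_inter]
    exact ENNReal.inv_mul_le_one _
  refine (add_le_add (h1 _ _) (h1 _ _)).trans (by norm_num)

lemma Kp_int (n : ℕ) (a ρ : Fin n → ℝ) (ha : ∀ l, 0 ≤ a l) (hρ : ∀ l, 1 < ρ l) :
    ∃ C : ℝ≥0∞, C ≠ ∞ ∧ ∀ k x, ∫⁻ z, Kp n a ρ k x z ≤ C := by
  classical
  choose c hc hc2 using fun l => kap_int (a l) (ρ l) (ha l) (hρ l)
  have key : ∀ S : Finset (Fin n), ∀ k x, KS n a ρ S (fun _ _ => 1) k x ≤ ∏ l ∈ S, c l := by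
    intro S
    induction S using Finset.induction_on with
    | empty => intro k x; simp [KS]
    | insert i S hi ih =>
      intro k x
      rw [KS_insert n a ρ S i hi _ (fun k => measurable_const), Finset.prod_insert hi]
      unfold Kco
      calc _ ≤ ∫⁻ s, kap (a i) (ρ i) k (x i - s) * ∏ l ∈ S, c l := lintegral_mono fun s => mul_le_mul' le_rfl (ih _ _)
        _ = (∫⁻ s, kap (a i) (ρ i) k (x i - s)) * ∏ l ∈ S, c l := lintegral_mul_const' _ _ (ENNReal.prod_ne_top fun l _ => hc l)
        _ ≤ _ := mul_le_mul' (hc2 _ _ _) le_rfl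
  refine ⟨∏ l, c l, ENNReal.prod_ne_top fun l _ => hc l, fun k x => ?_⟩
  have := key Finset.univ k x
  rw [Kall_eq] at this
  simpa only [Kall, Kp, mul_one] using this

lemma peetre_bound (n : ℕ) (a : Fin n → ℝ) (ha : ∀ l, 0 ≤ a l) (U : Set (ℕ → RV n → ℝ≥0∞))
    (H1 : ∀ R L : ℝ, 0 ≤ R → ∃ C : ℝ≥0∞, C ≠ ∞ ∧ ∀ u ∈ U, ∀ j y, u j y ≤ C * SS n a L (fun _ => R) u j y)
    (Hg : ∀ u ∈ U, ∃ Cf : ℝ≥0∞, Cf ≠ ∞ ∧ ∃ A : ℝ, 0 ≤ A ∧ ∀ k y, u k y * Wk n a (fun _ => A) 0 0 y ≤ Cf * p2 (k * A))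
    (Hm : ∀ u ∈ U, ∀ k, Measurable (u k))
    (τ : ℝ) (hτ : 0 < τ) (r : Fin n → ℝ) (hr : ∀ l, 0 ≤ r l) (L : ℝ) :
    ∃ C : ℝ≥0∞, C ≠ ∞ ∧ ∀ u ∈ U, ∀ j x y, (u j y * Wk n a r j x y) ^ τ ≤
      C * SS n a L (fun l => τ * r l) (fun k z => u k z ^ τ) j x := by
  have H1v : ∀ (ρ : Fin n → ℝ) (L : ℝ), (∀ l, 0 ≤ ρ l) → ∃ C : ℝ≥0∞, C ≠ ∞ ∧ ∀ u ∈ U, ∀ j y, u j y ≤ C * SS n a L ρ u j y := by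
    intro ρ L hρ
    obtain ⟨C, hC, h⟩ := H1 (∑ l, ρ l) L (Finset.sum_nonneg fun l _ => hρ l)
    refine ⟨C, hC, fun u hu j y => (h u hu j y).trans (mul_le_mul' le_rfl (SS_mono n a _ _ le_rfl _ _ ?_ u j y))⟩
    intro l
    exact Finset.single_le_sum (f := ρ) (fun l _ => hρ l) (Finset.mem_univ l)
  set A := ∑ l, a l with hA
  have hA0 : 0 ≤ A := Finset.sum_nonneg fun l _ => ha l
  rcases le_total τ 1 with h1 | h1
  · set L0 := (L + A) / τ with hL0
    have hL0' : L0 * τ - A = L := by rw [hL0]; field_simp; ring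
    obtain ⟨C, hC, h⟩ := H1v r L0 hr
    refine ⟨C + 1, by finiteness, fun u hu j x y => ?_⟩
    by_cases hS : SS n a L (fun l => τ * r l) (fun k z => u k z ^ τ) j x = ∞
    · rw [hS, ENNReal.mul_top (by simp)]; exact le_top
    have hM : MM n a L0 r u j x ≠ ∞ := by
      obtain ⟨Cf, hCf, A', hA', hg⟩ := Hg u hu
      set L' := max A' ((L0 * τ + A) / τ) with hL'
      set ρ' : Fin n → ℝ := fun l => max A' (r l) with hρ'
      have hρ0 : ∀ l, 0 ≤ ρ' l := fun l => le_max_of_le_left hA'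
      obtain ⟨C', hC', h'⟩ := H1v ρ' L' hρ0
      have s1 : ∀ j y, u j y ^ τ ≤ C' * SS n a (L0 * τ) (fun l => τ * r l) (fun k z => u k z ^ τ) j y := by
        intro j y
        have b1 := MM_bound n a ha L' ρ' hρ0 u C' (h' u hu) j y τ hτ h1
          (MM_fin n a ha u Cf hCf A' hA' hg L' (le_max_left _ _) ρ' (fun l => le_max_left _ _) j y)
        have b2 := le_MM0 n a L' ρ' u j y y
        rw [Wk_self, mul_one] at b2
        refine (ENNReal.rpow_le_rpow b2 hτ.le).trans (b1.trans (mul_le_mul' le_rfl (SS_mono n a _ _ ?_ _ _ ?_ _ j y)))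
        · have : (L0 * τ + A) / τ * τ ≤ L' * τ := by gcongr; exact le_max_right _ _
          rw [div_mul_cancel₀ _ hτ.ne'] at this
          linarith
        · intro l; have : r l ≤ ρ' l := le_max_right _ _
          gcongr
      have s2 := MM_le n a ha (L0 * τ) (fun l => τ * r l) (fun l => mul_nonneg hτ.le (hr l)) (fun k z => u k z ^ τ) _ C' s1 j x
      rw [← hA, hL0'] at s2
      have s3 := (MM_rpow n a L0 r u j x τ hτ).trans s2
      intro hT
      rw [hT, ENNReal.top_rpow_of_pos hτ, top_le_iff] at s3
      exact ENNReal.mul_ne_top hC' hS s3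
    have b1 := MM_bound n a ha L0 r hr u C (h u hu) j x τ hτ h1 hM
    rw [← hA, hL0'] at b1
    refine (ENNReal.rpow_le_rpow (le_MM0 n a L0 r u j x y) hτ.le).trans (b1.trans (mul_le_mul' (by simp) le_rfl))
  · set L1 := max L 1 with hL1
    obtain ⟨C, hC, h⟩ := H1v (fun l => r l + 2) L1 (fun l => by linarith [hr l])
    obtain ⟨I, hI, hI2⟩ := Kp_int n a (fun _ => 2) ha (fun _ => by norm_num)
    have hG : ∑' m : ℕ, p2 (-(m:ℝ) * L1) ≠ ∞ := by
      have := geo_fin 1 L1 (lt_of_lt_of_le one_pos (le_max_right _ _))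
      simpa only [one_mul, p2] using this
    refine ⟨C ^ τ * ((∑' m : ℕ, p2 (-(m:ℝ) * L1)) ^ (τ - 1) * I ^ (τ - 1)), ?_, fun u hu j x y => ?_⟩
    · have := sub_nonneg.2 h1
      exact ENNReal.mul_ne_top (ENNReal.rpow_ne_top_of_nonneg hτ.le hC) (ENNReal.mul_ne_top (ENNReal.rpow_ne_top_of_nonneg this hG) (ENNReal.rpow_ne_top_of_nonneg this hI))
    have hu' := Hm u hu
    have hWm : Measurable (Wk n a r j x) := by
      unfold Wk wk; fun_prop
    have k1 : u j y * Wk n a r j x y ≤ C * ∑' m : ℕ, p2 (-(m:ℝ) * L1) * ∫⁻ z, Kp n a (fun _ => 2) j y z * (Wk n a r j x z * u (j + m) z) := by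
      refine (mul_le_mul' (h u hu j y) le_rfl).trans ?_
      rw [mul_assoc]
      refine mul_le_mul' le_rfl ?_
      unfold SS
      rw [← ENNReal.tsum_mul_right]
      refine ENNReal.tsum_le_tsum fun m => ?_
      rw [mul_assoc]
      refine mul_le_mul' le_rfl ?_
      rw [← lintegral_mul_const' _ _ (Wk_ne_top _ _ _ _ _ _)]
      refine lintegral_mono fun z => ?_
      have e : Kp n a (fun l => r l + 2) j y z = Kp n a (fun _ => 2) j y z * Wk n a r j y z := by
        rw [Kp_eq, Kp_eq, mul_assoc]; congr 1
        unfold Wk; rw [← Finset.prod_mul_distrib]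
        refine Finset.prod_congr rfl fun l _ => ?_
        rw [wk_add, mul_comm]
      have t2 := Wk_tri n a r ha hr j 0 x y z
      rw [add_zero] at t2
      calc _ = Kp n a (fun _ => 2) j y z * ((Wk n a r j x y * Wk n a r j y z) * u (j + m) z) := by rw [e]; ring
        _ ≤ _ := by gcongr
    refine (ENNReal.rpow_le_rpow k1 hτ.le).trans ?_
    rw [ENNReal.mul_rpow_of_nonneg _ _ hτ.le, mul_assoc]
    refine mul_le_mul' le_rfl ?_
    have j1 := jensen_w (Measure.count : Measure ℕ) (fun m => p2 (-(m:ℝ) * L1))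
      (fun m => ∫⁻ z, Kp n a (fun _ => 2) j y z * (Wk n a r j x z * u (j + m) z)) measurable_from_nat measurable_from_nat τ h1
    rw [lintegral_count, lintegral_count, lintegral_count] at j1
    refine j1.trans ?_
    rw [mul_assoc]
    refine mul_le_mul' le_rfl ?_
    unfold SS
    rw [← ENNReal.tsum_mul_left]
    refine ENNReal.tsum_le_tsum fun m => ?_
    rw [mul_left_comm]
    refine mul_le_mul' (p2_mono ?_) ?_
    · have : (m:ℝ) * L ≤ m * L1 := by gcongr; exact le_max_left _ _
      linarith
    refine (jensen_w volume _ _ (Kp_meas n a (fun _ => 2) j y) (hWm.mul (hu' (j + m))) τ h1).trans ?_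
    refine mul_le_mul' (ENNReal.rpow_le_rpow (hI2 j y) (by linarith)) (lintegral_mono fun z => ?_)
    simp only [Pi.mul_apply]
    rw [ENNReal.mul_rpow_of_nonneg _ _ hτ.le, Wk_rpow _ _ _ _ hτ.le, ← mul_assoc, Kp_eq, Kp_eq]
    refine mul_le_mul' ?_ le_rfl
    refine mul_le_mul' ?_ le_rfl
    exact (mul_le_mul' le_rfl (Wk_le_one n a (fun _ => 2) (fun _ => by norm_num) j y z)).trans (by simp)


lemma mixAux_pow (n : ℕ) (p : Fin n → ℝ≥0∞) (hp : ∀ i, 0 < p i ∧ p i ≠ ∞) (τ : ℝ) (hτ : 0 < τ) (l : ℕ) (F : RV n → ℝ≥0∞) (x : RV n) :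
    mixAux n p l F x ^ τ = mixAux n (fun i => p i / ENNReal.ofReal τ) l (fun x => F x ^ τ) x := by
  induction l generalizing x with
  | zero => rfl
  | succ l ih =>
    simp only [mixAux]
    split_ifs with h h1 h2 h3
    · exact absurd h1 (hp _).2
    · exact absurd h1 (hp _).2
    · exfalso
      exact ENNReal.div_ne_top (hp _).2 (by simpa using hτ) h3
    · have hP : 0 < (p ⟨l, h⟩).toReal := ENNReal.toReal_pos (hp _).1.ne' (hp _).2
      rw [ENNReal.toReal_div, ENNReal.toReal_ofReal hτ.le, ← ENNReal.rpow_mul]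
      congr 1
      · refine lintegral_congr fun t => ?_
        rw [← ih, ← ENNReal.rpow_mul]; congr 1; field_simp
      · field_simp
    · exact ih x

lemma lq_pow (q : ℝ≥0∞) (hq : 0 < q) (τ : ℝ) (hτ : 0 < τ) (u : ℕ → ℝ≥0∞) :
    lq q u ^ τ = lq (q / ENNReal.ofReal τ) (fun k => u k ^ τ) := by
  unfold lq
  by_cases h : q = ∞
  · have : (∞ : ℝ≥0∞) / ENNReal.ofReal τ = ∞ := ENNReal.top_div_of_ne_top (by simp)
    rw [h, this]; simp only [if_true]
    exact rpow_iSup' hτ u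
  · have h2 : q / ENNReal.ofReal τ ≠ ∞ := ENNReal.div_ne_top h (by simpa using hτ)
    have hP : 0 < q.toReal := ENNReal.toReal_pos hq.ne' h
    rw [if_neg h, if_neg h2, ENNReal.toReal_div, ENNReal.toReal_ofReal hτ.le, ← ENNReal.rpow_mul]
    congr 1
    · refine tsum_congr fun k => ?_
      rw [← ENNReal.rpow_mul]; congr 1; field_simp
    · field_simp

lemma lq_shift (q : ℝ≥0∞) (u : ℕ → ℝ≥0∞) (m : ℕ) : lq q (fun k => u (k + m)) ≤ lq q u := by
  unfold lq
  split_ifs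
  · exact iSup_comp_le u _
  · refine ENNReal.rpow_le_rpow ?_ (by positivity)
    exact ENNReal.tsum_comp_le_tsum_of_injective (add_left_injective m) (fun k => u k ^ q.toReal)

lemma assemble (n : ℕ) (hn : 1 ≤ n) (a : Fin n → ℝ) (ha : ∀ l, 0 ≤ a l)
    (p : Fin n → ℝ≥0∞) (hp : ∀ i, 0 < p i ∧ p i ≠ ∞) (q : ℝ≥0∞) (hq : 0 < q)
    (s : ℝ) (r : Fin n → ℝ)
    (hr : ∀ l, 1 < ENNReal.ofReal (r l) * min q (⨅ i, p i))
    (U : Set (ℕ → RV n → ℝ≥0∞))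
    (H1 : ∀ R L : ℝ, 0 ≤ R → ∃ C : ℝ≥0∞, C ≠ ∞ ∧ ∀ u ∈ U, ∀ j y, u j y ≤ C * SS n a L (fun _ => R) u j y)
    (Hg : ∀ u ∈ U, ∃ Cf : ℝ≥0∞, Cf ≠ ∞ ∧ ∃ A : ℝ, 0 ≤ A ∧ ∀ k y, u k y * Wk n a (fun _ => A) 0 0 y ≤ Cf * p2 (k * A))
    (Hm : ∀ u ∈ U, ∀ k, Measurable (u k)) :
    ∃ C : ℝ≥0∞, C ≠ ∞ ∧ ∀ u ∈ U, seqNorm n p q (fun j x => p2 (j * s) * ⨆ y, u j y * Wk n a r j x y) ≤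
      C * seqNorm n p q (fun j x => p2 (j * s) * u j x) := by
  have i0 : Fin n := ⟨0, hn⟩
  haveI : Nonempty (Fin n) := ⟨i0⟩
  have hPt : min q (⨅ i, p i) ≠ ∞ := ne_top_of_le_ne_top (hp i0).2 ((min_le_right _ _).trans (iInf_le _ i0))
  set P := (min q (⨅ i, p i)).toReal with hP
  have hPe : min q (⨅ i, p i) = ENNReal.ofReal P := (ENNReal.ofReal_toReal hPt).symm
  have hr0 : ∀ l, 0 < r l := by
    intro l
    by_contra hc
    have := hr l
    rw [ENNReal.ofReal_of_nonpos (not_lt.1 hc), zero_mul] at this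
    exact absurd this (by simp)
  have hrP : ∀ l, 1 / r l < P := by
    intro l
    have := hr l
    rw [hPe, ← ENNReal.ofReal_mul (hr0 l).le, ENNReal.one_lt_ofReal] at this
    rw [div_lt_iff₀ (hr0 l)]; linarith
  obtain ⟨l0, hl0⟩ := Finite.exists_max (fun l => 1 / r l)
  obtain ⟨τ, hτ1, hτ2⟩ := exists_between (hrP l0)
  have hτ : 0 < τ := lt_trans (one_div_pos.2 (hr0 l0)) hτ1
  have hρ : ∀ l, 1 < τ * r l := by
    intro l
    have := (hl0 l).trans_lt hτ1
    rwa [div_lt_iff₀ (hr0 l)] at this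
  set p' : Fin n → ℝ≥0∞ := fun i => p i / ENNReal.ofReal τ with hp'
  set q' : ℝ≥0∞ := q / ENNReal.ofReal τ with hq'
  have hp't : ∀ i, p' i ≠ ∞ := fun i => ENNReal.div_ne_top (hp _).2 (by simpa using hτ)
  have hp1 : ∀ i, 1 < (p' i).toReal := by
    intro i
    rw [hp', ENNReal.toReal_div, ENNReal.toReal_ofReal hτ.le, lt_div_iff₀ hτ, one_mul]
    refine hτ2.trans_le ?_
    exact ENNReal.toReal_mono (hp i).2 ((min_le_right _ _).trans (iInf_le _ i))
  have hq1 : 1 ≤ q' := by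
    rw [hq', ENNReal.le_div_iff_mul_le (Or.inl (by simpa using hτ)) (Or.inl (by simp)), one_mul]
    refine le_trans ?_ (min_le_left q (⨅ i, p i))
    rw [hPe]; exact ENNReal.ofReal_le_ofReal hτ2.le
  set N := mixLN n p' hp't (fun i => (hp1 i).le) q' hq1 n (fun _ => 0) with hN
  have hpow : ∀ v : ℕ → RV n → ℝ≥0∞, seqNorm n p q v ^ τ = N.N (fun k x => v k x ^ τ) := by
    intro v
    have e1 : seqNorm n p q v = mixAux n p n (fun x => lq q fun k => v k x) (fun _ => 0) := rfl
    rw [e1, mixAux_pow n p hp τ hτ]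
    simp_rw [lq_pow q hq τ hτ]; rfl
  obtain ⟨C, hC, hB⟩ := peetre_bound n a ha U H1 Hg Hm τ hτ r (fun l => (hr0 l).le) (1 - s * τ)
  obtain ⟨D, hD, hK⟩ := Kall_bdd n a (fun l => τ * r l) ha hρ p' hp't hp1 q' hq1
  have hG : ∑' m : ℕ, p2 (-(m:ℝ)) ≠ ∞ := by
    have := geo_fin 1 1 one_pos
    simpa only [one_mul, p2, mul_one] using this
  refine ⟨(C * ((∑' m : ℕ, p2 (-(m:ℝ))) * D)) ^ (1 / τ), ENNReal.rpow_ne_top_of_nonneg (by positivity) (ENNReal.mul_ne_top hC (ENNReal.mul_ne_top hG hD)), fun u hu => ?_⟩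
  set w : ℕ → RV n → ℝ≥0∞ := fun k x => (p2 (k * s) * u k x) ^ τ with hw
  have hwm : ∀ k, Measurable (w k) := fun k => ((Hm u hu k).const_mul _).pow_const _
  rw [← ENNReal.rpow_le_rpow_iff hτ, ENNReal.mul_rpow_of_nonneg _ _ hτ.le, ← ENNReal.rpow_mul, one_div, inv_mul_cancel₀ hτ.ne', ENNReal.rpow_one,
    hpow, hpow]
  have hKm : ∀ m : ℕ, ∀ k, Measurable (Kall n a (fun l => τ * r l) (fun k => w (k + m)) k) := fun m => (hK _ (fun k => hwm (k + m))).1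
  calc _ ≤ N.N (fun j x => ((C.toNNReal : ℝ≥0) : ℝ≥0∞) * ∑' m : ℕ, (((p2 (-(m:ℝ))).toNNReal : ℝ≥0) : ℝ≥0∞) * Kall n a (fun l => τ * r l) (fun k => w (k + m)) j x) := by
        refine N.mono _ _ fun j x => ?_
        rw [ENNReal.mul_rpow_of_nonneg _ _ hτ.le, ENNReal.coe_toNNReal hC]
        have h1 : (⨆ y, u j y * Wk n a r j x y) ^ τ ≤ C * SS n a (1 - s * τ) (fun l => τ * r l) (fun k z => u k z ^ τ) j x := by
          rw [← ENNReal.le_rpow_inv_iff hτ]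
          refine iSup_le fun y => ?_
          rw [ENNReal.le_rpow_inv_iff hτ]
          exact hB u hu j x y
        refine (mul_le_mul' le_rfl h1).trans ?_
        rw [mul_left_comm]
        refine mul_le_mul' le_rfl ?_
        unfold SS
        rw [← ENNReal.tsum_mul_left]
        refine ENNReal.tsum_le_tsum fun m => ?_
        rw [ENNReal.coe_toNNReal (p2_ne_top _), p2_rpow _ _ hτ.le, ← mul_assoc, ← p2_add]
        have e : ∀ z, w (j + m) z = p2 ((j + m : ℕ) * s * τ) * u (j + m) z ^ τ := by
          intro z; rw [hw]; simp only; rw [ENNReal.mul_rpow_of_nonneg _ _ hτ.le, p2_rpow _ _ hτ.le]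
        unfold Kall
        simp_rw [e, mul_left_comm _ (p2 _)]
        rw [lintegral_const_mul' _ _ (p2_ne_top _), ← mul_assoc, ← p2_add]
        refine mul_le_mul' (p2_mono ?_) le_rfl
        push_cast
        linarith
    _ ≤ C * N.N (fun j x => ∑' m : ℕ, (((p2 (-(m:ℝ))).toNNReal : ℝ≥0) : ℝ≥0∞) * Kall n a (fun l => τ * r l) (fun k => w (k + m)) j x) := by
        conv_rhs => rw [← ENNReal.coe_toNNReal hC]
        refine N.smul _ _ fun k => ?_
        exact Measurable.tsum fun m => (hKm m k).const_mul _
    _ ≤ C * ∑' m : ℕ, N.N (fun j x => (((p2 (-(m:ℝ))).toNNReal : ℝ≥0) : ℝ≥0∞) * Kall n a (fun l => τ * r l) (fun k => w (k + m)) j x) :=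
        mul_le_mul' le_rfl (N.tsum _ fun m k => (hKm m k).const_mul _)
    _ ≤ C * ∑' m : ℕ, p2 (-(m:ℝ)) * (D * N.N w) := by
        refine mul_le_mul' le_rfl (ENNReal.tsum_le_tsum fun m => ?_)
        refine (N.smul _ _ (hKm m)).trans ?_
        rw [ENNReal.coe_toNNReal (p2_ne_top _)]
        refine mul_le_mul' le_rfl (((hK _ (fun k => hwm (k + m))).2 _).trans (mul_le_mul' le_rfl ?_))
        exact mixAux_mono n p' n (fun x => lq_shift q' (fun k => w k x) m) hp't _
    _ = _ := by rw [ENNReal.tsum_mul_right]; ring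

/-- Euclidean model. -/
abbrev EV (n : ℕ) := EuclideanSpace ℝ (Fin n)

abbrev SE (E : Type) [NormedAddCommGroup E] [NormedSpace ℝ E] := SchwartzMap E ℂ

section GenE
set_option linter.unusedSectionVars false
variable (E : Type) [NormedAddCommGroup E] [InnerProductSpace ℝ E] [FiniteDimensional ℝ E] [MeasurableSpace E] [BorelSpace E]

/-- convolution of Schwartz functions -/
def scv (η φ : SE E) : SE E :=
  SchwartzMap.convolution (ContinuousLinearMap.mul ℂ ℂ) η φ

lemma scv_apply (η φ : SE E) (x : E) : scv E η φ x = ∫ z, η z * φ (x - z) := by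
  simp [scv, SchwartzMap.convolution_apply, MeasureTheory.convolution]

open FourierTransform LineDeriv in
lemma scv_fourier (η φ : SE E) (ξ : E) :
    𝓕 (scv E η φ) ξ = 𝓕 η ξ * 𝓕 φ ξ := by
  rw [scv, SchwartzMap.fourier_convolution]
  simp

open FourierTransform LineDeriv in
lemma four_inj (φ ψ : SE E) (h : ∀ ξ, 𝓕 φ ξ = 𝓕 ψ ξ) : φ = ψ := by
  have : 𝓕 φ = 𝓕 ψ := by ext ξ; exact h ξ
  rw [← FourierTransform.fourierInv_fourier_eq (F := SE E) φ, this, FourierTransform.fourierInv_fourier_eq (F := SE E) ψ]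

open FourierTransform LineDeriv in
lemma scv_lineDeriv (η φ : SE E) (m : E) :
    ∂_{m} (scv E η φ) = scv E η (∂_{m} φ) := by
  apply four_inj
  intro ξ
  have hg : Function.HasTemperateGrowth (fun x : E => inner ℝ x m) := by fun_prop
  rw [scv_fourier, SchwartzMap.fourier_lineDerivOp_eq, SchwartzMap.fourier_lineDerivOp_eq]
  simp only [smul_apply, SchwartzMap.smulLeftCLM_apply_apply hg, scv_fourier]
  simp only [smul_eq_mul, Complex.real_smul]
  ring

open FourierTransform LineDeriv in
lemma scv_iter (η φ : SE E) (l : ℕ) (m : Fin l → E) :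
    ∂^{m} (scv E η φ) = scv E η (∂^{m} φ) := by
  induction l with
  | zero => simp
  | succ l ih => rw [iteratedLineDerivOp_succ_left, iteratedLineDerivOp_succ_left, ih, scv_lineDeriv]

lemma scv_iterF (η φ : SE E) (l : ℕ) (m : Fin l → E) (x : E) :
    iteratedFDeriv ℝ l (scv E η φ) x m = ∫ z, η z * iteratedFDeriv ℝ l φ (x - z) m := by
  rw [← SchwartzMap.iteratedLineDerivOp_eq_iteratedFDeriv, scv_iter, scv_apply]
  simp only [SchwartzMap.iteratedLineDerivOp_eq_iteratedFDeriv]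

/-- translation -/
abbrev tsl (z : E) (φ : SE E) : SE E := SchwartzMap.compSubConstCLM ℂ z φ

lemma tsl_iterF (z : E) (φ : SE E) (l : ℕ) (x : E) :
    iteratedFDeriv ℝ l (tsl E z φ) x = iteratedFDeriv ℝ l φ (x - z) := by
  have : (⇑(tsl E z φ)) = fun x => φ (x - z) := by ext x; simp
  rw [this, iteratedFDeriv_comp_sub]

/-- combined seminorm -/
def sM (k l : ℕ) (φ : SE E) : ℝ :=
  2 ^ k * (Finset.Iic (k, l)).sup (fun m => SchwartzMap.seminorm ℝ m.1 m.2) φ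

lemma sM_nonneg (k l : ℕ) (φ : SE E) : 0 ≤ sM E k l φ := by
  unfold sM; positivity

lemma sM_bound (k l : ℕ) (φ : SE E) (x : E) :
    (1 + ‖x‖) ^ k * ‖iteratedFDeriv ℝ l φ x‖ ≤ sM E k l φ :=
  SchwartzMap.one_add_le_sup_seminorm_apply (𝕜 := ℝ) (m := (k, l)) le_rfl le_rfl φ x

lemma norm_tri (x z : E) (k : ℕ) : ‖x‖ ^ k ≤ (1 + ‖x - z‖) ^ k * (1 + ‖z‖) ^ k := by
  rw [← mul_pow]
  refine pow_le_pow_left₀ (norm_nonneg _) ?_ k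
  have h1 : ‖x‖ ≤ ‖x - z‖ + ‖z‖ := by simpa using norm_add_le (x - z) z
  nlinarith [norm_nonneg (x - z), norm_nonneg z, mul_nonneg (norm_nonneg (x - z)) (norm_nonneg z)]

lemma tsl_growth (k l : ℕ) (φ : SE E) (z x : E) :
    ‖x‖ ^ k * ‖iteratedFDeriv ℝ l (tsl E z φ) x‖ ≤ sM E k l φ * (1 + ‖z‖) ^ k := by
  rw [tsl_iterF]
  calc ‖x‖ ^ k * ‖iteratedFDeriv ℝ l φ (x - z)‖
      ≤ ((1 + ‖x - z‖) ^ k * (1 + ‖z‖) ^ k) * ‖iteratedFDeriv ℝ l φ (x - z)‖ := by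
        gcongr; exact norm_tri E x z k
    _ = ((1 + ‖x - z‖) ^ k * ‖iteratedFDeriv ℝ l φ (x - z)‖) * (1 + ‖z‖) ^ k := by ring
    _ ≤ _ := by gcongr; exact sM_bound E k l φ _

/-- continuity estimate -/
lemma tsl_lip (k l : ℕ) (φ : SE E) (R : ℝ) (z w x : E) (hz : ‖z‖ ≤ R) (hw : ‖w‖ ≤ R) :
    ‖x‖ ^ k * ‖iteratedFDeriv ℝ l φ (x - z) - iteratedFDeriv ℝ l φ (x - w)‖
      ≤ sM E k (l + 1) φ * (1 + R) ^ k * ‖z - w‖ := by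
  have hR : 0 ≤ R := (norm_nonneg _).trans hz
  rcases eq_or_lt_of_le (pow_nonneg (norm_nonneg x) k) with h0 | h0
  · rw [← h0]; simp only [zero_mul]
    have := sM_nonneg E k (l + 1) φ
    positivity
  have hd : ∀ y : E, DifferentiableAt ℝ (iteratedFDeriv ℝ l φ) y := by
    intro y
    have := (φ.smooth ⊤).differentiable_iteratedFDeriv (m := l) (by exact_mod_cast WithTop.coe_lt_top _)
    exact this y
  have hb : ∀ ζ ∈ Metric.closedBall (0 : E) R,
      ‖fderiv ℝ (fun ζ => iteratedFDeriv ℝ l φ (x - ζ)) ζ‖ ≤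
        sM E k (l + 1) φ * (1 + R) ^ k / ‖x‖ ^ k := by
    intro ζ hζ
    rw [mem_closedBall_zero_iff] at hζ
    have he : ‖fderiv ℝ (fun ζ => iteratedFDeriv ℝ l φ (x - ζ)) ζ‖ ≤
        ‖fderiv ℝ (iteratedFDeriv ℝ l φ) (x - ζ)‖ := by
      have h1 : HasFDerivAt (fun ζ : E => x - ζ) (-ContinuousLinearMap.id ℝ (E)) ζ := by
        simpa using (hasFDerivAt_id ζ).const_sub x
      have h2 := ((hd (x - ζ)).hasFDerivAt.comp ζ h1).fderiv
      rw [Function.comp_def] at h2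
      rw [h2]
      refine (ContinuousLinearMap.opNorm_comp_le _ _).trans ?_
      refine mul_le_of_le_one_right (norm_nonneg _) ?_
      refine ContinuousLinearMap.opNorm_le_bound _ zero_le_one fun v => ?_
      simp
    refine he.trans ?_
    rw [norm_fderiv_iteratedFDeriv, le_div_iff₀ h0]
    have := tsl_growth E k (l + 1) φ ζ x
    rw [tsl_iterF] at this
    rw [mul_comm]
    refine this.trans ?_
    have := sM_nonneg E k (l + 1) φ
    gcongr
  have := (convex_closedBall (0 : E) R).norm_image_sub_le_of_norm_fderiv_le (𝕜 := ℝ)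
    (f := fun ζ => iteratedFDeriv ℝ l φ (x - ζ)) (x := w) (y := z)
    (fun ζ _ => (hd _).comp ζ (by fun_prop)) hb (by simpa using hw) (by simpa using hz)
  calc _ ≤ ‖x‖ ^ k * (sM E k (l + 1) φ * (1 + R) ^ k / ‖x‖ ^ k * ‖z - w‖) := by gcongr
    _ = _ := by field_simp

end GenE


section GenE
set_option linter.unusedSectionVars false
variable (E : Type) [NormedAddCommGroup E] [InnerProductSpace ℝ E] [FiniteDimensional ℝ E] [MeasurableSpace E] [BorelSpace E]

/-- unit tuples -/
abbrev UT (E : Type) [NormedAddCommGroup E] (l : ℕ) := Fin l → Metric.closedBall (0 : E) 1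

/-- Target Banach space -/
abbrev BB (E : Type) [NormedAddCommGroup E] (S : Finset (ℕ × ℕ)) :=
  (s : S) → BoundedContinuousFunction (E × UT E s.1.2) ℂ

lemma iF_cont (l : ℕ) (φ : SE E) : Continuous (iteratedFDeriv ℝ l φ) :=
  (φ.smooth ⊤).continuous_iteratedFDeriv (m := l) (by exact_mod_cast le_top)

lemma mlt_le (l : ℕ) (D : ContinuousMultilinearMap ℝ (fun _ : Fin l => E) ℂ) (m : UT E l) :
    ‖D (fun i => (m i : E))‖ ≤ ‖D‖ := by
  refine (D.le_opNorm _).trans ?_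
  refine mul_le_of_le_one_right (norm_nonneg D) ?_
  refine Finset.prod_le_one (fun i _ => norm_nonneg _) fun i _ => ?_
  have := (m i).2
  rwa [mem_closedBall_zero_iff] at this

lemma mlt_ge (l : ℕ) (D : ContinuousMultilinearMap ℝ (fun _ : Fin l => E) ℂ) (M : ℝ) (hM : 0 ≤ M)
    (h : ∀ m : UT E l, ‖D (fun i => (m i : E))‖ ≤ M) : ‖D‖ ≤ M := by
  refine ContinuousMultilinearMap.opNorm_le_bound hM fun m => ?_
  let m' : UT E l := fun i => ⟨(‖m i‖⁻¹ : ℝ) • m i, by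
    rw [mem_closedBall_zero_iff, norm_smul, norm_inv, norm_norm]
    exact inv_mul_le_one⟩
  have h1 : m = fun i => ‖m i‖ • (m' i : E) := by
    funext i
    show m i = ‖m i‖ • ((‖m i‖⁻¹ : ℝ) • m i)
    rcases eq_or_ne (m i) 0 with h0 | h0
    · simp [h0]
    · rw [smul_smul, mul_inv_cancel₀ (norm_ne_zero_iff.2 h0), one_smul]
  have h2 : D m = (∏ i, ‖m i‖) • D (fun i => (m' i : E)) := by
    conv_lhs => rw [h1]
    exact D.map_smul_univ _ _
  rw [h2, norm_smul, Real.norm_of_nonneg (Finset.prod_nonneg fun i _ => norm_nonneg _), mul_comm]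
  exact mul_le_mul_of_nonneg_right (h m') (Finset.prod_nonneg fun i _ => norm_nonneg _)

/-- embedding -/
def bcf (s : ℕ × ℕ) (φ : SE E) : BoundedContinuousFunction (E × UT E s.2) ℂ :=
  BoundedContinuousFunction.ofNormedAddCommGroup
    (fun x => ((‖x.1‖ ^ s.1 : ℝ) : ℂ) * iteratedFDeriv ℝ s.2 φ x.1 (fun i => (x.2 i : E)))
    (by
      have h1 : Continuous fun x : E × UT E s.2 => ((‖x.1‖ ^ s.1 : ℝ) : ℂ) := by fun_prop
      have h2 : Continuous fun x : E × UT E s.2 => iteratedFDeriv ℝ s.2 φ x.1 :=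
        (iF_cont E s.2 φ).comp continuous_fst
      have h3 : Continuous fun x : E × UT E s.2 => (fun i => (x.2 i : E)) := by fun_prop
      exact h1.mul (h2.eval h3)) (SchwartzMap.seminorm ℂ s.1 s.2 φ) (by
      intro x
      rw [norm_mul]
      refine le_trans ?_ (SchwartzMap.le_seminorm ℂ s.1 s.2 φ x.1)
      refine mul_le_mul (by simp) (mlt_le E s.2 _ _) (norm_nonneg _) (by positivity))

lemma bcf_apply (s : ℕ × ℕ) (φ : SE E) (x : E × UT E s.2) :
    bcf E s φ x = ((‖x.1‖ ^ s.1 : ℝ) : ℂ) * iteratedFDeriv ℝ s.2 φ x.1 (fun i => (x.2 i : E)) := rfl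

lemma seminorm_le_bcf (s : ℕ × ℕ) (φ : SE E) :
    SchwartzMap.seminorm ℂ s.1 s.2 φ ≤ ‖bcf E s φ‖ := by
  refine SchwartzMap.seminorm_le_bound ℂ _ _ _ (norm_nonneg _) fun x => ?_
  rcases eq_or_lt_of_le (pow_nonneg (norm_nonneg x) s.1) with h0 | h0
  · rw [← h0, zero_mul]; exact norm_nonneg _
  rw [mul_comm, ← le_div_iff₀ h0]
  refine mlt_ge E s.2 _ _ (by positivity) fun m => ?_
  rw [le_div_iff₀ h0, mul_comm]
  have := (bcf E s φ).norm_coe_le_norm (x, m)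
  rw [bcf_apply, norm_mul] at this
  simpa using this

/-- embedding as linear map -/
def iot (S : Finset (ℕ × ℕ)) : SE E →ₗ[ℂ] BB E S where
  toFun φ := fun s => bcf E s.1 φ
  map_add' φ ψ := by
    funext s
    ext1 x
    have h : iteratedFDeriv ℝ s.1.2 (⇑(φ + ψ)) x.1 = iteratedFDeriv ℝ s.1.2 φ x.1 + iteratedFDeriv ℝ s.1.2 ψ x.1 := by
      have : (⇑(φ + ψ)) = ⇑φ + ⇑ψ := by ext; simp
      rw [this]
      exact iteratedFDeriv_add_apply (φ.contDiffAt _) (ψ.contDiffAt _)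
    show bcf E s.1 (φ + ψ) x = bcf E s.1 φ x + bcf E s.1 ψ x
    rw [bcf_apply, bcf_apply, bcf_apply, h, add_apply, mul_add]
  map_smul' c φ := by
    funext s
    ext1 x
    have h : iteratedFDeriv ℝ s.1.2 (⇑(c • φ)) x.1 = c • iteratedFDeriv ℝ s.1.2 φ x.1 := by
      have : (⇑(c • φ)) = c • ⇑φ := by ext; simp
      rw [this]
      exact iteratedFDeriv_const_smul_apply (φ.contDiffAt _)
    show bcf E s.1 (c • φ) x = c • bcf E s.1 φ x
    rw [bcf_apply, bcf_apply, h, smul_apply, smul_eq_mul, smul_eq_mul]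
    ring

lemma T_bound (T : SE E →L[ℂ] ℂ) : ∃ (S : Finset (ℕ × ℕ)) (C : ℝ), 0 ≤ C ∧
    ∀ φ, ‖T φ‖ ≤ C * (S.sup (schwartzSeminormFamily ℂ (E) ℂ)) φ := by
  obtain ⟨S, C, -, h⟩ := Seminorm.bound_of_continuous (schwartz_withSeminorms ℂ (E) ℂ)
    ((normSeminorm ℂ ℂ).comp T.toLinearMap) (continuous_norm.comp T.continuous)
  exact ⟨S, C, C.2, fun φ => h φ⟩

lemma sup_le_iot (S : Finset (ℕ × ℕ)) (φ : SE E) :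
    (S.sup (schwartzSeminormFamily ℂ (E) ℂ)) φ ≤ ‖iot E S φ‖ := by
  refine Seminorm.finset_sup_apply_le (norm_nonneg _) fun s hs => ?_
  exact (seminorm_le_bcf E s φ).trans (norm_le_pi_norm (iot E S φ) ⟨s, hs⟩)

lemma T_ext (T : SE E →L[ℂ] ℂ) : ∃ (S : Finset (ℕ × ℕ)) (G : BB E S →L[ℂ] ℂ),
    ∀ φ, T φ = G (iot E S φ) := by
  obtain ⟨S, C, hC, h⟩ := T_bound E T
  have h' : ∀ φ, ‖T φ‖ ≤ C * ‖iot E S φ‖ := fun φ =>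
    (h φ).trans (mul_le_mul_of_nonneg_left (sup_le_iot E S φ) hC)
  have hk : LinearMap.ker (iot E S) ≤ LinearMap.ker T.toLinearMap := by
    intro φ hφ
    rw [LinearMap.mem_ker] at hφ ⊢
    have := h' φ
    rw [hφ, norm_zero, mul_zero] at this
    simpa using this
  let g : LinearMap.range (iot E S) →ₗ[ℂ] ℂ :=
    ((LinearMap.ker (iot E S)).liftQ T.toLinearMap hk).comp
      (iot E S).quotKerEquivRange.symm.toLinearMap
  have hg : ∀ φ, g ⟨iot E S φ, LinearMap.mem_range_self _ φ⟩ = T φ := by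
    intro φ
    have : (iot E S).quotKerEquivRange.symm ⟨iot E S φ, LinearMap.mem_range_self _ φ⟩ =
        (LinearMap.ker (iot E S)).mkQ φ := by
      rw [LinearEquiv.symm_apply_eq]; rfl
    show ((LinearMap.ker (iot E S)).liftQ T.toLinearMap hk) ((iot E S).quotKerEquivRange.symm _) = _
    rw [this]; rfl
  let g' : LinearMap.range (iot E S) →L[ℂ] ℂ := g.mkContinuous C (by
    rintro ⟨_, φ, rfl⟩
    rw [hg]; exact h' φ)
  obtain ⟨G, hG, -⟩ := exists_extension_norm_eq (LinearMap.range (iot E S)) g'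
  refine ⟨S, G, fun φ => ?_⟩
  have := hG ⟨iot E S φ, LinearMap.mem_range_self _ φ⟩
  rw [this]; exact (hg φ).symm

lemma iot_cont (S : Finset (ℕ × ℕ)) (φ : SE E) :
    Continuous fun z => iot E S (tsl E z φ) := by
  refine continuous_pi fun s => ?_
  show Continuous fun z => bcf E s.1 (tsl E z φ)
  rw [continuous_iff_continuousAt]
  intro w
  set K := sM E s.1.1 (s.1.2 + 1) φ * (1 + (‖w‖ + 1)) ^ s.1.1 with hK
  have hK0 : 0 ≤ K := by have := sM_nonneg E s.1.1 (s.1.2 + 1) φ; positivity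
  rw [ContinuousAt, tendsto_iff_dist_tendsto_zero]
  have h0 : Filter.Tendsto (fun z : E => K * ‖z - w‖) (nhds w) (nhds 0) := by
    have : Continuous fun z : E => K * ‖z - w‖ := by fun_prop
    simpa using this.tendsto w
  refine squeeze_zero' (Filter.Eventually.of_forall fun _ => dist_nonneg) ?_ h0
  filter_upwards [Metric.ball_mem_nhds w one_pos] with z hz
  rw [BoundedContinuousFunction.dist_le (by positivity)]
  intro x
  rw [dist_eq_norm, bcf_apply, bcf_apply, tsl_iterF, tsl_iterF, ← mul_sub, norm_mul, ← sub_apply]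
  have hzn : ‖z‖ ≤ ‖w‖ + 1 := by
    have h1 : ‖z‖ ≤ ‖z - w‖ + ‖w‖ := by simpa using norm_add_le (z - w) w
    have h2 : ‖z - w‖ < 1 := by simpa [dist_eq_norm] using hz
    linarith
  have := tsl_lip E s.1.1 s.1.2 φ (‖w‖ + 1) z w x.1 hzn (by linarith)
  refine le_trans ?_ this
  exact mul_le_mul (by simp) (mlt_le E s.1.2 _ _) (norm_nonneg _) (by positivity)

lemma iot_growth (S : Finset (ℕ × ℕ)) (φ : SE E) : ∃ (C : ℝ) (K : ℕ), 0 ≤ C ∧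
    ∀ z, ‖iot E S (tsl E z φ)‖ ≤ C * (1 + ‖z‖) ^ K := by
  refine ⟨∑ s ∈ S, sM E s.1 s.2 φ, S.sup Prod.fst, Finset.sum_nonneg fun s _ => sM_nonneg _ _ _ _, fun z => ?_⟩
  have hC : 0 ≤ ∑ s ∈ S, sM E s.1 s.2 φ := Finset.sum_nonneg fun s _ => sM_nonneg _ _ _ _
  rw [pi_norm_le_iff_of_nonneg (by positivity)]
  intro s
  show ‖bcf E s.1 (tsl E z φ)‖ ≤ _
  rw [BoundedContinuousFunction.norm_le (by positivity)]
  intro x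
  rw [bcf_apply, norm_mul]
  have h1 := tsl_growth E s.1.1 s.1.2 φ z x.1
  refine (mul_le_mul (by simp) (mlt_le E s.1.2 _ _) (norm_nonneg _) (by positivity)).trans (h1.trans ?_)
  have h2 : sM E s.1.1 s.1.2 φ ≤ ∑ s ∈ S, sM E s.1 s.2 φ :=
    Finset.single_le_sum (f := fun s : ℕ × ℕ => sM E s.1 s.2 φ) (fun s _ => sM_nonneg _ _ _ _) s.2
  have h3 : s.1.1 ≤ S.sup Prod.fst := Finset.le_sup (f := Prod.fst) s.2
  gcongr
  linarith [norm_nonneg z]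

lemma eta_int (η : SE E) (K : ℕ) : Integrable fun z : E => ‖η z‖ * (1 + ‖z‖) ^ K := by
  have : (fun z : E => ‖η z‖ * (1 + ‖z‖) ^ K) =
      fun z => ∑ i ∈ Finset.range (K + 1), (K.choose i : ℝ) * (‖z‖ ^ i * ‖η z‖) := by
    ext z
    rw [add_comm, add_pow, Finset.mul_sum]
    refine Finset.sum_congr rfl fun i _ => ?_
    simp; ring
  rw [this]
  refine integrable_finsetSum _ fun i _ => ?_
  exact (η.integrable_pow_mul volume i).const_mul _

lemma T_comm (T : SE E →L[ℂ] ℂ) (φ : SE E) :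
    Continuous (fun z => T (tsl E z φ)) ∧ (∃ (C : ℝ) (K : ℕ), 0 ≤ C ∧ ∀ z, ‖T (tsl E z φ)‖ ≤ C * (1 + ‖z‖) ^ K) ∧
    ∀ η, T (scv E η φ) = ∫ z, η z * T (tsl E z φ) := by
  obtain ⟨S, G, hG⟩ := T_ext E T
  obtain ⟨C, K, hC, hb⟩ := iot_growth E S φ
  have hc := iot_cont E S φ
  refine ⟨?_, ?_, ?_⟩
  · simp only [hG]
    exact G.continuous.comp hc
  · refine ⟨‖G‖ * C, K, by positivity, fun z => ?_⟩
    rw [hG, mul_assoc]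
    exact (G.le_opNorm _).trans (mul_le_mul_of_nonneg_left (hb z) (norm_nonneg _))
  · intro η
    have hint : Integrable fun z => η z • iot E S (tsl E z φ) := by
      refine ((eta_int E η K).const_mul C).mono' ?_ ?_
      · exact (η.continuous.smul hc).aestronglyMeasurable
      · refine Filter.Eventually.of_forall fun z => ?_
        rw [norm_smul]
        calc _ ≤ ‖η z‖ * (C * (1 + ‖z‖) ^ K) := by gcongr; exact hb z
          _ = _ := by ring
    have key : iot E S (scv E η φ) = ∫ z, η z • iot E S (tsl E z φ) := by
      funext s
      ext1 x
      let Λ : BB E S →L[ℂ] ℂ :=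
        (BoundedContinuousFunction.evalCLM ℂ x).comp (ContinuousLinearMap.proj s)
      have hΛ : ∀ b : BB E S, b s x = Λ b := fun b => rfl
      rw [hΛ, hΛ]
      rw [← ContinuousLinearMap.integral_comp_comm Λ hint]
      have h1 : ∀ χ : SE E, Λ (iot E S χ) = ((‖x.1‖ ^ s.1.1 : ℝ) : ℂ) * iteratedFDeriv ℝ s.1.2 χ x.1 (fun i => (x.2 i : E)) := by
        intro χ
        exact bcf_apply E s.1 χ x
      have h2 : ∀ z, Λ (η z • iot E S (tsl E z φ)) = ((‖x.1‖ ^ s.1.1 : ℝ) : ℂ) * (η z * iteratedFDeriv ℝ s.1.2 φ (x.1 - z) (fun i => (x.2 i : E))) := by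
        intro z
        rw [← LinearMap.map_smul, h1]
        have h : iteratedFDeriv ℝ s.1.2 (⇑(η z • tsl E z φ)) x.1 = η z • iteratedFDeriv ℝ s.1.2 (tsl E z φ) x.1 := by
          have : (⇑(η z • tsl E z φ)) = η z • ⇑(tsl E z φ) := by ext; simp
          rw [this]
          exact iteratedFDeriv_const_smul_apply (SchwartzMap.contDiffAt _ _)
        rw [h, tsl_iterF]; simp
      simp only [h2]
      rw [h1, integral_const_mul, scv_iterF]
    rw [hG, key, ← ContinuousLinearMap.integral_comp_comm G hint]
    simp only [map_smul, smul_eq_mul, hG]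

end GenE

section GenE
set_option linter.unusedSectionVars false
variable (E : Type) [NormedAddCommGroup E] [InnerProductSpace ℝ E] [FiniteDimensional ℝ E] [MeasurableSpace E] [BorelSpace E]

/-- pointwise product -/
def smul2 (f g : SE E) : SE E := SchwartzMap.pairing (ContinuousLinearMap.mul ℂ ℂ) f g

lemma smul2_apply (f g : SE E) (x : E) : smul2 E f g x = f x * g x := by
  simp [smul2]

lemma comp_bd (g : E → ℂ) (hg : ContDiff ℝ (⊤ : ℕ∞) g) (i : ℕ) (B : ℝ) (hB : ∀ x, ‖iteratedFDeriv ℝ i g x‖ ≤ B)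
    (A : E →L[ℝ] E) (hA : ‖A‖ ≤ 1) (x : E) : ‖iteratedFDeriv ℝ i (fun y => g (A y)) x‖ ≤ B := by
  have h0 : 0 ≤ B := (norm_nonneg _).trans (hB x)
  have h := A.iteratedFDeriv_comp_right hg x (i := i) (by exact_mod_cast le_top)
  rw [Function.comp_def] at h
  rw [h]
  refine (ContinuousMultilinearMap.norm_compContinuousLinearMap_le _ _).trans ?_
  calc _ ≤ B * 1 := by
        refine mul_le_mul (hB _) ?_ (by positivity) h0
        exact Finset.prod_le_one (fun _ _ => norm_nonneg _) fun _ _ => hA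
    _ = B := mul_one B

lemma lemS (χ : SE E) (g : E → ℂ) (hg : ContDiff ℝ (⊤ : ℕ∞) g)
    (hB : ∀ i, ∃ B, ∀ x, ‖iteratedFDeriv ℝ i g x‖ ≤ B) (c : ℝ) (hc : 0 < c)
    (h0 : ∀ x, ‖x‖ < c → g x = 0) (k l L : ℕ) :
    ∃ C : ℝ, 0 ≤ C ∧ ∀ (m : ℕ) (A : E →L[ℝ] E), (∀ x, ‖A x‖ ≤ (2 ^ m)⁻¹ * ‖x‖) →
      ∀ P : SE E, (∀ x, P x = χ x * g (A x)) →
        SchwartzMap.seminorm ℂ k l P ≤ C * ((2 ^ m)⁻¹) ^ L := by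
  choose B hB using hB
  have hB0 : ∀ i, 0 ≤ B i := fun i => (norm_nonneg _).trans (hB i 0)
  set Sg := ∑ i ∈ Finset.range (l + 1), (l.choose i : ℝ) * SchwartzMap.seminorm ℝ (k + L) i χ * B (l - i) with hSg
  have hSg0 : 0 ≤ Sg := by
    refine Finset.sum_nonneg fun i _ => ?_
    have := hB0 (l - i)
    positivity
  refine ⟨Sg * (c⁻¹) ^ L, by positivity, fun m A hA P hP => ?_⟩
  refine SchwartzMap.seminorm_le_bound ℂ k l P (by positivity) fun x => ?_
  have hPe : (⇑P) = fun x => χ x * g (A x) := funext hP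
  have h2 : (0:ℝ) < 2 ^ m := by positivity
  rcases lt_or_ge ‖x‖ (c * 2 ^ m) with hx | hx
  · have : (⇑P) =ᶠ[nhds x] fun _ => (0 : ℂ) := by
      have ho : IsOpen {y : E | ‖y‖ < c * 2 ^ m} := isOpen_lt continuous_norm continuous_const
      filter_upwards [ho.mem_nhds hx] with y hy
      rw [hP, h0, mul_zero]
      refine (hA y).trans_lt ?_
      have hy' : ‖y‖ < c * 2 ^ m := hy
      calc (2 ^ m)⁻¹ * ‖y‖ < (2 ^ m)⁻¹ * (c * 2 ^ m) := by gcongr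
        _ = c := by field_simp
    have h3 := (this.iteratedFDeriv ℝ l).eq_of_nhds
    have h4 : iteratedFDeriv ℝ l (fun _ : E => (0:ℂ)) x = 0 := by
      have := iteratedFDeriv_fun_zero (𝕜 := ℝ) (E := E) (F := ℂ) (n := l)
      exact congrFun this x
    rw [h3, h4, norm_zero, mul_zero]; positivity
  · have hA1 : ‖A‖ ≤ 1 := by
      refine A.opNorm_le_bound zero_le_one fun y => (hA y).trans ?_
      gcongr
      exact inv_le_one_of_one_le₀ (one_le_pow₀ (by norm_num))
    have hgA : ContDiff ℝ (⊤ : ℕ∞) fun y => g (A y) := hg.comp A.contDiff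
    have hL := norm_iteratedFDeriv_mul_le (χ.smooth ⊤) hgA x (n := l) (by exact_mod_cast le_top)
    rw [hPe]
    have h1 : (1:ℝ) ≤ ‖x‖ * (c⁻¹ * (2 ^ m)⁻¹) := by
      rw [← mul_inv, ← div_eq_mul_inv, le_div_iff₀ (by positivity), one_mul]; exact hx
    calc ‖x‖ ^ k * ‖iteratedFDeriv ℝ l (fun x => χ x * g (A x)) x‖
        ≤ ‖x‖ ^ k * (‖x‖ * (c⁻¹ * (2 ^ m)⁻¹)) ^ L * ‖iteratedFDeriv ℝ l (fun x => χ x * g (A x)) x‖ := by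
          gcongr
          refine le_mul_of_one_le_right (by positivity) (one_le_pow₀ h1)
      _ = (c⁻¹ ^ L * ((2 ^ m)⁻¹) ^ L) * (‖x‖ ^ (k + L) * ‖iteratedFDeriv ℝ l (fun x => χ x * g (A x)) x‖) := by
          rw [mul_pow, mul_pow, pow_add]; ring
      _ ≤ (c⁻¹ ^ L * ((2 ^ m)⁻¹) ^ L) * Sg := by
          refine mul_le_mul_of_nonneg_left ?_ (by positivity)
          calc _ ≤ ‖x‖ ^ (k + L) * ∑ i ∈ Finset.range (l + 1), (l.choose i : ℝ) * ‖iteratedFDeriv ℝ i χ x‖ *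
                ‖iteratedFDeriv ℝ (l - i) (fun y => g (A y)) x‖ := by
                exact mul_le_mul_of_nonneg_left hL (by positivity)
            _ = ∑ i ∈ Finset.range (l + 1), (l.choose i : ℝ) * (‖x‖ ^ (k + L) * ‖iteratedFDeriv ℝ i χ x‖) *
                ‖iteratedFDeriv ℝ (l - i) (fun y => g (A y)) x‖ := by
                rw [Finset.mul_sum]; refine Finset.sum_congr rfl fun i _ => ?_; ring
            _ ≤ Sg := by
                refine Finset.sum_le_sum fun i _ => ?_
                have h5 := comp_bd E g hg (l - i) (B (l - i)) (hB (l - i)) A hA1 x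
                have h6 := SchwartzMap.le_seminorm ℝ (k + L) i χ x
                have := hB0 (l - i)
                gcongr
      _ = _ := by ring

lemma lemS' (χ : SE E) (g : E → ℂ) (hg : ContDiff ℝ (⊤ : ℕ∞) g)
    (hB : ∀ i, ∃ B, ∀ x, ‖iteratedFDeriv ℝ i g x‖ ≤ B) (c : ℝ) (hc : 0 < c)
    (h0 : ∀ x, ‖x‖ < c → g x = 0) (Q : Seminorm ℂ (SE E)) (hQ : Continuous Q) (L : ℕ) :
    ∃ C : ℝ, 0 ≤ C ∧ ∀ (m : ℕ) (A : E →L[ℝ] E), (∀ x, ‖A x‖ ≤ (2 ^ m)⁻¹ * ‖x‖) →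
      ∀ P : SE E, (∀ x, P x = χ x * g (A x)) → Q P ≤ C * ((2 ^ m)⁻¹) ^ L := by
  choose C hC0 hC using fun s : ℕ × ℕ => lemS E χ g hg hB c hc h0 s.1 s.2 L
  obtain ⟨S, K, -, hK⟩ := Seminorm.bound_of_continuous (schwartz_withSeminorms ℂ E ℂ) Q hQ
  have hS : 0 ≤ ∑ s ∈ S, C s := Finset.sum_nonneg fun s _ => hC0 s
  refine ⟨K * ∑ s ∈ S, C s, by positivity, fun m A hA P hP => ?_⟩
  refine (hK P).trans ?_
  show (K : ℝ) * (S.sup (schwartzSeminormFamily ℂ E ℂ)) P ≤ _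
  rw [mul_assoc]
  refine mul_le_mul_of_nonneg_left ?_ K.2
  refine Seminorm.finset_sup_apply_le (by positivity) fun s hs => ?_
  refine (hC s m A hA P hP).trans ?_
  gcongr
  exact Finset.single_le_sum (fun s _ => hC0 s) hs

lemma sch_bd (G : SE E) (c0 : ℂ) (i : ℕ) :
    ∃ B, ∀ x, ‖iteratedFDeriv ℝ i (fun x => c0 - G x) x‖ ≤ B := by
  refine ⟨‖c0‖ + SchwartzMap.seminorm ℝ 0 i G, fun x => ?_⟩
  have h1 : iteratedFDeriv ℝ i (fun x => c0 - G x) x =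
      iteratedFDeriv ℝ i (fun _ : E => c0) x - iteratedFDeriv ℝ i G x :=
    iteratedFDeriv_sub_apply (f := fun _ : E => c0) contDiffAt_const (G.contDiffAt _)
  rw [h1]
  refine (norm_sub_le _ _).trans (add_le_add ?_ (G.norm_iteratedFDeriv_le_seminorm ℝ i x))
  rcases Nat.eq_zero_or_pos i with rfl | hi
  · simp
  · rw [iteratedFDeriv_const_of_ne (by omega)]; simp

open FourierTransform in
lemma core (D : ℕ → E ≃L[ℝ] E) (hD0 : ∀ x, D 0 x = x) (hD : ∀ m x, ‖D m x‖ ≤ (2 ^ m)⁻¹ * ‖x‖)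
    (χ ψ Φ lam : SE E) (c : ℝ) (hc : 0 < c) (hΦ : ∀ x, ‖x‖ < c → Φ x = 1)
    (hl : ∀ x, ‖x‖ < c → lam x = 0)
    (hlψ : ∀ m ξ, lam (D (m + 1) ξ) * 𝓕 ψ (D (m + 1) ξ) = Φ (D (m + 1) ξ) - Φ (D m ξ))
    (v : ℕ → SE E) (hv0 : v 0 = χ) (hv : ∀ m ξ, 𝓕 (v (m + 1)) ξ = 𝓕 ψ (D (m + 1) ξ)) :
    ∃ κ : ℕ → SE E, (∀ N L : ℕ, ∃ C : ℝ, 0 ≤ C ∧ ∀ m x, (1 + ‖x‖) ^ N * ‖κ m x‖ ≤ C * ((2 ^ m)⁻¹) ^ L) ∧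
      ∀ T : SE E →L[ℂ] ℂ, Filter.Tendsto
        (fun M : ℕ => ∑ m ∈ Finset.range (M + 1), ∫ z, κ m z * T (tsl E z (v m))) Filter.atTop (nhds (T χ)) := by
  let cD : ℕ → SE E → SE E := fun m => SchwartzMap.compCLMOfContinuousLinearEquiv ℂ (D m)
  have hcD : ∀ m f x, cD m f x = f (D m x) := fun m f x => rfl
  let κ : ℕ → SE E := fun m => match m with
    | 0 => 𝓕⁻ Φ
    | m + 1 => 𝓕⁻ (smul2 E (𝓕 χ) (cD (m + 1) lam))
  have hκ0 : 𝓕 (κ 0) = Φ := FourierTransform.fourier_fourierInv_eq (E := SE E) Φ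
  have hκ : ∀ m, 𝓕 (κ (m + 1)) = smul2 E (𝓕 χ) (cD (m + 1) lam) := fun m =>
    FourierTransform.fourier_fourierInv_eq (E := SE E) _
  refine ⟨κ, fun N L => ?_, fun T => ?_⟩
  · let Qr : Seminorm ℂ (SE E) := (Finset.Iic (N, 0)).sup (schwartzSeminormFamily ℂ E ℂ)
    have hQr : Continuous Qr := by
      refine Seminorm.continuous_finsetSup ?_
      intro s _
      exact (schwartz_withSeminorms ℂ E ℂ).continuous_seminorm s
    let Q : Seminorm ℂ (SE E) := Qr.comp (fourierInvCLM ℂ (SE E)).toLinearMap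
    have hQ : Continuous Q := hQr.comp (fourierInvCLM ℂ (SE E)).continuous
    have hb : ∀ (f : SE E) x, (1 + ‖x‖) ^ N * ‖f x‖ ≤ 2 ^ N * Qr f := by
      intro f x
      have := SchwartzMap.one_add_le_sup_seminorm_apply (𝕜 := ℂ) (m := (N, 0)) le_rfl le_rfl f x
      rw [norm_iteratedFDeriv_zero] at this; exact this
    obtain ⟨C, hC0, hC⟩ := lemS' E (𝓕 χ) lam (lam.smooth ⊤)
      (fun i => ⟨_, fun x => lam.norm_iteratedFDeriv_le_seminorm ℝ i x⟩) c hc hl Q hQ L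
    refine ⟨2 ^ N * (Qr (κ 0) + C), ?_, ?_⟩
    · have : 0 ≤ Qr (κ 0) := apply_nonneg _ _
      positivity
    · intro m x
      have hq0 : 0 ≤ Qr (κ 0) := apply_nonneg _ _
      refine (hb _ x).trans ?_
      rw [mul_assoc]
      refine mul_le_mul_of_nonneg_left ?_ (by positivity)
      cases m with
      | zero => simp; exact hC0
      | succ m =>
        have := hC (m + 1) (D (m + 1)).toContinuousLinearMap (hD (m + 1))
          (smul2 E (𝓕 χ) (cD (m + 1) lam)) (fun x => by rw [smul2_apply, hcD]; rfl)
        calc Qr (κ (m + 1)) ≤ C * ((2 ^ (m + 1))⁻¹) ^ L := this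
          _ ≤ _ := by gcongr; linarith
  · have h1 : ∀ M, ∑ m ∈ Finset.range (M + 1), ∫ z, κ m z * T (tsl E z (v m)) =
        T (∑ m ∈ Finset.range (M + 1), scv E (κ m) (v m)) := by
      intro M
      rw [map_sum]
      exact Finset.sum_congr rfl fun m _ => ((T_comm E T (v m)).2.2 (κ m)).symm
    have hF : ∀ M ξ, 𝓕 (∑ m ∈ Finset.range (M + 1), scv E (κ m) (v m)) ξ = 𝓕 χ ξ * Φ (D M ξ) := by
      intro M ξ
      induction M with
      | zero =>
        simp only [zero_add, Finset.sum_range_one, scv_fourier, hκ0, hv0, hD0]; ring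
      | succ M ih =>
        rw [Finset.sum_range_succ, FourierTransform.fourier_add, add_apply, ih,
          scv_fourier, hκ, hv, smul2_apply, hcD, mul_assoc, hlψ]
        ring
    let T' : SE E →L[ℂ] ℂ := T.comp (fourierInvCLM ℂ (SE E))
    let R : ℕ → SE E := fun M => 𝓕 χ - smul2 E (𝓕 χ) (cD M Φ)
    have h2 : ∀ M, T χ - T (∑ m ∈ Finset.range (M + 1), scv E (κ m) (v m)) = T' (R M) := by
      intro M
      have : 𝓕⁻ (R M) = χ - ∑ m ∈ Finset.range (M + 1), scv E (κ m) (v m) := by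
        rw [← FourierTransform.fourierInv_fourier_eq (F := SE E) (χ - ∑ m ∈ Finset.range (M + 1), scv E (κ m) (v m))]
        congr 1
        ext ξ
        have hs : 𝓕 (χ - ∑ m ∈ Finset.range (M + 1), scv E (κ m) (v m)) =
            𝓕 χ - 𝓕 (∑ m ∈ Finset.range (M + 1), scv E (κ m) (v m)) :=
          map_sub (FourierTransform.fourierCLM ℂ (SE E)) _ _
        rw [hs]
        show (𝓕 χ - smul2 E (𝓕 χ) (cD M Φ)) ξ = _
        rw [sub_apply, sub_apply, hF, smul2_apply, hcD]
      show _ = T (𝓕⁻ (R M))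
      rw [this, map_sub]
    obtain ⟨C, hC0, hC⟩ := lemS' E (𝓕 χ) (fun x => 1 - Φ x) (contDiff_const.sub (Φ.smooth ⊤))
      (sch_bd E Φ 1) c hc (fun x hx => by simp [hΦ x hx]) ((normSeminorm ℂ ℂ).comp T'.toLinearMap)
      (continuous_norm.comp T'.continuous) 1
    simp only [h1]
    rw [tendsto_iff_norm_sub_tendsto_zero]
    refine squeeze_zero (fun _ => norm_nonneg _) (g := fun M => C * (1/2) ^ M) (fun M => ?_) ?_
    · rw [norm_sub_rev, h2]
      have := hC M (D M).toContinuousLinearMap (hD M) (R M) (fun x => by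
        show (𝓕 χ - smul2 E (𝓕 χ) (cD M Φ)) x = _
        rw [sub_apply, smul2_apply, hcD]; simp; ring)
      refine le_trans this (le_of_eq ?_)
      simp
    · simpa using (tendsto_pow_atTop_nhds_zero_of_lt_one (r := (1/2 : ℝ)) (by norm_num) (by norm_num)).const_mul C

end GenE

/-- anisotropic dilation -/
def dlL (n : ℕ) (a : Fin n → ℝ) (t : ℝ) : EV n →ₗ[ℝ] EV n where
  toFun x := WithLp.toLp 2 fun i => (2:ℝ) ^ (t * a i) * x i
  map_add' x y := by ext i; simp [mul_add]
  map_smul' c x := by ext i; simp; ring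

lemma dlL_comp (n : ℕ) (a : Fin n → ℝ) (s t : ℝ) (x : EV n) : dlL n a s (dlL n a t x) = dlL n a (s + t) x := by
  ext i
  simp only [dlL, LinearMap.coe_mk, AddHom.coe_mk]
  rw [add_mul, Real.rpow_add (by norm_num)]; ring

lemma dlL_zero (n : ℕ) (a : Fin n → ℝ) (x : EV n) : dlL n a 0 x = x := by
  ext i; simp [dlL]

def dl (n : ℕ) (a : Fin n → ℝ) (t : ℝ) : EV n ≃L[ℝ] EV n :=
  LinearEquiv.toContinuousLinearEquiv
    { dlL n a t with
      invFun := dlL n a (-t)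
      left_inv := fun x => by
        show dlL n a (-t) (dlL n a t x) = x
        rw [dlL_comp, neg_add_cancel, dlL_zero]
      right_inv := fun x => by
        show dlL n a t (dlL n a (-t) x) = x
        rw [dlL_comp, add_neg_cancel, dlL_zero] }

lemma dl_eq (n : ℕ) (a : Fin n → ℝ) (t : ℝ) (x : EV n) : dl n a t x = dlL n a t x := rfl

lemma dl_apply (n : ℕ) (a : Fin n → ℝ) (t : ℝ) (x : EV n) (i : Fin n) :
    dl n a t x i = (2:ℝ) ^ (t * a i) * x i := rfl

lemma dl_comp (n : ℕ) (a : Fin n → ℝ) (s t : ℝ) (x : EV n) : dl n a s (dl n a t x) = dl n a (s + t) x :=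
  dlL_comp n a s t x

lemma dl_zero (n : ℕ) (a : Fin n → ℝ) (x : EV n) : dl n a 0 x = x := dlL_zero n a x

lemma dl_norm (n : ℕ) (a : Fin n → ℝ) (ha : ∀ i, 1 ≤ a i) (m : ℕ) (x : EV n) :
    ‖dl n a (-(m:ℝ)) x‖ ≤ (2 ^ m)⁻¹ * ‖x‖ := by
  have h0 : (0:ℝ) ≤ (2 ^ m)⁻¹ := by positivity
  rw [EuclideanSpace.norm_eq, EuclideanSpace.norm_eq, ← Real.sqrt_sq h0, ← Real.sqrt_mul (by positivity),
    Finset.mul_sum]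
  refine Real.sqrt_le_sqrt (Finset.sum_le_sum fun i _ => ?_)
  rw [dl_apply, norm_mul, mul_pow]
  refine mul_le_mul_of_nonneg_right ?_ (by positivity)
  have : (2:ℝ) ^ (-(m:ℝ) * a i) ≤ (2 ^ m)⁻¹ := by
    rw [← Real.rpow_natCast, ← Real.rpow_neg (by norm_num)]
    refine Real.rpow_le_rpow_of_exponent_le (by norm_num) ?_
    nlinarith [ha i, (Nat.cast_nonneg m : (0:ℝ) ≤ m)]
  rw [Real.norm_of_nonneg (by positivity)]
  gcongr

lemma dl_det (n : ℕ) (a : Fin n → ℝ) (t : ℝ) : LinearMap.det (dlL n a t) = (2:ℝ) ^ (t * ∑ i, a i) := by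
  have : dlL n a t = Matrix.toLin (EuclideanSpace.basisFun (Fin n) ℝ).toBasis (EuclideanSpace.basisFun (Fin n) ℝ).toBasis
      (Matrix.diagonal fun i => (2:ℝ) ^ (t * a i)) := by
    refine (EuclideanSpace.basisFun (Fin n) ℝ).toBasis.ext fun j => ?_
    rw [Matrix.toLin_self]
    ext i
    simp [dlL, Matrix.diagonal_apply]
    split_ifs with h
    · rw [h]
    · rfl
  rw [this, LinearMap.det_toLin, Matrix.det_diagonal, Finset.mul_sum, Real.rpow_sum_of_pos (by norm_num)]

lemma dl_map (n : ℕ) (a : Fin n → ℝ) (t : ℝ) :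
    Measure.map (dl n a t).toHomeomorph.toMeasurableEquiv (volume : Measure (EV n)) = p2 (-t * ∑ i, a i) • volume := by
  have h := Measure.map_linearMap_addHaar_eq_smul_addHaar (volume : Measure (EV n)) (f := dlL n a t)
    (by rw [dl_det]; positivity)
  rw [dl_det, ← Real.rpow_neg (by norm_num), abs_of_pos (by positivity), ← neg_mul] at h
  exact h

lemma dl_lint (n : ℕ) (a : Fin n → ℝ) (t : ℝ) (g : EV n → ℝ≥0∞) :
    ∫⁻ x, g (dl n a t x) = p2 (-t * ∑ i, a i) * ∫⁻ x, g x := by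
  have := lintegral_map_equiv g (dl n a t).toHomeomorph.toMeasurableEquiv (μ := (volume : Measure (EV n)))
  rw [dl_map, lintegral_smul_measure] at this
  exact this.symm

lemma dl_int (n : ℕ) (a : Fin n → ℝ) (t : ℝ) (g : EV n → ℂ) :
    ∫ x, g (dl n a t x) = (((2:ℝ) ^ (-t * ∑ i, a i) : ℝ) : ℂ) * ∫ x, g x := by
  have := integral_map_equiv (dl n a t).toHomeomorph.toMeasurableEquiv g (μ := (volume : Measure (EV n)))
  rw [dl_map, integral_smul_measure, p2, ENNReal.toReal_ofReal (by positivity), Complex.real_smul] at this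
  exact this.symm

/-- `L¹`-normalised dilate -/
def dS (n : ℕ) (a : Fin n → ℝ) (t : ℝ) : SE (EV n) →L[ℂ] SE (EV n) :=
  (((2:ℝ) ^ (t * ∑ i, a i) : ℝ) : ℂ) • SchwartzMap.compCLMOfContinuousLinearEquiv ℂ (dl n a t)

lemma dS_apply (n : ℕ) (a : Fin n → ℝ) (t : ℝ) (φ : SE (EV n)) (x : EV n) :
    dS n a t φ x = (((2:ℝ) ^ (t * ∑ i, a i) : ℝ) : ℂ) * φ (dl n a t x) := rfl

lemma dS_comp (n : ℕ) (a : Fin n → ℝ) (s t : ℝ) (φ : SE (EV n)) : dS n a s (dS n a t φ) = dS n a (s + t) φ := by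
  ext x
  rw [dS_apply, dS_apply, dS_apply, dl_comp, ← mul_assoc, ← Complex.ofReal_mul, ← Real.rpow_add (by norm_num),
    ← add_mul, add_comm t s]

lemma dS_zero (n : ℕ) (a : Fin n → ℝ) (φ : SE (EV n)) : dS n a 0 φ = φ := by
  ext x
  rw [dS_apply, dl_zero]; simp

open FourierTransform in
lemma dS_four (n : ℕ) (a : Fin n → ℝ) (t : ℝ) (φ : SE (EV n)) (ξ : EV n) :
    𝓕 (dS n a t φ) ξ = 𝓕 φ (dl n a (-t) ξ) := by
  rw [SchwartzMap.fourier_coe, SchwartzMap.fourier_coe, Real.fourier_eq', Real.fourier_eq']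
  have h := dl_int n a t (fun v => cexp (↑(-2 * Real.pi * inner ℝ v (dl n a (-t) ξ)) * I) • φ v)
  have h2 : (((2:ℝ) ^ (t * ∑ i, a i) : ℝ) : ℂ) * (((2:ℝ) ^ (-t * ∑ i, a i) : ℝ) : ℂ) = 1 := by
    rw [← Complex.ofReal_mul, ← Real.rpow_add (by norm_num), ← add_mul]; simp
  rw [← one_mul (∫ v, cexp (↑(-2 * Real.pi * inner ℝ v (dl n a (-t) ξ)) * I) • φ v), ← h2, mul_assoc, ← h,
    ← integral_const_mul]
  refine integral_congr_ae (Filter.Eventually.of_forall fun v => ?_)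
  have h3 : inner ℝ (dl n a t v) (dl n a (-t) ξ) = inner ℝ v ξ := by
    simp only [PiLp.inner_apply, dl_apply]
    refine Finset.sum_congr rfl fun i _ => ?_
    have : (2:ℝ) ^ (t * a i) * (2:ℝ) ^ (-t * a i) = 1 := by
      rw [← Real.rpow_add (by norm_num), ← add_mul]; simp
    simp only [RCLike.inner_apply, conj_trivial]
    linear_combination (ξ.ofLp i * v.ofLp i) * this
  show _ = (((2:ℝ) ^ (t * ∑ i, a i) : ℝ) : ℂ) * (cexp (↑(-2 * Real.pi * inner ℝ (dl n a t v) (dl n a (-t) ξ)) * I) • φ (dl n a t v))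
  beta_reduce
  rw [h3, dS_apply]
  simp only [smul_eq_mul]; ring

/-- transfer -/
def toE (n : ℕ) : SchwartzMap (RV n) ℂ →L[ℂ] SE (EV n) :=
  SchwartzMap.compCLMOfContinuousLinearEquiv ℂ (EuclideanSpace.equiv (Fin n) ℝ)

def toR (n : ℕ) : SE (EV n) →L[ℂ] SchwartzMap (RV n) ℂ :=
  SchwartzMap.compCLMOfContinuousLinearEquiv ℂ (EuclideanSpace.equiv (Fin n) ℝ).symm

lemma toE_apply (n : ℕ) (φ : SchwartzMap (RV n) ℂ) (x : EV n) : toE n φ x = φ (WithLp.ofLp x) := rfl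

lemma toR_apply (n : ℕ) (φ : SE (EV n)) (x : RV n) : toR n φ x = φ (WithLp.toLp 2 x) := rfl

open FourierTransform in
lemma toE_four (n : ℕ) (φ : SchwartzMap (RV n) ℂ) (ξ : EV n) :
    𝓕 (toE n φ) ξ = FT n φ (fun i => 2 * Real.pi * ξ i) := by
  rw [SchwartzMap.fourier_coe, Real.fourier_eq', FT]
  have h := (EuclideanSpace.volume_preserving_symm_measurableEquiv_toLp (Fin n)).integral_comp'
    (fun x : RV n => Complex.exp (-Complex.I * ((∑ i, x i * (2 * Real.pi * ξ i) : ℝ) : ℂ)) * φ x)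
  rw [← h]
  refine integral_congr_ae (Filter.Eventually.of_forall fun v => ?_)
  show cexp (↑(-2 * Real.pi * inner ℝ v ξ) * I) • φ (WithLp.ofLp v) =
    Complex.exp (-Complex.I * ((∑ i, v i * (2 * Real.pi * ξ i) : ℝ) : ℂ)) * φ (WithLp.ofLp v)
  rw [smul_eq_mul]
  congr 2
  have : (∑ i, v i * (2 * Real.pi * ξ i) : ℝ) = 2 * Real.pi * inner ℝ v ξ := by
    simp only [PiLp.inner_apply, RCLike.inner_apply, conj_trivial, Finset.mul_sum]
    exact Finset.sum_congr rfl fun i _ => by ring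
  rw [this]; push_cast; ring

lemma an_scale (a b s t x : ℝ) (ha : 1 ≤ a) (hb : 0 < b) (hb1 : b ≤ 1) (ht : 0 < t) (hs : t ≤ b * s) :
    x ^ 2 / s ^ (2 * a) ≤ b ^ 2 * (x ^ 2 / t ^ (2 * a)) := by
  have hs0 : 0 < s := by by_contra h; push Not at h; nlinarith
  have h1 : t ^ (2 * a) ≤ b ^ 2 * s ^ (2 * a) := by
    calc t ^ (2 * a) ≤ (b * s) ^ (2 * a) := Real.rpow_le_rpow ht.le hs (by linarith)
      _ = b ^ (2 * a) * s ^ (2 * a) := Real.mul_rpow hb.le hs0.le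
      _ ≤ b ^ (2:ℝ) * s ^ (2 * a) := by
        refine mul_le_mul_of_nonneg_right ?_ (by positivity)
        exact Real.rpow_le_rpow_of_exponent_ge hb hb1 (by linarith)
      _ = _ := by norm_num
  have hsp : 0 < s ^ (2 * a) := Real.rpow_pos_of_pos hs0 _
  have htp : 0 < t ^ (2 * a) := Real.rpow_pos_of_pos ht _
  rw [← mul_div_assoc, div_le_div_iff₀ hsp htp]
  nlinarith [sq_nonneg x]

/-- quadratic form -/
def qf (n : ℕ) (a : Fin n → ℝ) (ρ : ℝ) (ξ : EV n) : ℝ := ∑ i, (2 * Real.pi * ξ i) ^ 2 / ρ ^ (2 * a i)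

lemma qf_smooth (n : ℕ) (a : Fin n → ℝ) (ρ : ℝ) : ContDiff ℝ (⊤ : ℕ∞) (qf n a ρ) := by
  unfold qf
  refine ContDiff.sum fun i _ => ?_
  have : ContDiff ℝ (⊤ : ℕ∞) fun ξ : EV n => ξ i := (EuclideanSpace.proj (𝕜 := ℝ) i).contDiff
  exact ((contDiff_const.mul this).pow 2).div_const _

lemma qf_mono (n : ℕ) (a : Fin n → ℝ) (ha : ∀ i, 1 ≤ a i) (ρ : ℝ) (hρ : 0 < ρ) (ξ : EV n) :
    qf n a ρ ξ ≤ qf n a ρ (dl n a 1 ξ) := by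
  refine Finset.sum_le_sum fun i _ => ?_
  have h1 : (1:ℝ) ≤ (2:ℝ) ^ (1 * a i) := Real.one_le_rpow (by norm_num) (by linarith [ha i])
  have h2 : 0 < ρ ^ (2 * a i) := by positivity
  rw [dl_apply]
  refine div_le_div_of_nonneg_right ?_ h2.le
  have : (2 * Real.pi * (2 ^ (1 * a i) * ξ i)) ^ 2 = ((2:ℝ) ^ (1 * a i)) ^ 2 * (2 * Real.pi * ξ i) ^ 2 := by ring
  rw [this]
  exact le_mul_of_one_le_left (by positivity) (one_le_pow₀ h1)

lemma qf_an (n : ℕ) (a : Fin n → ℝ) (ha : ∀ i, 1 ≤ a i) (anorm : RV n → ℝ) (h : IsAnorm n a anorm)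
    (ε : ℝ) (hε : 0 < ε) (ξ : EV n) (h1 : qf n a (6/5 * ε) ξ ≤ 9/4) (h2 : 1 ≤ qf n a (6/5 * ε) (dl n a 1 ξ)) :
    ε / 2 < anorm (fun i => 2 * Real.pi * ξ i) ∧ anorm (fun i => 2 * Real.pi * ξ i) < 2 * ε := by
  set x : RV n := fun i => 2 * Real.pi * ξ i with hx
  have hx0 : x ≠ 0 := by
    intro h0
    have : ∀ i, 2 * Real.pi * ξ i = 0 := fun i => congrFun h0 i
    have h3 : ∀ i, ξ i = 0 := fun i => by
      have := this i
      have hp := Real.pi_pos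
      simpa [hp.ne'] using this
    have : qf n a (6/5 * ε) (dl n a 1 ξ) = 0 := by
      unfold qf
      exact Finset.sum_eq_zero fun i _ => by rw [dl_apply, h3]; simp
    linarith
  obtain ⟨ht, hs⟩ := h.2 x hx0
  set t := anorm x
  constructor
  · by_contra hc
    push Not at hc
    have : qf n a (6/5 * ε) (dl n a 1 ξ) ≤ (5/6:ℝ) ^ 2 * ∑ i, (x i) ^ 2 / t ^ (2 * a i) := by
      unfold qf
      rw [Finset.mul_sum]
      refine Finset.sum_le_sum fun i _ => ?_
      have h4 := an_scale (a i) (5/6) (6/5 * ε / 2) t (x i) (ha i) (by norm_num) (by norm_num) ht (by linarith)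
      refine le_trans (le_of_eq ?_) h4
      rw [dl_apply, Real.div_rpow (by positivity) (by norm_num), div_div_eq_mul_div, one_mul,
        mul_comm 2 (a i), Real.rpow_mul (by norm_num : (0:ℝ) ≤ 2)]
      congr 1
      simp only [hx]
      norm_num; ring
    rw [hs] at this
    linarith
  · by_contra hc
    push Not at hc
    have : ∑ i, (x i) ^ 2 / t ^ (2 * a i) ≤ (3/5:ℝ) ^ 2 * qf n a (6/5 * ε) ξ := by
      unfold qf
      rw [Finset.mul_sum]
      refine Finset.sum_le_sum fun i _ => ?_
      exact an_scale (a i) (3/5) t (6/5 * ε) (x i) (ha i) (by norm_num) (by norm_num) (by positivity) (by linarith)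
    rw [hs] at this
    linarith

lemma qf_bdd (n : ℕ) (a : Fin n → ℝ) (ρ : ℝ) (hρ : 0 < ρ) (B : ℝ) : IsCompact {ξ : EV n | qf n a ρ ξ ≤ B} := by
  refine Metric.isCompact_of_isClosed_isBounded (isClosed_le (qf_smooth n a ρ).continuous continuous_const) ?_
  rw [isBounded_iff_forall_norm_le]
  refine ⟨Real.sqrt (∑ i, B * ρ ^ (2 * a i) / (2 * Real.pi) ^ 2), fun ξ hξ => ?_⟩
  rw [EuclideanSpace.norm_eq]
  refine Real.sqrt_le_sqrt (Finset.sum_le_sum fun i _ => ?_)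
  have hq : qf n a ρ ξ ≤ B := hξ
  have h1 : (2 * Real.pi * ξ i) ^ 2 / ρ ^ (2 * a i) ≤ B :=
    (Finset.single_le_sum (f := fun i => (2 * Real.pi * ξ i) ^ 2 / ρ ^ (2 * a i))
      (fun i _ => by positivity) (Finset.mem_univ i)).trans hq
  have h2 : 0 < ρ ^ (2 * a i) := by positivity
  have hp := Real.pi_pos
  rw [div_le_iff₀ h2] at h1
  rw [Real.norm_eq_abs, sq_abs, le_div_iff₀ (by positivity)]
  linarith [mul_pow (2 * Real.pi) (ξ i) 2]

/-- the cutoff profile -/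
def cutf (n : ℕ) (a : Fin n → ℝ) (ρ : ℝ) (ξ : EV n) : ℂ := ((Real.smoothTransition (9/5 - 4/5 * qf n a ρ ξ) : ℝ) : ℂ)

lemma cutf_smooth (n : ℕ) (a : Fin n → ℝ) (ρ : ℝ) : ContDiff ℝ (⊤ : ℕ∞) (cutf n a ρ) := by
  unfold cutf
  refine Complex.ofRealCLM.contDiff.comp ?_
  exact Real.smoothTransition.contDiff.comp (contDiff_const.sub (contDiff_const.mul (qf_smooth n a ρ)))

lemma cutf_one (n : ℕ) (a : Fin n → ℝ) (ρ : ℝ) (ξ : EV n) (h : qf n a ρ ξ ≤ 1) : cutf n a ρ ξ = 1 := by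
  rw [cutf, Real.smoothTransition.one_of_one_le (by linarith)]; simp

lemma cutf_zero (n : ℕ) (a : Fin n → ℝ) (ρ : ℝ) (ξ : EV n) (h : 9/4 ≤ qf n a ρ ξ) : cutf n a ρ ξ = 0 := by
  rw [cutf, Real.smoothTransition.zero_of_nonpos (by linarith)]; simp

open FourierTransform in
lemma kern (n : ℕ) (a : Fin n → ℝ) (ha : ∀ i, 1 ≤ a i) (anorm : RV n → ℝ) (h : IsAnorm n a anorm)
    (ψ : SchwartzMap (RV n) ℂ) (ε : ℝ) (hε : 0 < ε)
    (hT : ∀ ξ, ε / 2 < anorm ξ → anorm ξ < 2 * ε → 0 < ‖FT n ψ ξ‖) (χ : SE (EV n))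
    (v : ℕ → SE (EV n)) (hv0 : v 0 = χ) (hv : ∀ m : ℕ, v (m + 1) = dS n a ((m:ℝ) + 1) (toE n ψ)) :
    ∃ κ : ℕ → SE (EV n), (∀ N L : ℕ, ∃ C : ℝ, 0 ≤ C ∧ ∀ m x, (1 + ‖x‖) ^ N * ‖κ m x‖ ≤ C * ((2 ^ m)⁻¹) ^ L) ∧
      ∀ T : SE (EV n) →L[ℂ] ℂ, Filter.Tendsto
        (fun M : ℕ => ∑ m ∈ Finset.range (M + 1), ∫ z, κ m z * T (tsl (EV n) z (v m))) Filter.atTop (nhds (T χ)) := by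
  set ρ := 6/5 * ε with hρd
  have hρ : 0 < ρ := by positivity
  have hcomp : HasCompactSupport (cutf n a ρ) := by
    refine HasCompactSupport.intro (qf_bdd n a ρ hρ (9/4)) fun ξ hξ => cutf_zero n a ρ ξ ?_
    have : ¬ (qf n a ρ ξ ≤ 9/4) := hξ
    linarith
  let Φ : SE (EV n) := hcomp.toSchwartzMap (cutf_smooth n a ρ)
  have hΦ : ∀ ξ, Φ ξ = cutf n a ρ ξ := fun ξ => rfl
  let lf : EV n → ℂ := fun ξ => (cutf n a ρ ξ - cutf n a ρ (dl n a 1 ξ)) / 𝓕 (toE n ψ) ξ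
  have hq1 : Continuous (qf n a ρ) := (qf_smooth n a ρ).continuous
  have hq2 : Continuous fun ξ => qf n a ρ (dl n a 1 ξ) := hq1.comp (dl n a 1).continuous
  have hz1 : ∀ ξ, qf n a ρ (dl n a 1 ξ) < 1 → cutf n a ρ ξ - cutf n a ρ (dl n a 1 ξ) = 0 := by
    intro ξ h1
    have := qf_mono n a ha ρ hρ ξ
    rw [cutf_one _ _ _ _ h1.le, cutf_one _ _ _ _ (by linarith), sub_self]
  have hz2 : ∀ ξ, 9/4 < qf n a ρ ξ → cutf n a ρ ξ - cutf n a ρ (dl n a 1 ξ) = 0 := by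
    intro ξ h1
    have := qf_mono n a ha ρ hρ ξ
    rw [cutf_zero _ _ _ _ h1.le, cutf_zero _ _ _ _ (by linarith), sub_self]
  have hnz : ∀ ξ, qf n a ρ ξ ≤ 9/4 → 1 ≤ qf n a ρ (dl n a 1 ξ) → 𝓕 (toE n ψ) ξ ≠ 0 := by
    intro ξ h1 h2
    obtain ⟨h3, h4⟩ := qf_an n a ha anorm h ε hε ξ h1 h2
    have := hT _ h3 h4
    rw [toE_four]
    exact norm_pos_iff.1 this
  have hdl : ContDiff ℝ (⊤ : ℕ∞) fun ξ => cutf n a ρ (dl n a 1 ξ) :=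
    (cutf_smooth n a ρ).comp (dl n a 1).contDiff
  have hls : ContDiff ℝ (⊤ : ℕ∞) lf := by
    rw [contDiff_iff_contDiffAt]
    intro ξ
    by_cases h1 : qf n a ρ ξ ≤ 9/4
    · by_cases h2 : 1 ≤ qf n a ρ (dl n a 1 ξ)
      · have hi := (((𝓕 (toE n ψ)).smooth ⊤).contDiffAt (x := ξ)).inv (hnz ξ h1 h2)
        have hm := (((cutf_smooth n a ρ).sub hdl).contDiffAt (x := ξ)).mul hi
        exact hm
      · push Not at h2
        have : lf =ᶠ[nhds ξ] fun _ => 0 := by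
          filter_upwards [(isOpen_lt hq2 continuous_const).mem_nhds h2] with y hy
          simp only [lf]; rw [hz1 y hy, zero_div]
        exact contDiffAt_const.congr_of_eventuallyEq this
    · push Not at h1
      have : lf =ᶠ[nhds ξ] fun _ => 0 := by
        filter_upwards [(isOpen_lt continuous_const hq1).mem_nhds h1] with y hy
        simp only [lf]; rw [hz2 y hy, zero_div]
      exact contDiffAt_const.congr_of_eventuallyEq this
  have hlc : HasCompactSupport lf := by
    refine HasCompactSupport.intro (qf_bdd n a ρ hρ (9/4)) fun ξ hξ => ?_
    have : ¬ (qf n a ρ ξ ≤ 9/4) := hξ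
    simp only [lf]; rw [hz2 ξ (by linarith), zero_div]
  let lam : SE (EV n) := hlc.toSchwartzMap hls
  have hq0 : qf n a ρ (dl n a 1 0) < 1 := by rw [map_zero]; simp [qf]
  obtain ⟨c, hc, hc'⟩ := Metric.mem_nhds_iff.1 ((isOpen_lt hq2 continuous_const).mem_nhds hq0)
  have hc2 : ∀ ξ : EV n, ‖ξ‖ < c → qf n a ρ (dl n a 1 ξ) < 1 := fun ξ hξ => hc' (by simpa using hξ)
  refine core (EV n) (fun m => dl n a (-(m:ℝ))) (fun x => by simp [dl_zero]) (dl_norm n a ha) χ (toE n ψ) Φ lam c hc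
    (fun ξ hξ => ?_) (fun ξ hξ => ?_) (fun m ξ => ?_) v hv0 (fun m ξ => ?_)
  · exact cutf_one _ _ _ _ ((qf_mono n a ha ρ hρ ξ).trans (hc2 ξ hξ).le)
  · show lf ξ = 0
    simp only [lf]; rw [hz1 ξ (hc2 ξ hξ), zero_div]
  · set y := dl n a (-((m + 1 : ℕ) : ℝ)) ξ with hy
    have hy1 : dl n a (-(m:ℝ)) ξ = dl n a 1 y := by
      rw [hy, dl_comp]; congr 1; push_cast; ring_nf
    rw [hy1]
    show (cutf n a ρ y - cutf n a ρ (dl n a 1 y)) / 𝓕 (toE n ψ) y * 𝓕 (toE n ψ) y = cutf n a ρ y - cutf n a ρ (dl n a 1 y)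
    by_cases hn0 : 𝓕 (toE n ψ) y = 0
    · have : cutf n a ρ y - cutf n a ρ (dl n a 1 y) = 0 := by
        by_cases h1 : qf n a ρ y ≤ 9/4
        · by_cases h2 : 1 ≤ qf n a ρ (dl n a 1 y)
          · exact absurd hn0 (hnz y h1 h2)
          · exact hz1 y (by push Not at h2; exact h2)
        · exact hz2 y (by push Not at h1; exact h1)
      rw [this]; simp
    · exact div_mul_cancel₀ _ hn0
  · rw [hv, dS_four]; push_cast; rfl

section GenE
set_option linter.unusedSectionVars false
variable (E : Type) [NormedAddCommGroup E] [InnerProductSpace ℝ E] [FiniteDimensional ℝ E] [MeasurableSpace E] [BorelSpace E]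

lemma dil_bd (A : E →L[ℝ] E) (M : ℝ) (hA : ‖A‖ ≤ M) (hx : ∀ x, ‖x‖ ≤ ‖A x‖) (Ψ P : SE E) (c0 : ℂ)
    (hP : ∀ x, P x = c0 * Ψ (A x)) (p l : ℕ) (x : E) :
    (1 + ‖x‖) ^ p * ‖iteratedFDeriv ℝ l P x‖ ≤ ‖c0‖ * M ^ l * sM E p l Ψ := by
  have hPe : (⇑P) = fun x => c0 • (Ψ ∘ A) x := funext fun x => hP x
  have hs : ContDiff ℝ l (Ψ ∘ A) := ((Ψ.smooth ⊤).comp A.contDiff).of_le (by exact_mod_cast le_top)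
  have h1 : iteratedFDeriv ℝ l P x = c0 • iteratedFDeriv ℝ l (Ψ ∘ A) x := by
    rw [hPe]; exact iteratedFDeriv_const_smul_apply' hs.contDiffAt
  have h2 := A.iteratedFDeriv_comp_right (Ψ.smooth ⊤) x (i := l) (by exact_mod_cast le_top)
  have h3 : ‖iteratedFDeriv ℝ l (Ψ ∘ A) x‖ ≤ ‖iteratedFDeriv ℝ l Ψ (A x)‖ * M ^ l := by
    rw [h2]
    refine (ContinuousMultilinearMap.norm_compContinuousLinearMap_le _ _).trans ?_
    refine mul_le_mul_of_nonneg_left ?_ (norm_nonneg _)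
    simp only [Finset.prod_const, Finset.card_univ, Fintype.card_fin]
    gcongr
  have hM : 0 ≤ M := (norm_nonneg _).trans hA
  rw [h1, norm_smul]
  calc (1 + ‖x‖) ^ p * (‖c0‖ * ‖iteratedFDeriv ℝ l (Ψ ∘ A) x‖)
      ≤ (1 + ‖A x‖) ^ p * (‖c0‖ * (‖iteratedFDeriv ℝ l Ψ (A x)‖ * M ^ l)) := by
        gcongr; exact hx x
    _ = ‖c0‖ * M ^ l * ((1 + ‖A x‖) ^ p * ‖iteratedFDeriv ℝ l Ψ (A x)‖) := by ring
    _ ≤ _ := by gcongr; exact sM_bound E p l Ψ _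

lemma T_dil (T : SE E →L[ℂ] ℂ) (Ψ : SE E) : ∃ C : ℝ, 0 ≤ C ∧ ∃ K : ℕ,
    ∀ (A : E →L[ℝ] E) (M : ℝ), 1 ≤ M → ‖A‖ ≤ M → (∀ x, ‖x‖ ≤ ‖A x‖) → ∀ (P : SE E) (c0 : ℂ),
      (∀ x, P x = c0 * Ψ (A x)) → ∀ y, ‖T (tsl E y P)‖ ≤ C * (‖c0‖ * M ^ K * (1 + ‖y‖) ^ K) := by
  obtain ⟨S, C, hC, hT⟩ := T_bound E T
  let Z : ℝ := ∑ s ∈ S, sM E s.1 s.2 Ψ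
  have hZ : 0 ≤ Z := Finset.sum_nonneg fun s _ => sM_nonneg E _ _ Ψ
  let K : ℕ := ∑ s ∈ S, (s.1 + s.2)
  refine ⟨C * Z, by positivity, K, fun A M hM hA hx P c0 hP y => ?_⟩
  refine (hT _).trans ?_
  rw [mul_assoc]
  refine mul_le_mul_of_nonneg_left ?_ hC
  refine Seminorm.finset_sup_apply_le (by positivity) fun s hs => ?_
  refine SchwartzMap.seminorm_le_bound ℂ s.1 s.2 _ (by positivity) fun x => ?_
  rw [tsl_iterF]
  have hK : s.1 + s.2 ≤ K := Finset.single_le_sum (f := fun s : ℕ × ℕ => s.1 + s.2) (fun _ _ => Nat.zero_le _) hs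
  have hZs : sM E s.1 s.2 Ψ ≤ Z :=
    Finset.single_le_sum (f := fun s : ℕ × ℕ => sM E s.1 s.2 Ψ) (fun s _ => sM_nonneg E _ _ Ψ) hs
  have hs0 := sM_nonneg E s.1 s.2 Ψ
  have hy : 1 ≤ 1 + ‖y‖ := by linarith [norm_nonneg y]
  calc ‖x‖ ^ s.1 * ‖iteratedFDeriv ℝ s.2 P (x - y)‖
      ≤ ((1 + ‖x - y‖) ^ s.1 * (1 + ‖y‖) ^ s.1) * ‖iteratedFDeriv ℝ s.2 P (x - y)‖ := by
        gcongr; exact norm_tri E x y s.1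
    _ = ((1 + ‖x - y‖) ^ s.1 * ‖iteratedFDeriv ℝ s.2 P (x - y)‖) * (1 + ‖y‖) ^ s.1 := by ring
    _ ≤ (‖c0‖ * M ^ s.2 * sM E s.1 s.2 Ψ) * (1 + ‖y‖) ^ s.1 := by
        exact mul_le_mul_of_nonneg_right (dil_bd E A M hA hx Ψ P c0 hP s.1 s.2 _) (by positivity)
    _ ≤ (‖c0‖ * M ^ K * Z) * (1 + ‖y‖) ^ K := by
        gcongr
        · omega
        · omega
    _ = _ := by ring

end GenE

/-- reflection-translation -/
def rf (n : ℕ) (y : EV n) : SE (EV n) →L[ℂ] SE (EV n) :=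
  (SchwartzMap.compSubConstCLM ℂ y).comp
    (SchwartzMap.compCLMOfContinuousLinearEquiv ℂ (ContinuousLinearEquiv.neg ℝ))

def ng (n : ℕ) (φ : SE (EV n)) : SE (EV n) :=
  SchwartzMap.compCLMOfContinuousLinearEquiv ℂ (ContinuousLinearEquiv.neg ℝ (M := EV n)) φ

lemma ng_apply (n : ℕ) (φ : SE (EV n)) (x : EV n) : ng n φ x = φ (-x) := rfl

lemma rf_eq (n : ℕ) (y : EV n) (φ : SE (EV n)) : rf n y φ = tsl (EV n) y (ng n φ) := rfl

lemma rf_apply (n : ℕ) (y : EV n) (φ : SE (EV n)) (x : EV n) : rf n y φ x = φ (y - x) := by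
  rw [rf_eq, SchwartzMap.compSubConstCLM_apply, ng_apply, neg_sub]

lemma rf_tsl (n : ℕ) (a : Fin n → ℝ) (t : ℝ) (y w : EV n) (φ : SE (EV n)) :
    rf n y (dS n a t (tsl (EV n) w φ)) = rf n (y - dl n a (-t) w) (dS n a t φ) := by
  ext x
  rw [rf_apply, rf_apply, dS_apply, dS_apply, SchwartzMap.compSubConstCLM_apply]
  congr 2
  have : dl n a t (dl n a (-t) w) = w := by rw [dl_comp, add_neg_cancel, dl_zero]
  rw [sub_right_comm, map_sub (dl n a t) (y - x), this]

/-- the family on the Euclidean model -/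
def fS (n : ℕ) (a : Fin n → ℝ) (ψ0 ψ : SE (EV n)) : ℕ → SE (EV n)
  | 0 => ψ0
  | k + 1 => dS n a ((k:ℝ) + 1) ψ

/-- the modulus functions -/
def uu (n : ℕ) (a : Fin n → ℝ) (ψ0 ψ : SE (EV n)) (T : SE (EV n) →L[ℂ] ℂ) (k : ℕ) (x : RV n) : ℝ≥0∞ :=
  ‖T (rf n (WithLp.toLp 2 x) (fS n a ψ0 ψ k))‖ₑ

lemma uu_meas (n : ℕ) (a : Fin n → ℝ) (ψ0 ψ : SE (EV n)) (T : SE (EV n) →L[ℂ] ℂ) (k : ℕ) :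
    Measurable (uu n a ψ0 ψ T k) := by
  have h1 := (T_comm (EV n) T (ng n (fS n a ψ0 ψ k))).1
  have h2 : Continuous fun x : RV n => T (rf n (WithLp.toLp 2 x) (fS n a ψ0 ψ k)) :=
    h1.comp (PiLp.continuous_toLp 2 _)
  exact h2.measurable.enorm

lemma ev_norm_le (n : ℕ) (x : EV n) : 1 + ‖x‖ ≤ ∏ l, (1 + |x l|) := by
  have h1 : ‖x‖ ≤ ∑ l, |x l| := by
    rw [EuclideanSpace.norm_eq]
    refine Real.sqrt_le_iff.2 ⟨Finset.sum_nonneg fun _ _ => abs_nonneg _, ?_⟩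
    simp only [Real.norm_eq_abs]
    exact Finset.sum_sq_le_sq_sum_of_nonneg fun _ _ => abs_nonneg _
  have h2 : ∀ s : Finset (Fin n), 1 + ∑ l ∈ s, |x l| ≤ ∏ l ∈ s, (1 + |x l|) := by
    intro s
    induction s using Finset.induction_on with
    | empty => simp
    | insert i s hi ih =>
      rw [Finset.sum_insert hi, Finset.prod_insert hi]
      have h3 : 0 ≤ ∑ l ∈ s, |x l| := Finset.sum_nonneg fun _ _ => abs_nonneg _
      have h4 := abs_nonneg (x i)
      nlinarith [mul_le_mul_of_nonneg_left ih (by linarith : 0 ≤ 1 + |x i|), mul_nonneg h4 h3]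
  linarith [h2 Finset.univ]

lemma ev_norm_ge (n : ℕ) (x : EV n) : ∏ l, (1 + |x l|) ≤ (1 + ‖x‖) ^ n := by
  have h2 : ∀ l : Fin n, |x l| ≤ ‖x‖ := fun l => by
    have := PiLp.norm_apply_le x l
    rwa [Real.norm_eq_abs] at this
  calc _ ≤ ∏ _l : Fin n, (1 + ‖x‖) := by
        refine Finset.prod_le_prod (fun l _ => by positivity) fun l _ => by linarith [h2 l]
    _ = _ := by simp

lemma dl_opnorm (n : ℕ) (a : Fin n → ℝ) (ha : ∀ i, 1 ≤ a i) (k : ℕ) :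
    ‖(dl n a (k:ℝ)).toContinuousLinearMap‖ ≤ (2:ℝ) ^ ((k:ℝ) * ∑ i, a i) := by
  refine ContinuousLinearMap.opNorm_le_bound _ (by positivity) fun x => ?_
  have h0 : (0:ℝ) ≤ (2:ℝ) ^ ((k:ℝ) * ∑ i, a i) := by positivity
  show ‖dl n a k x‖ ≤ _
  rw [EuclideanSpace.norm_eq, EuclideanSpace.norm_eq, ← Real.sqrt_sq h0, ← Real.sqrt_mul (by positivity),
    Finset.mul_sum]
  refine Real.sqrt_le_sqrt (Finset.sum_le_sum fun i _ => ?_)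
  rw [dl_apply, norm_mul, mul_pow]
  refine mul_le_mul_of_nonneg_right ?_ (by positivity)
  rw [Real.norm_of_nonneg (by positivity)]
  have : a i ≤ ∑ i, a i := Finset.single_le_sum (f := a) (fun i _ => by linarith [ha i]) (Finset.mem_univ i)
  gcongr
  norm_num

lemma uu_gr (n : ℕ) (a : Fin n → ℝ) (ha : ∀ i, 1 ≤ a i) (φ : SE (EV n)) (T : SE (EV n) →L[ℂ] ℂ) :
    ∃ C : ℝ, 0 ≤ C ∧ ∃ A : ℝ, 0 ≤ A ∧ ∀ (k : ℕ) (y : EV n),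
      ‖T (rf n y (dS n a k φ))‖ ≤ C * ((2:ℝ) ^ ((k:ℝ) * A) * (∏ l, (1 + |y l|)) ^ A) := by
  obtain ⟨C, hC, K, hK⟩ := T_dil (EV n) T (ng n φ)
  have hs : 0 ≤ ∑ i, a i := Finset.sum_nonneg fun i _ => by linarith [ha i]
  refine ⟨C, hC, (∑ i, a i) * (K + 1) + K, by positivity, fun k y => ?_⟩
  have h1 := hK (dl n a (k:ℝ)).toContinuousLinearMap ((2:ℝ) ^ ((k:ℝ) * ∑ i, a i))
    (Real.one_le_rpow (by norm_num) (by positivity)) (dl_opnorm n a ha k) (fun x => ?_) (ng n (dS n a k φ))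
    (((2:ℝ) ^ ((k:ℝ) * ∑ i, a i) : ℝ) : ℂ) (fun x => ?_) y
  · rw [rf_eq]
    refine h1.trans (mul_le_mul_of_nonneg_left ?_ hC)
    have h2 := ev_norm_le n y
    have h3 : (1:ℝ) ≤ ∏ l, (1 + |y l|) := by linarith [norm_nonneg y]
    refine mul_le_mul ?_ ?_ (by positivity) (by positivity)
    · rw [Complex.norm_real, Real.norm_of_nonneg (by positivity), ← pow_succ', ← Real.rpow_natCast, ← Real.rpow_mul (by norm_num)]
      refine Real.rpow_le_rpow_of_exponent_le (by norm_num) ?_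
      push_cast
      have : (0:ℝ) ≤ (k:ℝ) * K := by positivity
      nlinarith
    · calc (1 + ‖y‖) ^ K ≤ (∏ l, (1 + |y l|)) ^ K := by gcongr
        _ = (∏ l, (1 + |y l|)) ^ (K:ℝ) := (Real.rpow_natCast _ _).symm
        _ ≤ _ := by
          refine Real.rpow_le_rpow_of_exponent_le h3 ?_
          have : 0 ≤ (∑ i, a i) * ((K:ℝ) + 1) := by positivity
          linarith
  · show ‖x‖ ≤ ‖dl n a k x‖
    have h2 := dl_norm n a ha k (dl n a k x)
    rw [dl_comp, neg_add_cancel, dl_zero] at h2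
    refine h2.trans (mul_le_of_le_one_left (norm_nonneg _) ?_)
    exact inv_le_one_of_one_le₀ (one_le_pow₀ (by norm_num))
  · rw [ng_apply, dS_apply]
    show _ = _ * φ (-(dl n a k x))
    rw [map_neg]

lemma Wk_zero_eq (n : ℕ) (a : Fin n → ℝ) (A : ℝ) (y : RV n) :
    Wk n a (fun _ => A) 0 0 y = ENNReal.ofReal ((∏ l, (1 + |y l|)) ^ (-A)) := by
  rw [Wk, ← Real.finsetProd_rpow _ _ (fun l _ => by positivity), ENNReal.ofReal_prod_of_nonneg (fun l _ => by positivity)]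
  refine Finset.prod_congr rfl fun l _ => ?_
  simp [wk]

lemma uu_Hg (n : ℕ) (a : Fin n → ℝ) (ha : ∀ i, 1 ≤ a i) (ψ0 ψ : SE (EV n)) (T : SE (EV n) →L[ℂ] ℂ) :
    ∃ Cf : ℝ≥0∞, Cf ≠ ∞ ∧ ∃ A : ℝ, 0 ≤ A ∧ ∀ k y,
      uu n a ψ0 ψ T k y * Wk n a (fun _ => A) 0 0 y ≤ Cf * p2 (k * A) := by
  obtain ⟨C1, hC1, A1, hA1, h1⟩ := uu_gr n a ha ψ0 T
  obtain ⟨C2, hC2, A2, hA2, h2⟩ := uu_gr n a ha ψ T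
  refine ⟨ENNReal.ofReal (C1 + C2), ENNReal.ofReal_ne_top, A1 + A2, by positivity, fun k y => ?_⟩
  have key : ‖T (rf n (WithLp.toLp 2 y) (fS n a ψ0 ψ k))‖ ≤
      (C1 + C2) * ((2:ℝ) ^ ((k:ℝ) * (A1 + A2)) * (∏ l, (1 + |y l|)) ^ (A1 + A2)) := by
    have h3 : (1:ℝ) ≤ ∏ l, (1 + |y l|) := by
      have h4 := ev_norm_le n (WithLp.toLp 2 y)
      exact (le_add_of_nonneg_right (norm_nonneg _)).trans h4
    have h12 : (1:ℝ) ≤ 2 := by norm_num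
    cases k with
    | zero =>
      have := h1 0 (WithLp.toLp 2 y)
      rw [Nat.cast_zero, dS_zero] at this
      refine this.trans ?_
      rw [Nat.cast_zero, zero_mul, zero_mul]
      refine mul_le_mul (by linarith) ?_ (by positivity) (by positivity)
      refine mul_le_mul_of_nonneg_left ?_ (by positivity)
      exact Real.rpow_le_rpow_of_exponent_le h3 (by linarith)
    | succ k =>
      have := h2 (k + 1) (WithLp.toLp 2 y)
      have he : fS n a ψ0 ψ (k + 1) = dS n a ((k + 1 : ℕ) : ℝ) ψ := by push_cast; rfl
      rw [he]
      refine this.trans ?_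
      refine mul_le_mul (by linarith) ?_ (by positivity) (by positivity)
      refine mul_le_mul ?_ (Real.rpow_le_rpow_of_exponent_le h3 (by linarith)) (by positivity) (by positivity)
      refine Real.rpow_le_rpow_of_exponent_le h12 ?_
      refine mul_le_mul_of_nonneg_left (by linarith) (by positivity)
  have hpos : (0:ℝ) < ∏ l, (1 + |y l|) := Finset.prod_pos fun l _ => by positivity
  rw [Wk_zero_eq, uu, ← ofReal_norm, p2, ← ENNReal.ofReal_mul (norm_nonneg _),
    ← ENNReal.ofReal_mul (by positivity)]
  refine ENNReal.ofReal_le_ofReal ?_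
  calc _ ≤ ((C1 + C2) * ((2:ℝ) ^ ((k:ℝ) * (A1 + A2)) * (∏ l, (1 + |y l|)) ^ (A1 + A2))) * (∏ l, (1 + |y l|)) ^ (-(A1 + A2)) := by
        gcongr
    _ = (C1 + C2) * (2:ℝ) ^ ((k:ℝ) * (A1 + A2)) * ((∏ l, (1 + |y l|)) ^ (A1 + A2) * (∏ l, (1 + |y l|)) ^ (-(A1 + A2))) := by ring
    _ = _ := by rw [← Real.rpow_add hpos]; simp

/-- unscaled weight -/
def W0 (n : ℕ) (R : ℝ) (w : EV n) : ℝ≥0∞ := ∏ l, ENNReal.ofReal ((1 + |w l|) ^ (-R))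

lemma W0_dl (n : ℕ) (a : Fin n → ℝ) (R : ℝ) (j : ℕ) (y z : RV n) :
    W0 n R (dl n a j (WithLp.toLp 2 y - WithLp.toLp 2 z)) = Wk n a (fun _ => R) j y z := by
  refine Finset.prod_congr rfl fun l _ => ?_
  rw [dl_apply, abs_mul, abs_of_pos (by positivity : (0:ℝ) < 2 ^ ((j:ℝ) * a l))]
  rfl

lemma cov (n : ℕ) (a : Fin n → ℝ) (R : ℝ) (j : ℕ) (y : RV n) (g : RV n → ℝ≥0∞) :
    ∫⁻ w : EV n, W0 n R w * g (WithLp.ofLp (WithLp.toLp 2 y - dl n a (-(j:ℝ)) w)) =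
      ∫⁻ z, Kp n a (fun _ => R) j y z * g z := by
  have h1 := dl_lint n a (-(j:ℝ)) (fun w' => W0 n R (dl n a j w') * g (WithLp.ofLp (WithLp.toLp 2 y - w')))
  simp only [dl_comp, add_neg_cancel, dl_zero, neg_neg] at h1
  rw [h1]
  have h2 := lintegral_sub_left_eq_self (μ := (volume : Measure (EV n)))
    (fun w' => W0 n R (dl n a j w') * g (WithLp.ofLp (WithLp.toLp 2 y - w'))) (WithLp.toLp 2 y)
  rw [← h2]
  have h3 := (EuclideanSpace.volume_preserving_symm_measurableEquiv_toLp (Fin n)).lintegral_comp_emb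
    (MeasurableEquiv.measurableEmbedding _)
    (fun z : RV n => Wk n a (fun _ => R) j y z * g z)
  simp only [Kp_eq, mul_assoc]
  rw [lintegral_const_mul' _ _ (p2_ne_top _), ← h3]
  congr 1
  refine lintegral_congr fun x => ?_
  rw [sub_sub_cancel]
  congr 1
  exact W0_dl n a R j y (WithLp.ofLp x)

lemma kap_dec (n : ℕ) (R L : ℝ) (hR : 0 ≤ R) (κ : ℕ → SE (EV n))
    (h : ∀ N L : ℕ, ∃ C : ℝ, 0 ≤ C ∧ ∀ m x, (1 + ‖x‖) ^ N * ‖κ m x‖ ≤ C * ((2 ^ m)⁻¹) ^ L) :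
    ∃ C : ℝ≥0∞, C ≠ ∞ ∧ ∀ m x, ‖κ m x‖ₑ ≤ C * (p2 (-(m:ℝ) * L) * W0 n R x) := by
  obtain ⟨C, hC, hb⟩ := h (n * ⌈R⌉₊) ⌈L⌉₊
  refine ⟨ENNReal.ofReal C, ENNReal.ofReal_ne_top, fun m x => ?_⟩
  have hpp : (0:ℝ) < ∏ l, (1 + |x l|) := Finset.prod_pos fun l _ => by positivity
  have h1p : (1:ℝ) ≤ ∏ l, (1 + |x l|) := (le_add_of_nonneg_right (norm_nonneg _)).trans (ev_norm_le n x)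
  have hW : W0 n R x = ENNReal.ofReal ((∏ l, (1 + |x l|)) ^ (-R)) := by
    rw [W0, ← Real.finsetProd_rpow _ _ (fun l _ => by positivity), ENNReal.ofReal_prod_of_nonneg (fun l _ => by positivity)]
  rw [hW, p2, ← ofReal_norm, ← ENNReal.ofReal_mul (by positivity), ← ENNReal.ofReal_mul hC]
  refine ENNReal.ofReal_le_ofReal ?_
  have h2 : (∏ l, (1 + |x l|)) ^ R ≤ (1 + ‖x‖) ^ (n * ⌈R⌉₊) := by
    calc (∏ l, (1 + |x l|)) ^ R ≤ (∏ l, (1 + |x l|)) ^ (⌈R⌉₊ : ℝ) :=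
          Real.rpow_le_rpow_of_exponent_le h1p (Nat.le_ceil R)
      _ = (∏ l, (1 + |x l|)) ^ ⌈R⌉₊ := Real.rpow_natCast _ _
      _ ≤ ((1 + ‖x‖) ^ n) ^ ⌈R⌉₊ := by gcongr; exact ev_norm_ge n x
      _ = _ := (pow_mul _ _ _).symm
  have h3 : (((2:ℝ) ^ m)⁻¹) ^ ⌈L⌉₊ ≤ (2:ℝ) ^ (-(m:ℝ) * L) := by
    rw [inv_pow, ← pow_mul, ← Real.rpow_natCast, ← Real.rpow_neg (by norm_num)]
    refine Real.rpow_le_rpow_of_exponent_le (by norm_num) ?_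
    push_cast
    have : (m:ℝ) * L ≤ m * ⌈L⌉₊ := mul_le_mul_of_nonneg_left (Nat.le_ceil L) (by positivity)
    linarith
  have h4 : (∏ l, (1 + |x l|)) ^ R * ‖κ m x‖ ≤ C * (2:ℝ) ^ (-(m:ℝ) * L) := by
    calc _ ≤ (1 + ‖x‖) ^ (n * ⌈R⌉₊) * ‖κ m x‖ := by gcongr
      _ ≤ _ := (hb m x).trans (mul_le_mul_of_nonneg_left h3 hC)
  rw [Real.rpow_neg hpp.le, ← mul_assoc, ← div_eq_mul_inv, le_div_iff₀ (by positivity), mul_comm]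
  exact h4

lemma H1one (n : ℕ) (a : Fin n → ℝ) (ha : ∀ i, 1 ≤ a i) (anorm : RV n → ℝ) (h : IsAnorm n a anorm)
    (ψ0 ψ : SchwartzMap (RV n) ℂ) (ε : ℝ) (hε : 0 < ε)
    (hT : ∀ ξ, ε / 2 < anorm ξ → anorm ξ < 2 * ε → 0 < ‖FT n ψ ξ‖) (χ : SE (EV n)) (J : Set ℕ)
    (hJ : ∀ j ∈ J, dS n a j χ = fS n a (toE n ψ0) (toE n ψ) j) (R L : ℝ) (hR : 0 ≤ R) :
    ∃ C : ℝ≥0∞, C ≠ ∞ ∧ ∀ T : SE (EV n) →L[ℂ] ℂ, ∀ j ∈ J, ∀ y,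
      uu n a (toE n ψ0) (toE n ψ) T j y ≤ C * SS n a L (fun _ => R) (uu n a (toE n ψ0) (toE n ψ) T) j y := by
  let v : ℕ → SE (EV n) := fS n a χ (toE n ψ)
  have hv : ∀ j ∈ J, ∀ m : ℕ, dS n a j (v m) = fS n a (toE n ψ0) (toE n ψ) (j + m) := by
    intro j hj m
    cases m with
    | zero => exact hJ j hj
    | succ m =>
      show dS n a j (dS n a ((m:ℝ) + 1) (toE n ψ)) = dS n a (((j + m : ℕ) : ℝ) + 1) (toE n ψ)
      rw [dS_comp]; push_cast; rw [add_assoc]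
  obtain ⟨κ, hκ, hlim⟩ := kern n a ha anorm h ψ ε hε hT χ v rfl (fun m => rfl)
  obtain ⟨C, hC, hb⟩ := kap_dec n R L hR κ hκ
  refine ⟨C, hC, fun T j hj y => ?_⟩
  set u := uu n a (toE n ψ0) (toE n ψ) T with hu
  let T' : SE (EV n) →L[ℂ] ℂ := T.comp ((rf n (WithLp.toLp 2 y)).comp (dS n a j))
  have hT' : ∀ (m : ℕ) (w : EV n), ‖T' (tsl (EV n) w (v m))‖ₑ =
      u (j + m) (WithLp.ofLp (WithLp.toLp 2 y - dl n a (-(j:ℝ)) w)) := by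
    intro m w
    show ‖T (rf n (WithLp.toLp 2 y) (dS n a j (tsl (EV n) w (v m))))‖ₑ = _
    rw [rf_tsl, hv j hj]
    rfl
  have h0 : u j y = ‖T' χ‖ₑ := by
    show _ = ‖T (rf n (WithLp.toLp 2 y) (dS n a j χ))‖ₑ
    rw [hJ j hj]; rfl
  rw [h0]
  refine le_of_tendsto' (hlim T').enorm fun M => ?_
  refine (enorm_sum_le _ _).trans ?_
  rw [SS, ← ENNReal.tsum_mul_left]
  refine le_trans (Finset.sum_le_sum fun m _ => ?_) (ENNReal.sum_le_tsum (Finset.range (M + 1)))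
  refine (enorm_integral_le_lintegral_enorm _).trans ?_
  calc _ ≤ ∫⁻ w : EV n, (C * p2 (-(m:ℝ) * L)) * (W0 n R w * u (j + m) (WithLp.ofLp (WithLp.toLp 2 y - dl n a (-(j:ℝ)) w))) := by
        refine lintegral_mono fun w => ?_
        beta_reduce
        rw [enorm_mul, hT', ← mul_assoc]
        refine mul_le_mul' ?_ le_rfl
        rw [mul_assoc]
        exact hb m w
    _ = _ := by
        rw [lintegral_const_mul' _ _ (ENNReal.mul_ne_top hC (p2_ne_top _)), cov, mul_assoc]

lemma H1all (n : ℕ) (a : Fin n → ℝ) (ha : ∀ i, 1 ≤ a i) (anorm : RV n → ℝ) (h : IsAnorm n a anorm)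
    (ψ0 ψ : SchwartzMap (RV n) ℂ) (ε : ℝ) (hε : 0 < ε)
    (hT : ∀ ξ, ε / 2 < anorm ξ → anorm ξ < 2 * ε → 0 < ‖FT n ψ ξ‖) (R L : ℝ) (hR : 0 ≤ R) :
    ∃ C : ℝ≥0∞, C ≠ ∞ ∧ ∀ T : SE (EV n) →L[ℂ] ℂ, ∀ j y,
      uu n a (toE n ψ0) (toE n ψ) T j y ≤ C * SS n a L (fun _ => R) (uu n a (toE n ψ0) (toE n ψ) T) j y := by
  obtain ⟨C1, hC1, h1⟩ := H1one n a ha anorm h ψ0 ψ ε hε hT (toE n ψ0) {0}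
    (fun j hj => by rw [Set.mem_singleton_iff.1 hj, Nat.cast_zero, dS_zero]; rfl) R L hR
  obtain ⟨C2, hC2, h2⟩ := H1one n a ha anorm h ψ0 ψ ε hε hT (toE n ψ) {j | 0 < j}
    (fun j hj => by
      cases j with
      | zero => exact absurd hj (lt_irrefl 0)
      | succ j => push_cast; rfl) R L hR
  refine ⟨C1 + C2, ENNReal.add_ne_top.2 ⟨hC1, hC2⟩, fun T j y => ?_⟩
  rcases Nat.eq_zero_or_pos j with hj | hj
  · exact (h1 T j hj y).trans (mul_le_mul' le_self_add le_rfl)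
  · exact (h2 T j hj y).trans (mul_le_mul' le_add_self le_rfl)

lemma fS_fam (n : ℕ) (a : Fin n → ℝ) (ψ0 ψ : SchwartzMap (RV n) ℂ) (k : ℕ) (x : RV n) :
    fS n a (toE n ψ0) (toE n ψ) k (WithLp.toLp 2 x) = fam n a ψ0 ψ k x := by
  cases k with
  | zero => rfl
  | succ k => rfl

lemma pfs_eq (n : ℕ) (a r : Fin n → ℝ) (F : RV n → ℂ) (j : ℕ) (x : RV n) :
    pfs n a r F j x = ⨆ y, ‖F y‖ₑ * Wk n a r j x y := by
  unfold pfs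
  congr 1; ext1 y
  rw [Wk, ← ofReal_norm]
  simp only [wk]
  rw [← ENNReal.ofReal_prod_of_nonneg (fun l _ => by positivity), ← ENNReal.ofReal_mul (norm_nonneg _), div_eq_mul_inv,
    ← Finset.prod_inv_distrib]
  congr 2
  refine Finset.prod_congr rfl fun l _ => ?_
  rw [Real.rpow_neg (by positivity)]

/-- Theorem 3.9 (`inverse`), maximal functions controlled by convolutions. -/
theorem stmt15 (n : ℕ) (hn : 1 ≤ n) (a : Fin n → ℝ) (ha : ∀ i, 1 ≤ a i)
    (anorm : RV n → ℝ) (h : IsAnorm n a anorm)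
    (conv : TD n → (RV n → ℂ) → RV n → ℂ)
    (hconv : ∀ (f : TD n) (g : RV n → ℂ) (x : RV n) (Ψ : SchwartzMap (RV n) ℂ),
      (∀ y, Ψ y = g (x - y)) → conv f g x = f Ψ)
    (ψ0 ψ : SchwartzMap (RV n) ℂ) (ε : ℝ) (hε : 0 < ε)
    (hT : Tauber n anorm (⇑ψ0) (⇑ψ) ε)
    (p : Fin n → ℝ≥0∞) (hp : ∀ i, 0 < p i ∧ p i ≠ ∞) (q : ℝ≥0∞) (hq : 0 < q)
    (s : ℝ) (r : Fin n → ℝ)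
    (hr : ∀ l, 1 < ENNReal.ofReal (r l) * min q (⨅ i, p i)) :
    ∃ c : ℝ, 0 < c ∧
      ∀ f : TD n,
        seqNorm n p q
            (fun j x => ENNReal.ofReal ((2:ℝ) ^ ((j:ℝ) * s)) *
              pfs n a r (conv f (fam n a (⇑ψ0) (⇑ψ) j)) j x)
          ≤ ENNReal.ofReal c *
            seqNorm n p q
              (fun j x => ENNReal.ofReal ((2:ℝ) ^ ((j:ℝ) * s)) *
                (‖conv f (fam n a (⇑ψ0) (⇑ψ) j) x‖₊ : ℝ≥0∞)) := by
  have hcv : ∀ (f : TD n) k x, (‖conv f (fam n a ψ0 ψ k) x‖ₑ : ℝ≥0∞) =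
      uu n a (toE n ψ0) (toE n ψ) (f.comp (toR n)) k x := by
    intro f k x
    rw [hconv f _ x (toR n (rf n (WithLp.toLp 2 x) (fS n a (toE n ψ0) (toE n ψ) k)))]
    · rfl
    · intro y
      rw [toR_apply, rf_apply, ← fS_fam]; rfl
  obtain ⟨C, hC, hb⟩ := assemble n hn a (fun l => by linarith [ha l]) p hp q hq s r hr
    (Set.range fun f : TD n => uu n a (toE n ψ0) (toE n ψ) (f.comp (toR n)))
    (fun R L hR => by
      obtain ⟨C, hC, hb⟩ := H1all n a ha anorm h ψ0 ψ ε hε hT.2 R L hR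
      exact ⟨C, hC, by rintro _ ⟨f, rfl⟩ j y; exact hb _ j y⟩)
    (by rintro _ ⟨f, rfl⟩; exact uu_Hg n a ha _ _ _)
    (by rintro _ ⟨f, rfl⟩ k; exact uu_meas n a _ _ _ k)
  refine ⟨C.toReal + 1, by positivity, fun f => ?_⟩
  have h1 := hb _ ⟨f, rfl⟩
  simp only [pfs_eq, hcv]
  refine (h1.trans ?_)
  have h2 : C ≤ ENNReal.ofReal (C.toReal + 1) := by
    rw [← ENNReal.ofReal_toReal hC]
    exact ENNReal.ofReal_le_ofReal (by simp)
  refine mul_le_mul' h2 (le_of_eq ?_)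
  congr 1
  ext j x
  beta_reduce
  rw [← hcv]; rfl
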